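/- arXiv:1209.3882 — 7 statements merged into one kernel-verified Lean document; each statement's English description precedes it below -/
import Mathlib

section
/- Let n ≥ 2 and let A ∈ M_n(ℝ) be a 1-decomposable matrix that is diagonally similar to a matrix with all entries nonnegative. Suppose there exist proper cones K ⊆ ℝ₊^n and L ⊆ ℝ₊^n such that A(K) ⊆ K and Aᵀ(L) ⊆ L. Then A itself has all entries nonnegative. -/
open Matrix

/-- A matrix is decomposable if some simultaneous permutation of rows and columns puts it in
block upper-triangular form with two nonempty square diagonal blocks. -/
def Decomposable {n : ℕ} {α : Type*} [Zero α] (A : Matrix (Fin n) (Fin n) α) : Prop :=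
  ∃ σ : Equiv.Perm (Fin n), ∃ k : ℕ, 0 < k ∧ k < n ∧
    ∀ i j : Fin n, k ≤ (i : ℕ) → (j : ℕ) < k → A (σ i) (σ j) = 0

/-- A matrix is 1-decomposable if some simultaneous permutation of rows and columns puts it in
block upper-triangular form `[[A₁, B], [0, A₂]]` where each square diagonal block `A₁`, `A₂` is
indecomposable or a `1 × 1` block (a `1 × 1` block is never decomposable, so this is just
indecomposability of both diagonal blocks). -/
def OneDecomposable {n : ℕ} {α : Type*} [Zero α] (A : Matrix (Fin n) (Fin n) α) : Prop :=
  ∃ σ : Equiv.Perm (Fin n), ∃ k : ℕ, 0 < k ∧ ∃ hk : k < n,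
    (∀ i j : Fin n, k ≤ (i : ℕ) → (j : ℕ) < k → A (σ i) (σ j) = 0) ∧
    ¬ Decomposable (Matrix.of fun i j : Fin k =>
        A (σ (Fin.castLE hk.le i)) (σ (Fin.castLE hk.le j))) ∧
    ¬ Decomposable (Matrix.of fun i j : Fin (n - k) =>
        A (σ ⟨k + (i : ℕ), by have := i.isLt; omega⟩)
          (σ ⟨k + (j : ℕ), by have := j.isLt; omega⟩))

/-- A proper cone in `ℝⁿ`: a closed convex cone that is pointed (`K ∩ (−K) = {0}`) and solid
(nonempty interior). -/
def IsProperCone {n : ℕ} (K : Set (Fin n → ℝ)) : Prop :=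
  (0 : Fin n → ℝ) ∈ K ∧ (∀ x ∈ K, ∀ y ∈ K, x + y ∈ K) ∧
  (∀ r : ℝ, 0 ≤ r → ∀ x ∈ K, r • x ∈ K) ∧ IsClosed K ∧
  (∀ x ∈ K, -x ∈ K → x = 0) ∧ (interior K).Nonempty

/-- A neighbourhood of some point is mapped into the nonnegative orthant by all powers of `M`. -/
def NonnegOrbits {ι : Type*} [Fintype ι] [DecidableEq ι] (M : Matrix ι ι ℝ) : Prop :=
  ∃ x : ι → ℝ, ∃ ε > 0, ∀ z : ι → ℝ, (∀ i, |z i - x i| ≤ ε) → ∀ (m : ℕ) i, 0 ≤ ((M ^ m) *ᵥ z) i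

lemma NonnegOrbits.pow {ι : Type*} [Fintype ι] [DecidableEq ι] {M : Matrix ι ι ℝ}
    (h : NonnegOrbits M) (r : ℕ) : NonnegOrbits (M ^ r) := by
  obtain ⟨x, ε, hε, hz⟩ := h
  refine ⟨x, ε, hε, fun z hzx m i => ?_⟩
  rw [← pow_mul]
  exact hz z hzx _ i

lemma NonnegOrbits.comp {ι κ : Type*} [Fintype ι] [DecidableEq ι] [Fintype κ] [DecidableEq κ]
    {M : Matrix ι ι ℝ} (h : NonnegOrbits M) {M' : Matrix κ κ ℝ} {f : κ → ι}
    (hf : Function.Injective f) (hM : ∀ z, (M *ᵥ z) ∘ f = M' *ᵥ (z ∘ f)) :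
    NonnegOrbits M' := by
  obtain ⟨x, ε, hε, hz⟩ := h
  have hpow : ∀ (m : ℕ) z, ((M ^ m) *ᵥ z) ∘ f = (M' ^ m) *ᵥ (z ∘ f) := by
    intro m
    induction m with
    | zero => simp
    | succ m ih =>
      intro z
      rw [pow_succ, pow_succ, ← mulVec_mulVec, ← mulVec_mulVec, ih, hM]
  refine ⟨x ∘ f, ε, hε, fun z hzx m i => ?_⟩
  have hext : Function.extend f z x ∘ f = z := by
    funext j
    simp [hf.extend_apply]
  have h1 := hz (Function.extend f z x) (fun l => by
    by_cases hl : ∃ j, f j = l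
    · obtain ⟨j, rfl⟩ := hl
      simpa [hf.extend_apply] using hzx j
    · simp [Function.extend_apply' _ _ _ hl, hε.le]) m (f i)
  have h2 := congrFun (hpow m (Function.extend f z x)) i
  rw [hext] at h2
  rw [← h2]
  exact h1

lemma IsProperCone.nonnegOrbits {n : ℕ} {A : Matrix (Fin n) (Fin n) ℝ} {K : Set (Fin n → ℝ)}
    (hK : IsProperCone K) (hKpos : ∀ x ∈ K, ∀ i, 0 ≤ x i) (hKinv : ∀ x ∈ K, A *ᵥ x ∈ K) :
    NonnegOrbits (1 + A) := by
  obtain ⟨-, hadd, -, -, -, x, hx⟩ := hK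
  obtain ⟨ε, hε, hball⟩ := Metric.nhds_basis_closedBall.mem_iff.1 (mem_interior_iff_mem_nhds.1 hx)
  refine ⟨x, ε, hε, fun z hz m => hKpos _ ?_⟩
  induction m with
  | zero =>
    rw [pow_zero, one_mulVec]
    refine hball ((dist_pi_le_iff hε.le).2 fun i => ?_)
    rw [Real.dist_eq]
    exact hz i
  | succ m ih =>
    rw [pow_succ', ← mulVec_mulVec, add_mulVec, one_mulVec]
    exact hadd _ ih _ (hKinv _ ih)

lemma exists_mul_le_of_pos {ι : Type*} [Finite ι] [Nonempty ι] (g : ι → ℝ) (hg : ∀ i, 0 < g i) :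
    ∃ c : ℝ, 0 < c ∧ c ≤ 1 ∧ ∀ i j, c * g i ≤ g j := by
  obtain ⟨a, ha⟩ := Finite.exists_min g
  obtain ⟨b, hb⟩ := Finite.exists_max g
  refine ⟨g a / g b, div_pos (hg a) (hg b), (div_le_one (hg b)).2 (ha b), fun i j => ?_⟩
  calc g a / g b * g i ≤ g a / g b * g b :=
        mul_le_mul_of_nonneg_left (hb i) (div_pos (hg a) (hg b)).le
    _ = g a := div_mul_cancel₀ _ (hg b).ne'
    _ ≤ g j := ha j

/-- The ratios `(Nᵐ u)ᵢ / (Nᵐ 1)ᵢ` of a positive matrix `N` merge as `m → ∞`. -/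
lemma exists_ratio_bounds_of_pos {κ : Type*} [Fintype κ] [DecidableEq κ] [Nonempty κ]
    {N : Matrix κ κ ℝ} (hN : ∀ i j, 0 < N i j) (u : κ → ℝ) {δ : ℝ} (hδ : 0 < δ) :
    ∃ (m : ℕ) (a b : ℝ), a - b < δ ∧ ∀ i, 0 < ((N ^ m) *ᵥ 1) i ∧
      b * ((N ^ m) *ᵥ 1) i ≤ ((N ^ m) *ᵥ u) i ∧ ((N ^ m) *ᵥ u) i ≤ a * ((N ^ m) *ᵥ 1) i := by
  obtain ⟨c, hc0, hc1, hc⟩ := exists_mul_le_of_pos (fun p : κ × κ => N p.1 p.2) fun p => hN _ _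
  have hsucc : ∀ (v : κ → ℝ) (m : ℕ) i,
      ((N ^ (m + 1)) *ᵥ v) i = ∑ k, N i k * ((N ^ m) *ᵥ v) k := by
    intro v m i
    rw [pow_succ', ← mulVec_mulVec]
    rfl
  have hRpos : ∀ m i, 0 < ((N ^ m) *ᵥ (1 : κ → ℝ)) i := by
    intro m
    induction m with
    | zero => simp
    | succ m ih =>
      intro i
      rw [hsucc]
      exact Finset.sum_pos (fun k _ => mul_pos (hN i k) (ih k)) Finset.univ_nonempty
  have hRcomp : ∀ m i j, c * ((N ^ m) *ᵥ (1 : κ → ℝ)) i ≤ ((N ^ m) *ᵥ (1 : κ → ℝ)) j := by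
    intro m i j
    cases m with
    | zero => simpa using hc1
    | succ m =>
      rw [hsucc, hsucc, Finset.mul_sum]
      refine Finset.sum_le_sum fun k _ => ?_
      rw [← mul_assoc]
      exact mul_le_mul_of_nonneg_right (hc (i, k) (j, k)) (hRpos m k).le
  have hcard : (1 : ℝ) ≤ Fintype.card κ := by exact_mod_cast Fintype.card_pos (α := κ)
  set η : ℝ := c * c / Fintype.card κ with hη
  have hη0 : 0 < η := by positivity
  have hη1 : η ≤ 1 := by
    rw [hη, div_le_one (by linarith)]
    nlinarith
  obtain ⟨p⟩ := ‹Nonempty κ›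
  have hkey : ∀ m j, η * ((N ^ (m + 1)) *ᵥ (1 : κ → ℝ)) j ≤ N j p * ((N ^ m) *ᵥ (1 : κ → ℝ)) p := by
    intro m j
    rw [hη, div_mul_eq_mul_div, div_le_iff₀ (by linarith), hsucc, Finset.mul_sum]
    calc ∑ k, c * c * (N j k * ((N ^ m) *ᵥ (1 : κ → ℝ)) k)
        ≤ ∑ k : κ, N j p * ((N ^ m) *ᵥ (1 : κ → ℝ)) p := by
          refine Finset.sum_le_sum fun k _ => ?_
          calc c * c * (N j k * ((N ^ m) *ᵥ (1 : κ → ℝ)) k)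
              = (c * N j k) * (c * ((N ^ m) *ᵥ (1 : κ → ℝ)) k) := by ring
            _ ≤ _ := mul_le_mul (hc (j, k) (j, p)) (hRcomp m k p)
                (mul_pos hc0 (hRpos m k)).le (hN j p).le
      _ = _ := by simp [mul_comm]
  obtain ⟨C, hC⟩ : ∃ C : ℝ, ∀ i, |u i| ≤ C := by
    obtain ⟨i, hi⟩ := @Finite.exists_max _ _ _ ⟨p⟩ _ (fun i => |u i|)
    exact ⟨_, hi⟩
  have hbounds : ∀ m : ℕ, ∃ a b : ℝ, a - b = (1 - η) ^ m * (2 * C) ∧ ∀ i,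
      b * ((N ^ m) *ᵥ 1) i ≤ ((N ^ m) *ᵥ u) i ∧ ((N ^ m) *ᵥ u) i ≤ a * ((N ^ m) *ᵥ 1) i := by
    intro m
    induction m with
    | zero =>
      refine ⟨C, -C, by ring, fun i => ?_⟩
      simpa using abs_le.1 (hC i)
    | succ m ih =>
      obtain ⟨a, b, hab, h⟩ := ih
      set t := ((N ^ m) *ᵥ u) p / ((N ^ m) *ᵥ (1 : κ → ℝ)) p with ht
      have htp : ((N ^ m) *ᵥ u) p = t * ((N ^ m) *ᵥ (1 : κ → ℝ)) p :=
        (div_mul_cancel₀ _ (hRpos m p).ne').symm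
      have hbt : b ≤ t := (le_div_iff₀ (hRpos m p)).2 (h p).1
      have hta : t ≤ a := (div_le_iff₀ (hRpos m p)).2 (h p).2
      refine ⟨a + η * (t - a), b + η * (t - b), ?_, fun j => ⟨?_, ?_⟩⟩
      · rw [pow_succ]
        linear_combination (1 - η) * hab
      · have h1 : N j p * (((N ^ m) *ᵥ u) p - b * ((N ^ m) *ᵥ (1 : κ → ℝ)) p) ≤
            ∑ k, N j k * (((N ^ m) *ᵥ u) k - b * ((N ^ m) *ᵥ (1 : κ → ℝ)) k) :=
          Finset.single_le_sum
            (f := fun k => N j k * (((N ^ m) *ᵥ u) k - b * ((N ^ m) *ᵥ (1 : κ → ℝ)) k))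
            (fun k _ => mul_nonneg (hN j k).le (sub_nonneg.2 (h k).1)) (Finset.mem_univ p)
        have h2 : ∑ k, N j k * (((N ^ m) *ᵥ u) k - b * ((N ^ m) *ᵥ (1 : κ → ℝ)) k) =
            ((N ^ (m + 1)) *ᵥ u) j - b * ((N ^ (m + 1)) *ᵥ (1 : κ → ℝ)) j := by
          rw [hsucc, hsucc, Finset.mul_sum, ← Finset.sum_sub_distrib]
          exact Finset.sum_congr rfl fun k _ => by ring
        rw [htp] at h1
        have h3 := mul_le_mul_of_nonneg_left (hkey m j) (sub_nonneg.2 hbt)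
        linarith
      · have h1 : N j p * (a * ((N ^ m) *ᵥ (1 : κ → ℝ)) p - ((N ^ m) *ᵥ u) p) ≤
            ∑ k, N j k * (a * ((N ^ m) *ᵥ (1 : κ → ℝ)) k - ((N ^ m) *ᵥ u) k) :=
          Finset.single_le_sum
            (f := fun k => N j k * (a * ((N ^ m) *ᵥ (1 : κ → ℝ)) k - ((N ^ m) *ᵥ u) k))
            (fun k _ => mul_nonneg (hN j k).le (sub_nonneg.2 (h k).2)) (Finset.mem_univ p)
        have h2 : ∑ k, N j k * (a * ((N ^ m) *ᵥ (1 : κ → ℝ)) k - ((N ^ m) *ᵥ u) k) =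
            a * ((N ^ (m + 1)) *ᵥ (1 : κ → ℝ)) j - ((N ^ (m + 1)) *ᵥ u) j := by
          rw [hsucc, hsucc, Finset.mul_sum, ← Finset.sum_sub_distrib]
          exact Finset.sum_congr rfl fun k _ => by ring
        rw [htp] at h1
        have h3 := mul_le_mul_of_nonneg_left (hkey m j) (sub_nonneg.2 hta)
        linarith
  have hlim : Filter.Tendsto (fun m : ℕ => (1 - η) ^ m * (2 * C)) Filter.atTop (nhds 0) := by
    simpa using (tendsto_pow_atTop_nhds_zero_of_lt_one (by linarith) (by linarith)).mul_const
      (2 * C)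
  obtain ⟨m, hm⟩ := (hlim.eventually (gt_mem_nhds hδ)).exists
  obtain ⟨a, b, hab, h⟩ := hbounds m
  exact ⟨m, a, b, hab ▸ hm, fun i => ⟨hRpos m i, h i⟩⟩

lemma sign_conj_pow {ι : Type*} [Fintype ι] [DecidableEq ι] {s : ι → ℝ} (hs : ∀ i, s i * s i = 1)
    (M : Matrix ι ι ℝ) (m : ℕ) :
    (diagonal s * M * diagonal s) ^ m = diagonal s * M ^ m * diagonal s := by
  have hss : diagonal s * diagonal s = 1 := by
    rw [diagonal_mul_diagonal, ← diagonal_one]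
    exact congrArg _ (funext hs)
  induction m with
  | zero => simp [hss]
  | succ m ih =>
    rw [pow_succ, ih, pow_succ]
    calc diagonal s * M ^ m * diagonal s * (diagonal s * M * diagonal s)
        = diagonal s * M ^ m * (diagonal s * diagonal s) * M * diagonal s := by
          simp only [Matrix.mul_assoc]
      _ = _ := by rw [hss, Matrix.mul_one]; simp only [Matrix.mul_assoc]

lemma sign_eq_of_nonnegOrbits {κ : Type*} [Fintype κ] [DecidableEq κ] {M : Matrix κ κ ℝ}
    (hM : NonnegOrbits M) {s : κ → ℝ} (hs : ∀ i, s i = 1 ∨ s i = -1)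
    (hpos : ∀ i j, 0 < s i * M i j * s j) (i j : κ) : s i = s j := by
  have hss : ∀ i, s i * s i = 1 := fun i => by rcases hs i with h | h <;> simp [h]
  obtain ⟨x, ε, hε, hz⟩ := hM
  have : Nonempty κ := ⟨i⟩
  obtain ⟨m, a, b, hab, h⟩ := exists_ratio_bounds_of_pos (N := diagonal s * M * diagonal s)
    (by simpa using hpos) (fun i => s i * x i) (δ := 2 * ε) (by linarith)
  rw [sign_conj_pow hss] at h
  have hconj : ∀ (v : κ → ℝ) k, ((diagonal s * M ^ m * diagonal s) *ᵥ v) k =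
      s k * ((M ^ m) *ᵥ (fun l => s l * v l)) k := by
    intro v k
    rw [Matrix.mul_assoc, ← mulVec_mulVec, ← mulVec_mulVec, mulVec_diagonal]
    congr 3
    funext l
    rw [mulVec_diagonal]
  have hsx : (fun l => s l * (s l * x l)) = x := funext fun l => by rw [← mul_assoc, hss, one_mul]
  have hs1 : (fun l => s l * (1 : κ → ℝ) l) = s := funext fun l => by simp
  simp only [hconj, hsx, hs1] at h
  have hle : ∀ k, |s k| ≤ 1 := fun k => by rcases hs k with h | h <;> simp [h]
  have hp : ∀ k, 0 ≤ ((M ^ m) *ᵥ x) k + ε * ((M ^ m) *ᵥ s) k := fun k => by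
    have := hz (x + ε • s) (fun l => by
      simpa [abs_mul, abs_of_pos hε] using mul_le_mul_of_nonneg_left (hle l) hε.le) m k
    simpa [mulVec_add, mulVec_smul] using this
  have hn : ∀ k, 0 ≤ ((M ^ m) *ᵥ x) k - ε * ((M ^ m) *ᵥ s) k := fun k => by
    have := hz (x - ε • s) (fun l => by
      simpa [abs_mul, abs_of_pos hε] using mul_le_mul_of_nonneg_left (hle l) hε.le) m k
    simpa [mulVec_sub, mulVec_smul] using this
  have hno : ∀ p q, s p = 1 → s q = -1 → False := by
    intro p q h1 h2
    obtain ⟨hp0, -, hpa⟩ := h p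
    obtain ⟨hq0, hqb, -⟩ := h q
    have hnp := hn p
    have hpq := hp q
    rw [h1] at hp0 hpa
    rw [h2] at hq0 hqb
    have ha : ε ≤ a := by
      by_contra hlt
      nlinarith
    have hb : b ≤ -ε := by
      by_contra hlt
      nlinarith
    linarith
  rcases hs i with h1 | h1 <;> rcases hs j with h2 | h2
  · rw [h1, h2]
  · exact (hno i j h1 h2).elim
  · exact (hno j i h2 h1).elim
  · rw [h1, h2]

lemma pow_nonneg_of_nonneg {ι : Type*} [Fintype ι] [DecidableEq ι] {N : Matrix ι ι ℝ}
    (hN : ∀ i j, 0 ≤ N i j) (m : ℕ) : ∀ i j, 0 ≤ (N ^ m) i j := by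
  induction m with
  | zero =>
    intro i j
    rw [pow_zero, Matrix.one_apply]
    split_ifs <;> norm_num
  | succ m ih =>
    intro i j
    rw [pow_succ, Matrix.mul_apply]
    exact Finset.sum_nonneg fun k _ => mul_nonneg (ih i k) (hN k j)

lemma exists_pow_pos_of_reachable {ι : Type*} [Fintype ι] [DecidableEq ι] {N : Matrix ι ι ℝ}
    (hN : ∀ i j, 0 ≤ N i j) :
    ∃ r : ℕ, ∀ i j, Relation.ReflTransGen (fun a b => 0 < N a b) i j → 0 < ((1 + N) ^ r) i j := by
  have hnn : ∀ (r : ℕ) i j, 0 ≤ ((1 + N) ^ r) i j := pow_nonneg_of_nonneg fun i j => by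
    rw [Matrix.add_apply, Matrix.one_apply]
    have := hN i j
    split_ifs <;> linarith
  have hstep : ∀ (r : ℕ) i k j, 0 < ((1 + N) ^ r) i k → 0 < (1 + N) k j →
      0 < ((1 + N) ^ (r + 1)) i j := by
    intro r i k j h1 h2
    rw [pow_succ, Matrix.mul_apply]
    refine Finset.sum_pos' (fun l _ => mul_nonneg (hnn r i l) ?_) ⟨k, Finset.mem_univ k, mul_pos h1 h2⟩
    simpa using hnn 1 l j
  have hmono : ∀ (r t : ℕ) i j, r ≤ t → 0 < ((1 + N) ^ r) i j → 0 < ((1 + N) ^ t) i j := by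
    intro r t i j hrt h
    induction t, hrt using Nat.le_induction with
    | base => exact h
    | succ t _ ih =>
      refine hstep t i j j ih ?_
      rw [Matrix.add_apply, Matrix.one_apply_eq]
      linarith [hN j j]
  have hex : ∀ p : ι × ι, ∃ r : ℕ, Relation.ReflTransGen (fun a b => 0 < N a b) p.1 p.2 →
      0 < ((1 + N) ^ r) p.1 p.2 := by
    rintro ⟨i, j⟩
    by_cases h : Relation.ReflTransGen (fun a b => 0 < N a b) i j
    · suffices ∃ r : ℕ, 0 < ((1 + N) ^ r) i j from this.imp fun r hr _ => hr
      induction h with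
      | refl => exact ⟨0, by simp⟩
      | tail _ hbc ih =>
        obtain ⟨r, hr⟩ := ih
        refine ⟨r + 1, hstep r i _ _ hr ?_⟩
        rw [Matrix.add_apply, Matrix.one_apply]
        split_ifs <;> linarith
    · exact ⟨0, fun h' => (h h').elim⟩
  choose r hr using hex
  exact ⟨Finset.univ.sup r, fun i j hij =>
    hmono _ _ i j (Finset.le_sup (f := r) (Finset.mem_univ (i, j))) (hr (i, j) hij)⟩

lemma reachable_of_not_decomposable {k : ℕ} {α : Type*} [Zero α] {A : Matrix (Fin k) (Fin k) α}
    (hA : ¬ Decomposable A) (i j : Fin k) : Relation.ReflTransGen (fun a b => A a b ≠ 0) i j := by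
  classical
  by_contra hij
  apply hA
  set q : Fin k → Prop := fun l => ¬ Relation.ReflTransGen (fun a b => A a b ≠ 0) i l with hq
  have hlt : Fintype.card {l // q l} < k := by
    simpa using Fintype.card_subtype_lt (p := q) (x := i) (by simp [hq, Relation.ReflTransGen.refl])
  have hpos : 0 < Fintype.card {l // q l} := Fintype.card_pos_iff.2 ⟨⟨j, hij⟩⟩
  have hcard : Fintype.card {l : Fin k // (l : ℕ) < Fintype.card {l // q l}} =
      Fintype.card {l // q l} := by
    rw [Fintype.card_subtype, Fin.card_filter_val_lt, min_eq_right hlt.le]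
  let e := Fintype.equivOfCardEq hcard
  refine ⟨e.extendSubtype, _, hpos, hlt, fun a b ha hb => ?_⟩
  have h1 := e.extendSubtype_not_mem a (not_lt.2 ha)
  have h2 := e.extendSubtype_mem b hb
  by_contra hne
  exact h2 ((not_not.1 h1).tail hne)

lemma false_of_convolution_le {α β : ℕ → ℝ} (hα : ∀ m, 0 < α m) (hβ : ∀ m, 0 < β m)
    (hαm : ∀ a b, α (a + b) ≤ α a * α b) (hβm : ∀ a b, β (a + b) ≤ β a * β b) {C D : ℝ}
    (hC : ∀ m, ∑ b ∈ Finset.range m, α (m - 1 - b) * β b ≤ C * α m)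
    (hD : ∀ m, ∑ b ∈ Finset.range m, α (m - 1 - b) * β b ≤ D * β m) : False := by
  have key : ∀ {α β : ℕ → ℝ}, (∀ m, 0 < α m) → (∀ m, 0 < β m) →
      (∀ a b, α (a + b) ≤ α a * α b) → ∀ {C : ℝ} {m : ℕ},
      ∑ b ∈ Finset.range m, α (m - 1 - b) * β b ≤ C * α m →
      ∑ b ∈ Finset.range m, β b / α b ≤ C * α 1 := by
    intro α β hα hβ hαm C m h
    have h1 : α m * ∑ b ∈ Finset.range m, β b / α b ≤ α m * (C * α 1) := by
      calc α m * ∑ b ∈ Finset.range m, β b / α b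
          = ∑ b ∈ Finset.range m, α m * (β b / α b) := Finset.mul_sum _ _ _
        _ ≤ ∑ b ∈ Finset.range m, (α (m - 1 - b) * β b) * α 1 := by
          refine Finset.sum_le_sum fun b hb => ?_
          have hb := Finset.mem_range.1 hb
          have h2 : α m ≤ α (m - 1 - b) * (α b * α 1) := by
            calc α m = α (m - 1 - b + (b + 1)) := by congr 1; omega
              _ ≤ _ := (hαm _ _).trans (mul_le_mul_of_nonneg_left (hαm _ _) (hα _).le)
          calc α m * (β b / α b) ≤ α (m - 1 - b) * (α b * α 1) * (β b / α b) :=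
                mul_le_mul_of_nonneg_right h2 (div_pos (hβ b) (hα b)).le
            _ = _ := by
              have := (hα b).ne'
              field_simp
        _ = (∑ b ∈ Finset.range m, α (m - 1 - b) * β b) * α 1 := (Finset.sum_mul _ _ _).symm
        _ ≤ C * α m * α 1 := mul_le_mul_of_nonneg_right h (hα 1).le
        _ = _ := by ring
    exact le_of_mul_le_mul_left h1 (hα m)
  obtain ⟨m, hm⟩ := exists_nat_gt ((C * α 1 + D * β 1) / 2)
  have h1 := key hα hβ hαm (hC m)
  have h2 := key hβ hα hβm (C := D) (m := m) (by
    rw [← Finset.sum_range_reflect]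
    refine le_of_eq_of_le (Finset.sum_congr rfl fun b hb => ?_) (hD m)
    have hb := Finset.mem_range.1 hb
    rw [mul_comm]
    congr 2
    omega)
  have h3 : ∑ b ∈ Finset.range m, (2 : ℝ) ≤ ∑ b ∈ Finset.range m, (β b / α b + α b / β b) := by
    refine Finset.sum_le_sum fun b _ => ?_
    have ha := hα b
    have hb := hβ b
    rw [div_add_div _ _ ha.ne' hb.ne', le_div_iff₀ (mul_pos ha hb)]
    nlinarith [sq_nonneg (α b - β b)]
  rw [Finset.sum_add_distrib, Finset.sum_const, Finset.card_range, nsmul_eq_mul] at h3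
  linarith

lemma sum_pow_add_le {κ : Type*} [Fintype κ] [DecidableEq κ] {N : Matrix κ κ ℝ}
    (hN : ∀ (m : ℕ) i j, 0 ≤ (N ^ m) i j) (a b : ℕ) :
    ∑ i, ∑ j, (N ^ (a + b)) i j ≤ (∑ i, ∑ j, (N ^ a) i j) * ∑ i, ∑ j, (N ^ b) i j := by
  simp only [pow_add, Matrix.mul_apply, Finset.sum_mul]
  refine Finset.sum_le_sum fun i _ => ?_
  rw [Finset.sum_comm]
  refine Finset.sum_le_sum fun k _ => ?_
  rw [← Finset.mul_sum]
  refine mul_le_mul_of_nonneg_left ?_ (hN a i k)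
  exact Finset.single_le_sum (f := fun l => ∑ j, (N ^ b) l j)
    (fun l _ => Finset.sum_nonneg fun j _ => hN b l j) (Finset.mem_univ k)

lemma fromBlocks_neg_pow {κ₁ κ₂ : Type*} [Fintype κ₁] [Fintype κ₂] [DecidableEq κ₁] [DecidableEq κ₂]
    (N₁ : Matrix κ₁ κ₁ ℝ) (E : Matrix κ₁ κ₂ ℝ) (N₂ : Matrix κ₂ κ₂ ℝ) (m : ℕ) :
    (fromBlocks N₁ (-E) 0 N₂) ^ m = fromBlocks (N₁ ^ m)
      (-∑ b ∈ Finset.range m, N₁ ^ (m - 1 - b) * E * N₂ ^ b) 0 (N₂ ^ m) := by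
  induction m with
  | zero => simp
  | succ m ih =>
    rw [pow_succ', ih, fromBlocks_multiply]
    congr 1
    · simp [pow_succ']
    · rw [Finset.sum_range_succ, Matrix.mul_neg, Matrix.neg_mul, neg_add, Matrix.mul_sum]
      congr 2
      · refine Finset.sum_congr rfl fun b hb => ?_
        have hb := Finset.mem_range.1 hb
        rw [← Matrix.mul_assoc, ← Matrix.mul_assoc, ← pow_succ']
        congr 3
        omega
      · simp
    · simp
    · simp [pow_succ']

lemma sum_pow_pos {κ : Type*} [Fintype κ] [DecidableEq κ] [Nonempty κ] {N : Matrix κ κ ℝ}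
    (hN : ∀ i j, 0 < N i j) (m : ℕ) : 0 < ∑ i, ∑ j, (N ^ m) i j := by
  refine Finset.sum_pos (fun i _ => ?_) Finset.univ_nonempty
  induction m with
  | zero => simp [Matrix.one_apply]
  | succ m ih =>
    simp only [pow_succ, Matrix.mul_apply]
    rw [Finset.sum_comm]
    simp only [← Finset.mul_sum]
    obtain ⟨k, hk, hk0⟩ := Finset.exists_ne_zero_of_sum_ne_zero ih.ne'
    have hnn := pow_nonneg_of_nonneg (fun i j => (hN i j).le) m
    have hrow : ∀ k, 0 < ∑ j, N k j := fun k =>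
      Finset.sum_pos (fun j _ => hN k j) Finset.univ_nonempty
    exact Finset.sum_pos' (fun l _ => mul_nonneg (hnn i l) (hrow l).le)
      ⟨k, hk, mul_pos ((hnn i k).lt_of_ne' hk0) (hrow k)⟩

lemma NonnegOrbits.sum_inr_le {ι κ₁ κ₂ : Type*} [Fintype ι] [DecidableEq ι] [Fintype κ₁]
    [Fintype κ₂] {M : Matrix ι ι ℝ} (hM : NonnegOrbits M) (e : κ₁ ⊕ κ₂ ≃ ι)
    {P : ℕ → Matrix κ₁ κ₁ ℝ} {F : ℕ → Matrix κ₁ κ₂ ℝ}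
    (hP : ∀ m i j, 0 ≤ P m i j) (hF : ∀ m i j, 0 ≤ F m i j)
    (h₁ : ∀ m i j, (M ^ m) (e (Sum.inl i)) (e (Sum.inl j)) = P m i j)
    (h₂ : ∀ m i j, (M ^ m) (e (Sum.inl i)) (e (Sum.inr j)) = -F m i j) :
    ∃ C : ℝ, ∀ m, ∑ i, ∑ j, F m i j ≤ C * ∑ i, ∑ j, P m i j := by
  obtain ⟨x, ε, hε, hz⟩ := hM
  have hx : ∀ i, ε ≤ x i := fun i => by
    have := hz (fun i => x i - ε) (fun i => by simp [abs_of_pos hε]) 0 i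
    simpa using this
  refine ⟨(∑ i, x i) / ε, fun m => ?_⟩
  rw [div_mul_eq_mul_div, le_div_iff₀ hε, mul_comm, Finset.mul_sum, Finset.mul_sum]
  refine Finset.sum_le_sum fun i _ => ?_
  have h := hz x (fun i => by simp [hε.le]) m (e (Sum.inl i))
  simp only [mulVec, dotProduct] at h
  rw [← e.sum_comp] at h
  simp only [Fintype.sum_sum_type, h₁, h₂] at h
  calc ε * ∑ j, F m i j ≤ ∑ j, F m i j * x (e (Sum.inr j)) := by
        rw [Finset.mul_sum]
        refine Finset.sum_le_sum fun j _ => ?_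
        rw [mul_comm]
        exact mul_le_mul_of_nonneg_left (hx _) (hF m i j)
    _ ≤ ∑ j, P m i j * x (e (Sum.inl j)) := by
        simp only [neg_mul, Finset.sum_neg_distrib] at h
        linarith
    _ ≤ (∑ i, x i) * ∑ j, P m i j := by
        rw [Finset.mul_sum]
        refine Finset.sum_le_sum fun j _ => ?_
        rw [mul_comm]
        exact mul_le_mul_of_nonneg_right (Finset.single_le_sum
          (fun l _ => hε.le.trans (hx l)) (Finset.mem_univ _)) (hP m i j)

lemma not_nonnegOrbits_of_neg_block {κ₁ κ₂ : Type*} [Fintype κ₁] [Fintype κ₂] [DecidableEq κ₁]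
    [DecidableEq κ₂] [Nonempty κ₁] [Nonempty κ₂] {N₁ : Matrix κ₁ κ₁ ℝ} {E : Matrix κ₁ κ₂ ℝ}
    {N₂ : Matrix κ₂ κ₂ ℝ} (h₁ : ∀ i j, 0 < N₁ i j) (hE : ∀ i j, 0 < E i j)
    (h₂ : ∀ i j, 0 < N₂ i j) (hM : NonnegOrbits (fromBlocks N₁ (-E) 0 N₂))
    (hMt : NonnegOrbits (fromBlocks N₁ (-E) 0 N₂)ᵀ) : False := by
  have hN₁ := pow_nonneg_of_nonneg fun i j => (h₁ i j).le
  have hN₂ := pow_nonneg_of_nonneg fun i j => (h₂ i j).le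
  set F : ℕ → Matrix κ₁ κ₂ ℝ := fun m =>
    ∑ b ∈ Finset.range m, N₁ ^ (m - 1 - b) * E * N₂ ^ b with hF
  have hFapply : ∀ m i j, F m i j =
      ∑ b ∈ Finset.range m, ∑ l, ∑ k, (N₁ ^ (m - 1 - b)) i k * E k l * (N₂ ^ b) l j := by
    intro m i j
    simp only [hF, Matrix.sum_apply, Matrix.mul_apply, Finset.sum_mul]
  have hFnn : ∀ m i j, 0 ≤ F m i j := by
    intro m i j
    rw [hFapply]
    exact Finset.sum_nonneg fun b _ => Finset.sum_nonneg fun l _ => Finset.sum_nonneg fun k _ =>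
      mul_nonneg (mul_nonneg (hN₁ _ _ _) (hE _ _).le) (hN₂ _ _ _)
  obtain ⟨p, hp⟩ := Finite.exists_min fun p : κ₁ × κ₂ => E p.1 p.2
  set c := E p.1 p.2
  have hc : 0 < c := hE _ _
  have hlow : ∀ m, c * ∑ b ∈ Finset.range m,
      (∑ i, ∑ j, (N₁ ^ (m - 1 - b)) i j) * (∑ i, ∑ j, (N₂ ^ b) i j) ≤ ∑ i, ∑ j, F m i j := by
    intro m
    have hswap : ∑ i, ∑ j, F m i j = ∑ b ∈ Finset.range m, ∑ i, ∑ j, ∑ l, ∑ k,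
        (N₁ ^ (m - 1 - b)) i k * E k l * (N₂ ^ b) l j := by
      simp only [hFapply]
      simp_rw [Finset.sum_comm (t := Finset.range m)]
    rw [hswap, Finset.mul_sum]
    refine Finset.sum_le_sum fun b _ => ?_
    rw [Finset.sum_mul, Finset.mul_sum]
    refine Finset.sum_le_sum fun i _ => ?_
    rw [Finset.sum_comm (s := (Finset.univ : Finset κ₂)), Finset.mul_sum, Finset.mul_sum]
    refine Finset.sum_le_sum fun l _ => ?_
    rw [Finset.mul_sum, Finset.mul_sum]
    refine Finset.sum_le_sum fun j _ => ?_
    rw [Finset.sum_mul, Finset.mul_sum]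
    refine Finset.sum_le_sum fun k _ => ?_
    calc c * ((N₁ ^ (m - 1 - b)) i k * (N₂ ^ b) l j)
        = (N₁ ^ (m - 1 - b)) i k * c * (N₂ ^ b) l j := by ring
      _ ≤ _ := mul_le_mul_of_nonneg_right
          (mul_le_mul_of_nonneg_left (hp (k, l)) (hN₁ _ _ _)) (hN₂ _ _ _)
  obtain ⟨C, hC⟩ := hM.sum_inr_le (Equiv.refl _) (P := fun m => N₁ ^ m) (F := F) hN₁ hFnn
    (fun m i j => by simp [fromBlocks_neg_pow]) (fun m i j => by simp [fromBlocks_neg_pow, hF])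
  obtain ⟨D, hD⟩ := hMt.sum_inr_le (Equiv.sumComm _ _) (P := fun m => (N₂ ^ m)ᵀ)
    (F := fun m => (F m)ᵀ) (fun m i j => hN₂ m j i) (fun m i j => hFnn m j i)
    (fun m i j => by simp [← transpose_pow, fromBlocks_neg_pow])
    (fun m i j => by simp [← transpose_pow, fromBlocks_neg_pow, hF])
  refine false_of_convolution_le (α := fun m => ∑ i, ∑ j, (N₁ ^ m) i j)
    (β := fun m => ∑ i, ∑ j, (N₂ ^ m) i j) (sum_pow_pos h₁) (sum_pow_pos h₂)
    (sum_pow_add_le hN₁) (sum_pow_add_le hN₂) (C := C / c) (D := D / c) (fun m => ?_) (fun m => ?_)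
  · rw [div_mul_eq_mul_div, le_div_iff₀ hc, mul_comm]
    exact (hlow m).trans (hC m)
  · rw [div_mul_eq_mul_div, le_div_iff₀ hc, mul_comm]
    refine (hlow m).trans ?_
    have := hD m
    simp only [transpose_apply] at this
    rwa [Finset.sum_comm, Finset.sum_comm (f := fun i j => (N₂ ^ m) j i)] at this

lemma nonneg_of_blocks {κ₁ κ₂ : Type*} [Fintype κ₁] [Fintype κ₂] [DecidableEq κ₁]
    [DecidableEq κ₂] {A₁ : Matrix κ₁ κ₁ ℝ} {B : Matrix κ₁ κ₂ ℝ} {A₂ : Matrix κ₂ κ₂ ℝ}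
    (h₁ : ∀ i j, Relation.ReflTransGen (fun a b => A₁ a b ≠ 0) i j)
    (h₂ : ∀ i j, Relation.ReflTransGen (fun a b => A₂ a b ≠ 0) i j)
    {s : κ₁ ⊕ κ₂ → ℝ} (hs : ∀ i, s i = 1 ∨ s i = -1)
    (hA : ∀ i j, 0 ≤ s i * (fromBlocks A₁ B 0 A₂) i j * s j)
    (hM : NonnegOrbits (1 + fromBlocks A₁ B 0 A₂))
    (hMt : NonnegOrbits (1 + fromBlocks A₁ B 0 A₂)ᵀ) (i j : κ₁ ⊕ κ₂) :
    0 ≤ (fromBlocks A₁ B 0 A₂) i j := by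
  have hss : ∀ i, s i * s i = 1 := fun i => by rcases hs i with h | h <;> simp [h]
  have hs0 : ∀ i, s i ≠ 0 := fun i => by rcases hs i with h | h <;> simp [h]
  set A := fromBlocks A₁ B 0 A₂ with hAdef
  set N : Matrix (κ₁ ⊕ κ₂) (κ₁ ⊕ κ₂) ℝ := diagonal s * A * diagonal s with hNdef
  have hNapply : ∀ i j, N i j = s i * A i j * s j := fun i j => by simp [hNdef]
  have hNpos : ∀ {i j}, A i j ≠ 0 → 0 < N i j := fun {i j} hij => by
    rw [hNapply]
    exact lt_of_le_of_ne (hA i j) (mul_ne_zero (mul_ne_zero (hs0 i) hij) (hs0 j)).symm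
  obtain ⟨r, hr⟩ := exists_pow_pos_of_reachable (N := N) fun i j => (hNapply i j).symm ▸ hA i j
  have h1N : 1 + N = diagonal s * (1 + A) * diagonal s := by
    rw [Matrix.mul_add, Matrix.add_mul, Matrix.mul_one, diagonal_mul_diagonal, hNdef]
    congr 1
    rw [← diagonal_one]
    exact congrArg _ (funext hss).symm
  have hpow : ∀ i j, ((1 + N) ^ r) i j = s i * ((1 + A) ^ r) i j * s j := fun i j => by
    rw [h1N, sign_conj_pow hss]
    simp
  have hreach₁ : ∀ a b, Relation.ReflTransGen (fun a b => 0 < N a b) (Sum.inl a) (Sum.inl b) :=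
    fun a b => (h₁ a b).lift Sum.inl fun _ _ h => hNpos h
  have hreach₂ : ∀ a b, Relation.ReflTransGen (fun a b => 0 < N a b) (Sum.inr a) (Sum.inr b) :=
    fun a b => (h₂ a b).lift Sum.inr fun _ _ h => hNpos h
  have hblock : 1 + A = fromBlocks (1 + A₁) B 0 (1 + A₂) := by
    rw [hAdef, ← fromBlocks_one, fromBlocks_add, zero_add, zero_add]
  obtain ⟨E, hE⟩ : ∃ E, (1 + A) ^ r = fromBlocks ((1 + A₁) ^ r) (-E) 0 ((1 + A₂) ^ r) := by
    have h := fromBlocks_neg_pow (1 + A₁) (-B) (1 + A₂) r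
    rw [neg_neg, ← hblock] at h
    exact ⟨_, h⟩
  have hMr := hM.pow r
  have hMtr := hMt.pow r
  rw [← transpose_pow] at hMtr
  rw [hE] at hMr hMtr
  have hs₁ : ∀ a b, s (Sum.inl a) = s (Sum.inl b) := by
    have h : NonnegOrbits ((1 + A₁) ^ r)ᵀ := hMtr.comp Sum.inl_injective fun z => by
      rw [fromBlocks_transpose, fromBlocks_mulVec]
      simp
    refine sign_eq_of_nonnegOrbits h (fun i => hs _) fun a b => ?_
    have := hr _ _ (hreach₁ b a)
    rw [hpow, hE, fromBlocks_apply₁₁] at this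
    rw [transpose_apply]
    linarith
  have hs₂ : ∀ a b, s (Sum.inr a) = s (Sum.inr b) := by
    have h : NonnegOrbits ((1 + A₂) ^ r) := hMr.comp Sum.inr_injective fun z => by
      rw [fromBlocks_mulVec]
      simp
    refine sign_eq_of_nonnegOrbits h (fun i => hs _) fun a b => ?_
    have := hr _ _ (hreach₂ a b)
    rwa [hpow, hE, fromBlocks_apply₂₂] at this
  have hsame : ∀ {i j} {x : ℝ}, s i = s j → s i * x * s j = x := fun {i j x} h => by
    rw [h, mul_right_comm, hss, one_mul]
  rcases i with a | a <;> rcases j with b | b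
  · simpa only [hsame (hs₁ a b)] using hA (Sum.inl a) (Sum.inl b)
  · by_contra hneg
    have hAab : A (Sum.inl a) (Sum.inr b) ≠ 0 := fun h => hneg h.ge
    have hopp : s (Sum.inl a) * s (Sum.inr b) = -1 := by
      have h := hA (Sum.inl a) (Sum.inr b)
      rcases hs (Sum.inl a) with h1 | h1 <;> rcases hs (Sum.inr b) with h2 | h2 <;>
        rw [h1, h2] at h ⊢ <;> first | exact (hneg (by linarith)).elim | norm_num
    have : Nonempty κ₁ := ⟨a⟩
    have : Nonempty κ₂ := ⟨b⟩
    refine not_nonnegOrbits_of_neg_block (fun c d => ?_) (fun c d => ?_) (fun c d => ?_) hMr hMtr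
    · have := hr _ _ (hreach₁ c d)
      rwa [hpow, hE, fromBlocks_apply₁₁, hsame (hs₁ c d)] at this
    · have := hr _ _ (((hreach₁ c a).tail (hNpos hAab)).trans (hreach₂ b d))
      rw [hpow, hE, fromBlocks_apply₁₂, hs₁ c a, hs₂ d b, mul_right_comm, hopp] at this
      simpa using this
    · have := hr _ _ (hreach₂ c d)
      rwa [hpow, hE, fromBlocks_apply₂₂, hsame (hs₂ c d)] at this
  · exact le_rfl
  · simpa only [hsame (hs₂ a b)] using hA (Sum.inr a) (Sum.inr b)

/-- A 1-decomposable real matrix that is diagonally similar to a nonnegative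
matrix and leaves invariant proper cones `K ⊆ ℝ₊ⁿ` (for `A`) and `L ⊆ ℝ₊ⁿ` (for `Aᵀ`) is itself
nonnegative. -/
theorem stmt_10 {n : ℕ} (hn : 2 ≤ n) (A : Matrix (Fin n) (Fin n) ℝ)
    (h1dec : OneDecomposable A)
    (hdsim : ∃ d : Fin n → ℝ, (∀ i, d i ≠ 0) ∧
      ∀ i j, 0 ≤ (diagonal d * A * diagonal (fun i => (d i)⁻¹)) i j)
    (K L : Set (Fin n → ℝ))
    (hK : IsProperCone K) (hKpos : ∀ x ∈ K, ∀ i, 0 ≤ x i)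
    (hL : IsProperCone L) (hLpos : ∀ x ∈ L, ∀ i, 0 ≤ x i)
    (hKinv : ∀ x ∈ K, A.mulVec x ∈ K)
    (hLinv : ∀ x ∈ L, Aᵀ.mulVec x ∈ L) :
    ∀ i j, 0 ≤ A i j := by
  obtain ⟨σ, k, -, hk, hzero, h₁, h₂⟩ := h1dec
  obtain ⟨d, hd, hdA⟩ := hdsim
  let e : Fin k ⊕ Fin (n - k) ≃ Fin n :=
    finSumFinEquiv.trans ((finCongr (Nat.add_sub_cancel' hk.le)).trans σ)
  have hblock := (fromBlocks_toBlocks (A.submatrix e e)).symm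
  have h21 : (A.submatrix e e).toBlocks₂₁ = 0 := by
    ext i j
    exact hzero _ _ (by simp) (by simp)
  rw [h21] at hblock
  replace h₁ : ¬ Decomposable (A.submatrix e e).toBlocks₁₁ := h₁
  replace h₂ : ¬ Decomposable (A.submatrix e e).toBlocks₂₂ := h₂
  have hsub : ∀ {M : Matrix (Fin n) (Fin n) ℝ}, NonnegOrbits M → NonnegOrbits (M.submatrix e e) :=
    fun {M} hM => hM.comp e.injective fun z => by
      rw [submatrix_mulVec_equiv, Function.comp_assoc, e.self_comp_symm, Function.comp_id]
  have hMA := hsub (hK.nonnegOrbits hKpos hKinv)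
  have hMAt := hsub (hL.nonnegOrbits hLpos hLinv)
  rw [submatrix_add, Pi.add_apply, Pi.add_apply, submatrix_one_equiv] at hMA hMAt
  rw [← transpose_submatrix, ← transpose_one, ← transpose_add] at hMAt
  have hsd : ∀ i j, 0 ≤ (if 0 < d i then 1 else -1) * A i j * (if 0 < d j then 1 else -1) := by
    intro i j
    have h := hdA i j
    rw [mul_diagonal, diagonal_mul] at h
    have h' : 0 ≤ d i * d j * A i j := by
      have h2 := mul_nonneg h (mul_self_nonneg (d j))
      have h3 := hd j
      field_simp at h2
      linarith
    have hneg : ∀ {l}, ¬ 0 < d l → d l < 0 := fun {l} hl => lt_of_le_of_ne (not_lt.1 hl) (hd l)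
    split_ifs with hi hj hj
    · linarith [nonneg_of_mul_nonneg_right h' (mul_pos hi hj)]
    · linarith [nonpos_of_mul_nonneg_right h' (mul_neg_of_pos_of_neg hi (hneg hj))]
    · linarith [nonpos_of_mul_nonneg_right h' (mul_neg_of_neg_of_pos (hneg hi) hj)]
    · linarith [nonneg_of_mul_nonneg_right h' (mul_pos_of_neg_of_neg (hneg hi) (hneg hj))]
  rw [hblock] at hMA hMAt
  have key := nonneg_of_blocks (s := fun i => if 0 < d (e i) then 1 else -1)
    (reachable_of_not_decomposable h₁) (reachable_of_not_decomposable h₂)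
    (fun i => by split_ifs <;> simp) (fun i j => by rw [← hblock]; exact hsd _ _) hMA hMAt
  rw [← hblock] at key
  intro i j
  simpa using key (e.symm i) (e.symm j)
end

section
/- Let A = [[1, −1],[0, 0]] ∈ M₂(ℝ) and K = {(x,y) ∈ ℝ² : x ≥ y ≥ 0}. Then K is a proper cone contained in ℝ₊², A(K) ⊆ K, and A is diagonally similar to a matrix with all entries nonnegative (via the diagonal matrix with diagonal (1,−1)), yet A itself has a strictly negative entry. (Hence in the preceding proposition neither of the two invariant proper cones can be omitted.) -/
open Matrix

/-- For `A = [[1,−1],[0,0]]` and `K = {(x,y) : x ≥ y ≥ 0}`: `K` is a proper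
cone contained in `ℝ₊²` invariant under `A`, and `A` is diagonally similar (via `diag(1,−1)`)
to a nonnegative matrix, yet `A` has a strictly negative entry. -/
theorem stmt_11 (A : Matrix (Fin 2) (Fin 2) ℝ) (hA : A = !![1, -1; 0, 0])
    (K : Set (Fin 2 → ℝ)) (hK : K = {v | v 1 ≤ v 0 ∧ 0 ≤ v 1})
    (d : Fin 2 → ℝ) (hd : d = ![1, -1]) :
    IsProperCone K ∧ (∀ v ∈ K, ∀ i, 0 ≤ v i) ∧
    (∀ v ∈ K, A.mulVec v ∈ K) ∧
    (∀ i, d i ≠ 0) ∧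
    (∀ i j, 0 ≤ (diagonal d * A * diagonal (fun i => (d i)⁻¹)) i j) ∧
    (∃ i j, A i j < 0) := by
  subst hA hK hd
  refine ⟨⟨by simp, ?_, ?_, ?_, ?_, ?_⟩, ?_, ?_, ?_, ?_, 0, 1, by simp⟩
  · rintro x ⟨hx, hx'⟩ y ⟨hy, hy'⟩
    exact ⟨add_le_add hx hy, add_nonneg hx' hy'⟩
  · rintro r hr x ⟨hx, hx'⟩
    exact ⟨mul_le_mul_of_nonneg_left hx hr, mul_nonneg hr hx'⟩
  · exact (isClosed_le (continuous_apply 1) (continuous_apply 0)).inter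
      (isClosed_le continuous_const (continuous_apply 1))
  · rintro x ⟨hx, hx'⟩ ⟨hy, hy'⟩
    simp only [Pi.neg_apply] at hy hy'
    ext i
    fin_cases i <;> simp <;> linarith
  · have hopen : IsOpen {v : Fin 2 → ℝ | v 1 < v 0 ∧ 0 < v 1} :=
      (isOpen_lt (continuous_apply 1) (continuous_apply 0)).inter
        (isOpen_lt continuous_const (continuous_apply 1))
    have hsub : {v : Fin 2 → ℝ | v 1 < v 0 ∧ 0 < v 1} ⊆ {v | v 1 ≤ v 0 ∧ 0 ≤ v 1} :=
      fun v hv => ⟨hv.1.le, hv.2.le⟩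
    exact ⟨![2, 1], interior_maximal hsub hopen (by simp)⟩
  · rintro v ⟨hv, hv'⟩ i
    fin_cases i
    · exact hv'.trans hv
    · exact hv'
  · rintro v ⟨hv, -⟩
    simpa [Matrix.mulVec, dotProduct, Fin.sum_univ_two] using hv
  · intro i
    fin_cases i <;> simp
  · intro i j
    rw [mul_diagonal, diagonal_mul]
    fin_cases i <;> fin_cases j <;> simp
end

section
/- Let n ≥ 2 and let S ⊆ M_n(ℂ) be an irreducible multiplicative semigroup such that each member of S is diagonally similar to a matrix with all entries nonnegative real, and such that every member of S of rank at least 2 is either indecomposable or 1-decomposable. Then there exists a single invertible diagonal matrix D ∈ M_n(ℂ) such that every matrix in D S D⁻¹ has all entries nonnegative real. -/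
open Matrix
/-- A complex matrix is diagonally similar to a matrix with all entries nonnegative real if
some invertible diagonal conjugation takes it to such a matrix. -/
def DiagSimNonneg {n : ℕ} (A : Matrix (Fin n) (Fin n) ℂ) : Prop :=
  ∃ d : Fin n → ℂ, (∀ i, d i ≠ 0) ∧
    ∀ i j, 0 ≤ ((diagonal d * A * diagonal (fun i => (d i)⁻¹)) i j).re ∧
      ((diagonal d * A * diagonal (fun i => (d i)⁻¹)) i j).im = 0


section RankOne

open scoped ComplexOrder
open Filter Topology

variable {ι : Type*} [Fintype ι] [DecidableEq ι]

attribute [local instance] Matrix.linftyOpNormedRing Matrix.linftyOpNormedAlgebra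

/-- A closed convex cone of matrices which is closed under multiplication and all of whose
members have a nonnegative diagonal. -/
structure IsDiagNonnegCone (C : Set (Matrix ι ι ℂ)) : Prop where
  closed : IsClosed C
  add : ∀ A ∈ C, ∀ B ∈ C, A + B ∈ C
  smul : ∀ r : ℝ, 0 ≤ r → ∀ A ∈ C, (r : ℂ) • A ∈ C
  mul : ∀ A ∈ C, ∀ B ∈ C, A * B ∈ C
  diag : ∀ A ∈ C, ∀ i, 0 ≤ A i i

namespace IsDiagNonnegCone

variable {C : Set (Matrix ι ι ℂ)}

omit [DecidableEq ι] in
lemma trace_nonneg (hC : IsDiagNonnegCone C) {A : Matrix ι ι ℂ} (hA : A ∈ C) :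
    0 ≤ A.trace :=
  Finset.sum_nonneg fun i _ => hC.diag A hA i

lemma pow_mem (hC : IsDiagNonnegCone C) {A : Matrix ι ι ℂ} (hA : A ∈ C) (k : ℕ) :
    A ^ (k + 1) ∈ C := by
  induction k with
  | zero => simpa using hA
  | succ k ih => rw [pow_succ]; exact hC.mul _ ih _ hA

omit [DecidableEq ι] in
lemma sum_mem (hC : IsDiagNonnegCone C) {f : ℕ → Matrix ι ι ℂ} (hf : ∀ k, f k ∈ C) (m : ℕ) :
    ∑ k ∈ Finset.range (m + 1), f k ∈ C := by
  induction m with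
  | zero => simpa using hf 0
  | succ m ih => rw [Finset.sum_range_succ]; exact hC.add _ ih _ (hf _)

end IsDiagNonnegCone

omit [DecidableEq ι] in
lemma Matrix.mulVec_eq_zero_of_rank_le {N L : Matrix ι ι ℂ} (hr : N.rank ≤ L.rank)
    (hNL : ∀ v, N *ᵥ v = 0 → L *ᵥ v = 0) (v : ι → ℂ) (hv : L *ᵥ v = 0) : N *ᵥ v = 0 := by
  have hle : LinearMap.ker N.mulVecLin ≤ LinearMap.ker L.mulVecLin := by
    intro w hw
    simp only [LinearMap.mem_ker, mulVecLin_apply] at hw ⊢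
    exact hNL w hw
  have h1 := LinearMap.finrank_range_add_finrank_ker N.mulVecLin
  have h2 := LinearMap.finrank_range_add_finrank_ker L.mulVecLin
  have h3 := Submodule.eq_of_le_of_finrank_le hle (by
    unfold Matrix.rank at hr
    omega)
  have : v ∈ LinearMap.ker L.mulVecLin := by simpa using hv
  rw [← h3] at this
  simpa using this

lemma Matrix.exists_eigenvector_of_trace_ne_zero {N : Matrix ι ι ℂ} (h : N.trace ≠ 0) :
    ∃ μ : ℂ, μ ≠ 0 ∧ ∃ v, v ≠ 0 ∧ N *ᵥ v = μ • v := by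
  rw [trace_eq_sum_roots_charpoly] at h
  obtain ⟨μ, hμ, hμ0⟩ : ∃ μ ∈ N.charpoly.roots, μ ≠ 0 := by
    by_contra! hcon
    exact h (Multiset.sum_eq_zero hcon)
  refine ⟨μ, hμ0, ?_⟩
  have hroot := (Polynomial.mem_roots'.1 hμ).2
  rw [Polynomial.IsRoot, eval_charpoly, ← exists_mulVec_eq_zero_iff] at hroot
  obtain ⟨v, hv, hv0⟩ := hroot
  refine ⟨v, hv, ?_⟩
  rw [sub_mulVec, sub_eq_zero] at hv0
  rw [← hv0]
  simp [scalar_apply, ← smul_one_eq_diagonal, smul_mulVec]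

lemma Matrix.pow_mulVec_eq_smul {N : Matrix ι ι ℂ} {μ : ℂ} {v : ι → ℂ} (h : N *ᵥ v = μ • v)
    (k : ℕ) : N ^ k *ᵥ v = μ ^ k • v := by
  induction k with
  | zero => simp
  | succ k ih => rw [pow_succ, ← mulVec_mulVec, h, mulVec_smul, ih, smul_smul, pow_succ, mul_comm]

/-- A unimodular number other than `1` has a power with nonpositive real part. -/
lemma Complex.exists_pow_re_nonpos {z : ℂ} (h1 : ‖z‖ = 1) (hz : z ≠ 1) :
    ∃ k : ℕ, (z ^ (k + 1)).re ≤ 0 := by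
  by_contra! hcon
  have key : ∀ m : ℕ, 2 ^ m * (1 - z.re) ≤ 1 - (z ^ (2 ^ m)).re := by
    intro m
    induction m with
    | zero => simp
    | succ m ih =>
      have hpos : 0 < (z ^ (2 ^ m)).re := by
        have := hcon (2 ^ m - 1)
        rwa [Nat.sub_add_cancel Nat.one_le_two_pow] at this
      have hn : ‖z ^ (2 ^ m)‖ = 1 := by simp [h1]
      have hsq : (z ^ (2 ^ m)).re * (z ^ (2 ^ m)).re + (z ^ (2 ^ m)).im * (z ^ (2 ^ m)).im = 1 := by
        rw [← Complex.normSq_apply, Complex.normSq_eq_norm_sq, hn]; norm_num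
      have hle : (z ^ (2 ^ m)).re ≤ 1 := hn ▸ Complex.re_le_norm _
      have : (z ^ (2 ^ (m + 1))).re
          = (z ^ (2 ^ m)).re * (z ^ (2 ^ m)).re - (z ^ (2 ^ m)).im * (z ^ (2 ^ m)).im := by
        rw [pow_succ 2 m, pow_mul, pow_two, Complex.mul_re]
      rw [this, pow_succ]
      nlinarith
  have hlt : z.re < 1 := by
    refine lt_of_le_of_ne (h1 ▸ Complex.re_le_norm _) fun he => hz ?_
    have hsq : z.re * z.re + z.im * z.im = 1 := by
      rw [← Complex.normSq_apply, Complex.normSq_eq_norm_sq, h1]; norm_num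
    refine Complex.ext (by simpa using he) ?_
    have : z.im * z.im = 0 := by rw [he] at hsq; linarith
    simpa using this
  obtain ⟨m, hm⟩ := pow_unbounded_of_one_lt (1 / (1 - z.re)) (one_lt_two (α := ℝ))
  rw [div_lt_iff₀ (by linarith)] at hm
  have h2 := key m
  have h3 := hcon (2 ^ m - 1)
  rw [Nat.sub_add_cancel Nat.one_le_two_pow] at h3
  linarith

/-- A nonzero complex number which is not positive is a root of a real trinomial with nonnegative
coefficients and positive constant term. -/
lemma Complex.exists_nonneg_trinomial {z : ℂ} (h0 : z ≠ 0) (hz : ¬ 0 ≤ z) :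
    ∃ k : ℕ, ∃ a b : ℝ, 0 ≤ a ∧ 0 < b ∧
      (z ^ (k + 1)) * (z ^ (k + 1)) + a * z ^ (k + 1) + b = 0 := by
  have hn : (0 : ℝ) < ‖z‖ := norm_pos_iff.2 h0
  have hn' : (‖z‖ : ℂ) ≠ 0 := by exact_mod_cast hn.ne'
  obtain ⟨k, hk⟩ := Complex.exists_pow_re_nonpos (z := z / ‖z‖) (by simp [h0]) (by
    intro h
    rw [div_eq_one_iff_eq hn'] at h
    exact hz (h ▸ by exact_mod_cast hn.le))
  have hk' : (z ^ (k + 1)).re ≤ 0 := by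
    rw [div_pow, ← Complex.ofReal_pow, Complex.div_ofReal_re] at hk
    by_contra! hcon
    exact absurd hk (not_le.2 (by positivity))
  refine ⟨k, -2 * (z ^ (k + 1)).re, Complex.normSq (z ^ (k + 1)), by linarith,
    Complex.normSq_pos.2 (pow_ne_zero _ h0), ?_⟩
  generalize z ^ (k + 1) = w
  apply Complex.ext <;> simp [Complex.normSq_apply] <;> ring

variable {C : Set (Matrix ι ι ℂ)}

lemma IsDiagNonnegCone.eigenvalue_nonneg (hC : IsDiagNonnegCone C) {N : Matrix ι ι ℂ}
    (hN : N ∈ C) (hmin : ∀ L ∈ C, L ≠ 0 → N.rank ≤ L.rank) (htr : N.trace ≠ 0)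
    {μ : ℂ} (hμ : μ ≠ 0) {v : ι → ℂ} (hv : v ≠ 0) (hNv : N *ᵥ v = μ • v) : 0 ≤ μ := by
  by_contra hneg
  obtain ⟨k, a, b, ha, hb, hroot⟩ := Complex.exists_nonneg_trinomial hμ hneg
  set L := N ^ (k + 1) * N ^ (k + 1) * N + (a : ℂ) • (N ^ (k + 1) * N) + (b : ℂ) • N with hL
  have m1 : N ^ (k + 1) * N ^ (k + 1) * N ∈ C :=
    hC.mul _ (hC.mul _ (hC.pow_mem hN k) _ (hC.pow_mem hN k)) _ hN
  have m2 : N ^ (k + 1) * N ∈ C := hC.mul _ (hC.pow_mem hN k) _ hN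
  have hLC : L ∈ C := hC.add _ (hC.add _ m1 _ (hC.smul a ha _ m2)) _ (hC.smul b hb.le _ hN)
  have hLv : L *ᵥ v = 0 := by
    have hp := Matrix.pow_mulVec_eq_smul hNv (k + 1)
    simp only [hL, add_mulVec, smul_mulVec, ← mulVec_mulVec, hNv, mulVec_smul, hp, smul_smul]
    rw [← add_smul, ← add_smul]
    rw [show μ * (μ ^ (k + 1) * μ ^ (k + 1)) + a * (μ * μ ^ (k + 1)) + b * μ =
      μ * ((μ ^ (k + 1)) * (μ ^ (k + 1)) + a * μ ^ (k + 1) + b) by ring, hroot]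
    simp
  by_cases hL0 : L = 0
  · have ht : L.trace = 0 := by simp [hL0]
    rw [hL, trace_add, trace_add, trace_smul, trace_smul] at ht
    have t1 := hC.trace_nonneg m1
    have t2 := hC.trace_nonneg m2
    have t3 := lt_of_le_of_ne (hC.trace_nonneg hN) htr.symm
    have hb' : (0 : ℂ) < b := by exact_mod_cast hb
    have ha' : (0 : ℂ) ≤ a := by exact_mod_cast ha
    have : 0 < (N ^ (k + 1) * N ^ (k + 1) * N).trace + (a : ℂ) • (N ^ (k + 1) * N).trace
        + (b : ℂ) • N.trace := by
      simp only [smul_eq_mul]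
      exact add_pos_of_nonneg_of_pos (add_nonneg t1 (mul_nonneg ha' t2)) (mul_pos hb' t3)
    exact this.ne' ht
  · have := Matrix.mulVec_eq_zero_of_rank_le (hmin L hLC hL0) (fun w hw => by
      simp [hL, add_mulVec, smul_mulVec, ← mulVec_mulVec, hw]) v hLv
    rw [hNv, smul_eq_zero] at this
    exact this.elim hμ hv

lemma IsDiagNonnegCone.exists_norm_pow_le (hC : IsDiagNonnegCone C) {N : Matrix ι ι ℂ}
    (hN : N ∈ C) (hmin : ∀ L ∈ C, L ≠ 0 → N.rank ≤ L.rank)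
    {v : ι → ℂ} (hv : v ≠ 0) (hNv : N *ᵥ v = v) : ∃ c : ℝ, ∀ k, ‖N ^ (k + 1)‖ ≤ c := by
  by_contra! hcon
  choose k hk using fun m : ℕ => hcon (m + 1)
  have hpos : ∀ m, 0 < ‖N ^ (k m + 1)‖ := fun m => lt_trans (by positivity) (hk m)
  set x : ℕ → Matrix ι ι ℂ := fun m => ((‖N ^ (k m + 1)‖⁻¹ : ℝ) : ℂ) • N ^ (k m + 1) with hx
  have : ProperSpace (Matrix ι ι ℂ) := FiniteDimensional.proper ℂ _
  have hxn : ∀ m, ‖x m‖ = 1 := fun m => by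
    simp only [hx, norm_smul, Complex.norm_real, norm_inv, norm_norm]
    exact inv_mul_cancel₀ (hpos m).ne'
  obtain ⟨L, -, φ, hφ, hlim⟩ := tendsto_subseq_of_bounded
    (Metric.isBounded_sphere (x := (0 : Matrix ι ι ℂ)) (r := 1)) (x := x) (fun m => by simp [hxn])
  have hLC : L ∈ C := hC.closed.mem_of_tendsto hlim (Eventually.of_forall fun m =>
    hC.smul _ (by positivity) _ (hC.pow_mem hN _))
  have hLn : ‖L‖ = 1 := tendsto_nhds_unique hlim.norm (by simp [hxn])
  have hL0 : L ≠ 0 := by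
    rintro rfl
    simp at hLn
  have happ : ∀ w, Tendsto (fun m => x (φ m) *ᵥ w) atTop (𝓝 (L *ᵥ w)) := fun w =>
    ((continuous_id.matrix_mulVec continuous_const).tendsto L).comp hlim
  have hLv : L *ᵥ v = 0 := by
    refine tendsto_nhds_unique (happ v) ?_
    have h1 : Tendsto (fun m => ‖N ^ (k m + 1)‖⁻¹) atTop (𝓝 0) := by
      refine tendsto_inv_atTop_zero.comp ?_
      refine tendsto_atTop_mono (fun m => (hk m).le) ?_
      exact tendsto_atTop_add_const_right _ _ tendsto_natCast_atTop_atTop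
    have h2 : Tendsto (fun m => ((‖N ^ (k (φ m) + 1)‖⁻¹ : ℝ) : ℂ) • v) atTop
        (𝓝 (((0 : ℝ) : ℂ) • v)) :=
      ((Complex.continuous_ofReal.tendsto _).comp (h1.comp hφ.tendsto_atTop)).smul_const v
    simp only [Complex.ofReal_zero, zero_smul] at h2
    refine h2.congr fun m => ?_
    have := Matrix.pow_mulVec_eq_smul (N := N) (μ := 1) (v := v) (by simpa using hNv)
      (k (φ m) + 1)
    simp only [hx, smul_mulVec, this, one_pow, one_smul]
  have := Matrix.mulVec_eq_zero_of_rank_le (hmin L hLC hL0) (fun w hw => by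
    refine tendsto_nhds_unique (happ w) ?_
    refine tendsto_const_nhds.congr fun m => ?_
    simp only [hx, smul_mulVec, pow_succ, ← mulVec_mulVec, hw, mulVec_zero, smul_zero]) v hLv
  rw [hNv] at this
  exact hv this

lemma IsDiagNonnegCone.mul_self_of_fixed (hC : IsDiagNonnegCone C) {N : Matrix ι ι ℂ}
    (hN : N ∈ C) (hmin : ∀ L ∈ C, L ≠ 0 → N.rank ≤ L.rank)
    {v : ι → ℂ} (hv : v ≠ 0) (hNv : N *ᵥ v = v) : N * N = N := by
  obtain ⟨c, hc⟩ := hC.exists_norm_pow_le hN hmin hv hNv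
  have : ProperSpace (Matrix ι ι ℂ) := FiniteDimensional.proper ℂ _
  set x : ℕ → Matrix ι ι ℂ := fun m =>
    (((m + 1 : ℝ)⁻¹ : ℝ) : ℂ) • ∑ k ∈ Finset.range (m + 1), N ^ (k + 1) with hx
  have hxn : ∀ m, ‖x m‖ ≤ c := fun m => by
    have h1 : ‖∑ k ∈ Finset.range (m + 1), N ^ (k + 1)‖ ≤ (m + 1) * c := by
      refine (norm_sum_le _ _).trans ((Finset.sum_le_sum fun k _ => hc k).trans ?_)
      simp
    have hm : (0 : ℝ) < m + 1 := by positivity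
    simp only [hx, norm_smul, Complex.norm_real, norm_inv, Real.norm_of_nonneg hm.le]
    rwa [inv_mul_le_iff₀ hm]
  obtain ⟨L, -, φ, hφ, hlim⟩ := tendsto_subseq_of_bounded
    (Metric.isBounded_closedBall (x := (0 : Matrix ι ι ℂ)) (r := c)) (x := x)
    (fun m => by simpa using hxn m)
  have hLC : L ∈ C := hC.closed.mem_of_tendsto hlim (Eventually.of_forall fun m =>
    hC.smul _ (by positivity) _ (hC.sum_mem (hC.pow_mem hN) _))
  have happ : ∀ w, Tendsto (fun m => x (φ m) *ᵥ w) atTop (𝓝 (L *ᵥ w)) := fun w =>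
    ((continuous_id.matrix_mulVec continuous_const).tendsto L).comp hlim
  have hxv : ∀ m, x m *ᵥ v = v := fun m => by
    have hm : ((m : ℂ) + 1) ≠ 0 := by exact_mod_cast Nat.succ_ne_zero m
    have hp := Matrix.pow_mulVec_eq_smul (N := N) (μ := 1) (v := v) (by simpa using hNv)
    simp only [hx, smul_mulVec, sum_mulVec, hp, one_pow, one_smul, Finset.sum_const,
      Finset.card_range, ← Nat.cast_smul_eq_nsmul ℂ, smul_smul]
    push_cast
    rw [inv_mul_cancel₀ hm, one_smul]
  have hLv : L *ᵥ v = v :=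
    tendsto_nhds_unique (happ v) (by simp [hxv])
  have hL0 : L ≠ 0 := by
    rintro rfl
    simp at hLv
    exact hv hLv.symm
  have hLN : L * N - L = 0 := by
    have h1 : Tendsto (fun m => x (φ m) * N - x (φ m)) atTop (𝓝 (L * N - L)) :=
      (hlim.mul_const N).sub hlim
    refine tendsto_nhds_unique h1 ?_
    have h2 : Tendsto (fun m : ℕ => ((m + 1 : ℝ)⁻¹) * (c + ‖N‖)) atTop (𝓝 (0 * (c + ‖N‖))) := by
      refine Tendsto.mul_const _ (tendsto_inv_atTop_zero.comp ?_)
      exact tendsto_atTop_add_const_right _ _ tendsto_natCast_atTop_atTop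
    rw [zero_mul] at h2
    refine squeeze_zero_norm (fun m => ?_) (h2.comp hφ.tendsto_atTop)
    have h3 : ∀ m : ℕ, (∑ k ∈ Finset.range (m + 1), N ^ (k + 1)) * N
        - ∑ k ∈ Finset.range (m + 1), N ^ (k + 1) = N ^ (m + 1 + 1) - N := by
      intro m
      rw [Finset.sum_mul, ← Finset.sum_sub_distrib]
      simp only [← pow_succ]
      rw [Finset.sum_range_sub (fun k => N ^ (k + 1))]
      simp
    have hm : (0 : ℝ) < (φ m : ℝ) + 1 := by positivity
    simp only [hx, Function.comp_apply, smul_mul_assoc, ← smul_sub, h3, norm_smul,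
      Complex.norm_real, norm_inv, Real.norm_of_nonneg hm.le]
    gcongr
    exact (norm_sub_le _ _).trans (add_le_add (hc _) le_rfl)
  have hker := Matrix.mulVec_eq_zero_of_rank_le (hmin L hLC hL0) (fun w hw => by
    refine tendsto_nhds_unique (happ w) ?_
    refine tendsto_const_nhds.congr fun m => ?_
    simp only [hx, smul_mulVec, sum_mulVec, pow_succ, ← mulVec_mulVec, hw, mulVec_zero,
      Finset.sum_const_zero, smul_zero])
  rw [← sub_eq_zero]
  refine Matrix.ext_of_mulVec_single fun j => ?_
  have h4 := hker (N *ᵥ Pi.single j 1 - Pi.single j 1) (by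
    rw [mulVec_sub, mulVec_mulVec, ← sub_mulVec, hLN, zero_mulVec])
  rw [mulVec_sub, mulVec_mulVec, ← sub_mulVec] at h4
  rw [h4, zero_mulVec]

/-- A member of minimal rank with nonzero trace is a positive multiple of an idempotent. -/
lemma IsDiagNonnegCone.exists_mul_self_eq_smul (hC : IsDiagNonnegCone C) {N : Matrix ι ι ℂ}
    (hN : N ∈ C) (hmin : ∀ L ∈ C, L ≠ 0 → N.rank ≤ L.rank) (htr : N.trace ≠ 0) :
    ∃ r : ℝ, 0 < r ∧ N * N = (r : ℂ) • N := by
  obtain ⟨μ, hμ, v, hv, hNv⟩ := Matrix.exists_eigenvector_of_trace_ne_zero htr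
  have hnn := hC.eigenvalue_nonneg hN hmin htr hμ hv hNv
  obtain ⟨r, hr, rfl⟩ := RCLike.nonneg_iff_exists_ofReal.1 hnn
  have hr0 : r ≠ 0 := by
    rintro rfl
    simp at hμ
  refine ⟨r, lt_of_le_of_ne hr hr0.symm, ?_⟩
  simp only [Complex.coe_algebraMap] at hNv hμ ⊢
  have hM : ((r⁻¹ : ℝ) : ℂ) • N ∈ C := hC.smul _ (by positivity) _ hN
  have h := hC.mul_self_of_fixed hM (fun L hL hL0 => le_trans (by
    rw [← Matrix.mul_one N, ← Matrix.mul_smul]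
    exact (Matrix.rank_mul_le_left _ _).trans (by simp)) (hmin L hL hL0)) hv (by
      rw [smul_mulVec, hNv, smul_smul]
      push_cast
      rw [inv_mul_cancel₀ hμ, one_smul])
  push_cast at h
  rw [smul_mul_smul_comm] at h
  have h2 := congrArg (fun M => ((r : ℂ) * r) • M) h
  simp only [smul_smul] at h2
  rw [show (r : ℂ) * r * ((r : ℂ)⁻¹ * (r : ℂ)⁻¹) = 1 by field_simp,
    show (r : ℂ) * r * (r : ℂ)⁻¹ = r by field_simp, one_smul] at h2
  exact h2

/-- An absolutely irreducible set inside a closed multiplicative cone with nonnegative diagonals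
forces the cone to contain a matrix of rank one. -/
lemma IsDiagNonnegCone.exists_vecMulVec_mem [Nonempty ι] (hC : IsDiagNonnegCone C)
    {S : Set (Matrix ι ι ℂ)} (hSC : S ⊆ C)
    (hS : ∀ w : ι → ℂ, w ≠ 0 → ∀ f : ι → ℂ, f ≠ 0 → ∃ A ∈ S, f ⬝ᵥ (A *ᵥ w) ≠ 0) :
    ∃ u v : ι → ℂ, u ≠ 0 ∧ v ≠ 0 ∧ vecMulVec u v ∈ C := by
  have hne : {M | M ∈ C ∧ M ≠ 0}.Nonempty := by
    let i := Classical.arbitrary ι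
    have h1 : (Pi.single i 1 : ι → ℂ) ≠ 0 := by simp
    obtain ⟨A, hA, hA0⟩ := hS _ h1 _ h1
    refine ⟨A, hSC hA, ?_⟩
    rintro rfl
    simp at hA0
  obtain ⟨M, ⟨hM, hM0⟩, hmin⟩ := WellFounded.has_min (measure Matrix.rank).wf _ hne
  replace hmin : ∀ L ∈ C, L ≠ 0 → M.rank ≤ L.rank := fun L hL hL0 =>
    not_lt.1 (hmin L ⟨hL, hL0⟩)
  have exists_col : ∀ M : Matrix ι ι ℂ, M ≠ 0 → ∃ j, M *ᵥ Pi.single j 1 ≠ 0 := by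
    intro M hM
    by_contra! hcon
    exact hM (Matrix.ext_of_mulVec_single fun j => by rw [hcon j, zero_mulVec])
  obtain ⟨N, hN, hNtr, hNr⟩ : ∃ N ∈ C, N.trace ≠ 0 ∧ N.rank ≤ M.rank := by
    obtain ⟨j, hj⟩ := exists_col M hM0
    obtain ⟨A, hA, hA0⟩ := hS _ hj (Pi.single j 1) (by simp)
    refine ⟨A * M, hC.mul _ (hSC hA) _ hM, ?_, Matrix.rank_mul_le_right _ _⟩
    intro h0
    have hd := hC.diag _ (hC.mul _ (hSC hA) _ hM)
    have := (Finset.sum_eq_zero_iff_of_nonneg fun i _ => hd i).1 h0 j (Finset.mem_univ j)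
    rw [mulVec_mulVec] at hA0
    simp at hA0
    exact hA0 this
  obtain ⟨r, hr, hrN⟩ := hC.exists_mul_self_eq_smul hN
    (fun L hL hL0 => hNr.trans (hmin L hL hL0)) hNtr
  have hr' : (r : ℂ) ≠ 0 := by exact_mod_cast hr.ne'
  set E := ((r⁻¹ : ℝ) : ℂ) • N with hE
  have hEC : E ∈ C := hC.smul _ (by positivity) _ hN
  have hEE : E * E = E := by
    rw [hE, smul_mul_smul_comm, hrN, smul_smul]
    push_cast
    rw [mul_assoc, inv_mul_cancel₀ hr', mul_one]
  have hEtr : E.trace ≠ 0 := by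
    rw [hE, trace_smul, smul_eq_mul]
    exact mul_ne_zero (by push_cast; exact inv_ne_zero hr') hNtr
  have hE0 : E ≠ 0 := by
    intro h
    simp [h] at hEtr
  have hEmin : ∀ L ∈ C, L ≠ 0 → E.rank ≤ L.rank := fun L hL hL0 => by
    refine le_trans ?_ (hNr.trans (hmin L hL hL0))
    rw [hE, ← Matrix.mul_one N, ← Matrix.mul_smul]
    exact (Matrix.rank_mul_le_left _ _).trans (by simp)
  have hscal : ∀ A ∈ C, ∃ c : ℂ, E * A * E = c • E := by
    intro A hA
    have hm : E * A * E ∈ C := hC.mul _ (hC.mul _ hEC _ hA) _ hEC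
    set T := E + E * A * E with hT
    have hTC : T ∈ C := hC.add _ hEC _ hm
    have hTtr : T.trace ≠ 0 := by
      rw [hT, trace_add]
      exact (add_pos_of_pos_of_nonneg (lt_of_le_of_ne (hC.trace_nonneg hEC) hEtr.symm)
        (hC.trace_nonneg hm)).ne'
    have hT0 : T ≠ 0 := by
      intro h
      simp [h] at hTtr
    have hTE : T.rank ≤ E.rank := by
      have : T = E * (1 + A * E) := by rw [hT, mul_add, mul_one, mul_assoc]
      rw [this]
      exact Matrix.rank_mul_le_left _ _
    obtain ⟨l, -, hl⟩ := hC.exists_mul_self_eq_smul hTC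
      (fun L hL hL0 => hTE.trans (hEmin L hL hL0)) hTtr
    have hker := Matrix.mulVec_eq_zero_of_rank_le (hEmin T hTC hT0) (fun w hw => by
      simp [hT, add_mulVec, ← mulVec_mulVec, hw])
    have hET : E * T = T := by
      rw [hT, mul_add, hEE, ← mul_assoc, ← mul_assoc, hEE]
    have hTl : T = (l : ℂ) • E := by
      refine Matrix.ext_of_mulVec_single fun j => ?_
      have := hker (T *ᵥ Pi.single j 1 - (l : ℂ) • Pi.single j 1) (by
        rw [mulVec_sub, mulVec_mulVec, hl, mulVec_smul, smul_mulVec, sub_self])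
      rwa [mulVec_sub, mulVec_mulVec, hET, mulVec_smul, sub_eq_zero, ← smul_mulVec] at this
    refine ⟨l - 1, ?_⟩
    rw [sub_smul, one_smul, ← hTl, hT, add_sub_cancel_left]
  obtain ⟨j, hj⟩ := exists_col E hE0
  set u := E *ᵥ Pi.single j 1 with hu
  have hEu : E *ᵥ u = u := by rw [hu, mulVec_mulVec, hEE]
  obtain ⟨i, hi⟩ := Function.ne_iff.1 hj
  have hann : ∀ f : ι → ℂ, f ⬝ᵥ u = 0 → f ᵥ* E = 0 := by
    intro f hf
    by_contra hcon
    obtain ⟨A, hA, hA0⟩ := hS u hj _ hcon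
    obtain ⟨c, hc⟩ := hscal A (hSC hA)
    apply hA0
    rw [← dotProduct_mulVec]
    nth_rw 1 [← hEu]
    rw [mulVec_mulVec, mulVec_mulVec, hc, smul_mulVec, hEu, dotProduct_smul, hf,
      smul_zero]
  have hEeq : E = vecMulVec u (fun l => E i l / u i) := by
    ext k l
    have h1 := congrFun (hann (u i • Pi.single k 1 - u k • Pi.single i 1) (by
      simp [sub_dotProduct, mul_comm])) l
    simp [sub_vecMul, smul_vecMul, sub_eq_zero] at h1
    have hi' : u i ≠ 0 := hi
    rw [vecMulVec_apply]
    field_simp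
    rw [mul_comm, h1]
  refine ⟨u, _, hj, ?_, hEeq ▸ hEC⟩
  intro h
  rw [h] at hEeq
  exact hE0 (by rw [hEeq]; ext; simp [vecMulVec_apply])

omit [DecidableEq ι] in
/-- The closed convex cone generated by a multiplicative semigroup of matrices whose members have
nonnegative diagonals. -/
lemma isDiagNonnegCone_closure_span {S : Set (Matrix ι ι ℂ)}
    (hS : ∀ A ∈ S, ∀ B ∈ S, A * B ∈ S) (hd : ∀ A ∈ S, ∀ i, 0 ≤ A i i) :
    IsDiagNonnegCone (closure (Submodule.span NNReal S : Set (Matrix ι ι ℂ))) := by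
  have hmul : ∀ A ∈ Submodule.span NNReal S, ∀ B ∈ Submodule.span NNReal S,
      A * B ∈ Submodule.span NNReal S := by
    intro A hA B hB
    induction hA, hB using Submodule.span_induction₂ with
    | mem_mem x y hx hy => exact Submodule.subset_span (hS x hx y hy)
    | zero_left => simp
    | zero_right => simp
    | add_left x y z _ _ _ h1 h2 => rw [add_mul]; exact add_mem h1 h2
    | add_right x y z _ _ _ h1 h2 => rw [mul_add]; exact add_mem h1 h2
    | smul_left r x y _ _ h => rw [smul_mul_assoc]; exact Submodule.smul_mem _ _ h
    | smul_right r x y _ _ h => rw [mul_smul_comm]; exact Submodule.smul_mem _ _ h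
  have hdiag : ∀ A ∈ Submodule.span NNReal S, ∀ i, 0 ≤ A i i := by
    intro A hA i
    induction hA using Submodule.span_induction with
    | mem x hx => exact hd x hx i
    | zero => simp
    | add x y _ _ h1 h2 => exact add_nonneg h1 h2
    | smul r x _ h =>
      rw [Matrix.smul_apply, NNReal.smul_def, Complex.real_smul]
      exact mul_nonneg (by exact_mod_cast r.2) h
  refine ⟨isClosed_closure, fun A hA B hB => ?_, fun r hr A hA => ?_, fun A hA B hB => ?_,
    fun A hA i => ?_⟩
  · exact map_mem_closure₂ continuous_add hA hB fun a ha b hb => add_mem ha hb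
  · refine map_mem_closure (continuous_const_smul (r : ℂ)) hA fun a ha => ?_
    have := Submodule.smul_mem (Submodule.span NNReal S) r.toNNReal ha
    rwa [show r.toNNReal • a = (r : ℂ) • a by
      ext i j
      simp [NNReal.smul_def, hr]] at this
  · exact map_mem_closure₂ (continuous_fst.matrix_mul continuous_snd) hA hB
      fun a ha b hb => hmul a ha b hb
  · have hcl : IsClosed {A : Matrix ι ι ℂ | 0 ≤ A i i} :=
      isClosed_Ici.preimage (continuous_id.matrix_elem i i)
    exact closure_minimal (fun a ha => hdiag a ha i) hcl hA

end RankOne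
section Perron

open scoped ComplexOrder

variable {κ : Type*} [Fintype κ] [DecidableEq κ]

omit [DecidableEq κ] in
lemma Matrix.mulVec_apply_pos {C : Matrix κ κ ℝ} (hC : ∀ i j, 0 < C i j) {x : κ → ℝ}
    (hx : ∀ i, 0 ≤ x i) (hx0 : x ≠ 0) (i : κ) : 0 < (C *ᵥ x) i := by
  obtain ⟨j, hj⟩ := Function.ne_iff.1 hx0
  exact Finset.sum_pos' (fun l _ => mul_nonneg (hC i l).le (hx l))
    ⟨j, Finset.mem_univ j, mul_pos (hC i j) (lt_of_le_of_ne (hx j) (Ne.symm hj))⟩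

/-- Perron's theorem for a nonnegative matrix commuting with a positive one. -/
lemma Matrix.exists_pos_eigenvector [Nonempty κ] {B C : Matrix κ κ ℝ} (hB : ∀ i j, 0 ≤ B i j)
    (hC : ∀ i j, 0 < C i j) (hBC : B * C = C * B) :
    ∃ r : ℝ, 0 ≤ r ∧ ∃ p : κ → ℝ, (∀ i, 0 < p i) ∧ B *ᵥ p = r • p := by
  set M : ℝ := ∑ i, ∑ j, B i j with hM
  set T : Set ((κ → ℝ) × ℝ) :=
    (stdSimplex ℝ κ ×ˢ Set.Icc 0 M) ∩ {z | ∀ i, z.2 * z.1 i ≤ (B *ᵥ z.1) i} with hT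
  have hTc : IsCompact T := by
    refine ((isCompact_stdSimplex ℝ κ).prod isCompact_Icc).inter_right ?_
    simp only [Set.ofPred_forall]
    refine isClosed_iInter fun i => isClosed_le (by fun_prop) ?_
    exact (continuous_apply i).comp (continuous_const.matrix_mulVec continuous_fst)
  have hbound : ∀ x ∈ stdSimplex ℝ κ, ∀ r : ℝ, (∀ i, r * x i ≤ (B *ᵥ x) i) → r ≤ M := by
    intro x hx r h
    calc r = ∑ i, r * x i := by rw [← Finset.mul_sum, hx.2, mul_one]
      _ ≤ ∑ i, (B *ᵥ x) i := Finset.sum_le_sum fun i _ => h i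
      _ ≤ M := by
        refine Finset.sum_le_sum fun i _ => Finset.sum_le_sum fun j _ => ?_
        have : x j ≤ 1 := hx.2 ▸ Finset.single_le_sum (fun i _ => hx.1 i) (Finset.mem_univ j)
        exact mul_le_of_le_one_right (hB i j) this
  have hBx : ∀ x : κ → ℝ, (∀ i, 0 ≤ x i) → ∀ i, 0 ≤ (B *ᵥ x) i := fun x hx i =>
    Finset.sum_nonneg fun j _ => mul_nonneg (hB i j) (hx j)
  have hne : T.Nonempty := by
    let i := Classical.arbitrary κ
    have hs : (Pi.single i 1 : κ → ℝ) ∈ stdSimplex ℝ κ := single_mem_stdSimplex ℝ i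
    have h0 : ∀ j, (0 : ℝ) * (Pi.single i 1 : κ → ℝ) j ≤ (B *ᵥ Pi.single i 1) j := fun j => by
      rw [zero_mul]; exact hBx _ hs.1 j
    exact ⟨(Pi.single i 1, 0), ⟨hs, le_rfl, hbound _ hs 0 h0⟩, h0⟩
  obtain ⟨⟨x, r⟩, ⟨⟨hx, hr⟩, hxr⟩, hmax⟩ :=
    hTc.exists_isMaxOn hne (f := Prod.snd) continuous_snd.continuousOn
  simp only at hx hr hxr
  have hx0 : x ≠ 0 := by
    rintro rfl
    simpa using hx.2
  have hCx := Matrix.mulVec_apply_pos hC hx.1 hx0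
  have hy : B *ᵥ x = r • x := by
    by_contra hcon
    have hy0 : B *ᵥ x - r • x ≠ 0 := sub_ne_zero.2 hcon
    have hCy := Matrix.mulVec_apply_pos hC (x := B *ᵥ x - r • x)
      (fun i => by simpa using hxr i) hy0
    obtain ⟨i₀, -, hi₀⟩ := Finset.exists_min_image Finset.univ
      (fun i => (C *ᵥ (B *ᵥ x - r • x)) i / (C *ᵥ x) i) Finset.univ_nonempty
    set ε := (C *ᵥ (B *ᵥ x - r • x)) i₀ / (C *ᵥ x) i₀ with hε
    have hεpos : 0 < ε := div_pos (hCy _) (hCx _)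
    set s : ℝ := ∑ i, (C *ᵥ x) i with hs
    have hspos : 0 < s := Finset.sum_pos (fun i _ => hCx i) Finset.univ_nonempty
    have hz : s⁻¹ • (C *ᵥ x) ∈ stdSimplex ℝ κ := by
      refine ⟨fun i => mul_nonneg (by positivity) (hCx i).le, ?_⟩
      simp only [Pi.smul_apply, smul_eq_mul, ← Finset.mul_sum]
      exact inv_mul_cancel₀ hspos.ne'
    have hzr : ∀ i, (r + ε) * (s⁻¹ • (C *ᵥ x)) i ≤ (B *ᵥ (s⁻¹ • (C *ᵥ x))) i := by
      intro i
      have h1 := hi₀ i (Finset.mem_univ i)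
      rw [le_div_iff₀ (hCx i)] at h1
      rw [mulVec_sub, mulVec_smul, mulVec_mulVec, ← hBC, ← mulVec_mulVec] at h1
      simp only [Pi.sub_apply, Pi.smul_apply, smul_eq_mul] at h1
      rw [mulVec_smul]
      simp only [Pi.smul_apply, smul_eq_mul]
      have h2 : (r + ε) * (C *ᵥ x) i ≤ (B *ᵥ C *ᵥ x) i := by linarith
      calc (r + ε) * (s⁻¹ * (C *ᵥ x) i) = s⁻¹ * ((r + ε) * (C *ᵥ x) i) := by ring
        _ ≤ _ := by gcongr
    have hmem : (s⁻¹ • (C *ᵥ x), r + ε) ∈ T :=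
      ⟨⟨hz, by have := hr.1; positivity, hbound _ hz _ hzr⟩, hzr⟩
    have := hmax hmem
    simp only [Set.mem_ofPred_eq] at this
    linarith
  refine ⟨r, hr.1, C *ᵥ x, hCx, ?_⟩
  rw [mulVec_mulVec, hBC, ← mulVec_mulVec, hy, mulVec_smul]

/-- No proper nonempty set of indices is closed under the directed graph of the matrix. -/
def Matrix.NoInvariantSet {R : Type*} [Zero R] (A : Matrix κ κ R) : Prop :=
  ∀ s : Set κ, s.Nonempty → sᶜ.Nonempty → ∃ i ∈ sᶜ, ∃ j ∈ s, A i j ≠ 0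

omit [Fintype κ] [DecidableEq κ] in
lemma Matrix.NoInvariantSet.transpose {R : Type*} [Zero R] {A : Matrix κ κ R}
    (hA : A.NoInvariantSet) : Aᵀ.NoInvariantSet := by
  intro s hs hs'
  obtain ⟨i, hi, j, hj, h⟩ := hA sᶜ hs' (by rwa [compl_compl])
  exact ⟨j, hj, i, by rwa [compl_compl] at hi, h⟩

lemma Matrix.NoInvariantSet.exists_sum_pow_pos {B : Matrix κ κ ℝ} (hB : ∀ i j, 0 ≤ B i j)
    (hBi : B.NoInvariantSet) : ∃ m, ∀ i j, 0 < (∑ k ∈ Finset.range m, B ^ k) i j := by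
  have h : ∀ i j, ∃ k, 0 < (B ^ k) i j := by
    intro i j
    by_contra hcon
    obtain ⟨l, hl, t, ⟨k, hk⟩, hlt⟩ := hBi {i | ∃ k, 0 < (B ^ k) i j} ⟨j, 0, by simp⟩ ⟨i, hcon⟩
    refine hl ⟨k + 1, ?_⟩
    rw [pow_succ', mul_apply]
    exact Finset.sum_pos' (fun s _ => mul_nonneg (hB l s) (pow_apply_nonneg hB k s j))
      ⟨t, Finset.mem_univ t, mul_pos (lt_of_le_of_ne (hB l t) hlt.symm) hk⟩
  choose f hf using h
  refine ⟨(Finset.univ.sup fun i => Finset.univ.sup fun j => f i j) + 1, fun i j => ?_⟩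
  rw [sum_apply]
  refine Finset.sum_pos' (fun k _ => pow_apply_nonneg hB k i j) ⟨f i j, ?_, hf i j⟩
  rw [Finset.mem_range, Nat.lt_succ_iff]
  exact (Finset.le_sup (f := fun j => f i j) (Finset.mem_univ j)).trans
    (Finset.le_sup (f := fun i => Finset.univ.sup fun j => f i j) (Finset.mem_univ i))

lemma Matrix.NoInvariantSet.exists_pos_eigenvector [Nonempty κ] {B : Matrix κ κ ℝ}
    (hB : ∀ i j, 0 ≤ B i j) (hBi : B.NoInvariantSet) :
    ∃ r : ℝ, 0 ≤ r ∧ ∃ p : κ → ℝ, (∀ i, 0 < p i) ∧ B *ᵥ p = r • p := by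
  obtain ⟨m, hm⟩ := hBi.exists_sum_pow_pos hB
  exact Matrix.exists_pos_eigenvector hB hm
    (Commute.sum_right _ _ _ fun k _ => Commute.pow_right rfl k)

/-- A set of nonnegative vectors which spans and is invariant under `A`. -/
structure IsInvariantNonnegSet (A : Matrix κ κ ℂ) (X : Set (κ → ℂ)) : Prop where
  nonneg : ∀ x ∈ X, ∀ i, 0 ≤ x i
  spans : ∀ f : κ → ℂ, f ≠ 0 → ∃ x ∈ X, f ⬝ᵥ x ≠ 0
  invariant : ∀ x ∈ X, A *ᵥ x ∈ X

lemma IsInvariantNonnegSet.pow_mulVec_mem {A : Matrix κ κ ℂ} {X : Set (κ → ℂ)}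
    (hX : IsInvariantNonnegSet A X) {x : κ → ℂ} (hx : x ∈ X) (k : ℕ) : A ^ k *ᵥ x ∈ X := by
  induction k with
  | zero => simpa using hx
  | succ k ih => rw [pow_succ', ← mulVec_mulVec]; exact hX.invariant _ ih

/-- A matrix which is similar to a nonnegative indecomposable one through a diagonal unitary `d`
and preserves a spanning set of nonnegative vectors: then `d` is scalar. -/
lemma IsInvariantNonnegSet.phase_eq {A : Matrix κ κ ℂ} {X : Set (κ → ℂ)}
    (hX : IsInvariantNonnegSet A X) (hA : A.NoInvariantSet) {d : κ → ℂ} (hd : ∀ i, ‖d i‖ = 1)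
    (hdA : ∀ i j, 0 ≤ d i * A i j * (d j)⁻¹) (i j : κ) : d i = d j := by
  have : Nonempty κ := ⟨i⟩
  have hd0 : ∀ i, d i ≠ 0 := fun i => norm_ne_zero_iff.1 (by simp [hd])
  set B : Matrix κ κ ℝ := Matrix.of fun i j => (d i * A i j * (d j)⁻¹).re with hB
  have hBA : ∀ i j, A i j = (d i)⁻¹ * (B i j : ℂ) * d j := fun i j => by
    have h1 : ((B i j : ℝ) : ℂ) = d i * A i j * (d j)⁻¹ :=
      (Complex.eq_re_of_ofReal_le (r := 0) (by simpa using hdA i j)).symm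
    rw [h1]
    have := hd0 i
    have := hd0 j
    field_simp
  have hB0 : ∀ i j, 0 ≤ B i j := fun i j => (Complex.nonneg_iff.1 (hdA i j)).1
  have hBi : B.NoInvariantSet := by
    intro s hs hs'
    obtain ⟨i, hi, j, hj, h⟩ := hA s hs hs'
    refine ⟨i, hi, j, hj, fun h0 => h ?_⟩
    rw [hBA, h0]
    simp
  have hpow : ∀ k i j, (A ^ k) i j = (d i)⁻¹ * ((B ^ k) i j : ℂ) * d j := by
    intro k
    induction k with
    | zero =>
      intro i j
      by_cases hij : i = j
      · subst hij
        simp [hd0 i]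
      · simp [hij]
    | succ k ih =>
      intro i j
      rw [pow_succ, mul_apply, pow_succ, mul_apply]
      push_cast
      rw [Finset.mul_sum, Finset.sum_mul]
      refine Finset.sum_congr rfl fun l _ => ?_
      rw [ih, hBA]
      have := hd0 l
      field_simp
  obtain ⟨m, hm⟩ := hBi.exists_sum_pow_pos hB0
  set C := ∑ k ∈ Finset.range m, B ^ k with hC
  set P := ∑ k ∈ Finset.range m, A ^ k with hP
  have hPC : ∀ i j, P i j = (d i)⁻¹ * (C i j : ℂ) * d j := fun i j => by
    rw [hP, hC, Matrix.sum_apply, Matrix.sum_apply]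
    push_cast
    rw [Finset.mul_sum, Finset.sum_mul]
    exact Finset.sum_congr rfl fun k _ => hpow k i j
  obtain ⟨r, hr, q, hq, hqC⟩ := Matrix.exists_pos_eigenvector (B := Cᵀ) (C := Cᵀ)
    (fun i j => (hm j i).le) (fun i j => hm j i) rfl
  have hqC' : ∀ j, ∑ i, q i * C i j = r * q j := fun j => by
    have := congrFun hqC j
    simp only [mulVec, dotProduct, transpose_apply, Pi.smul_apply, smul_eq_mul] at this
    rw [← this]
    exact Finset.sum_congr rfl fun _ _ => mul_comm _ _
  have hr0 : 0 < r := by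
    have h1 : 0 < ∑ l, q l * C l i :=
      Finset.sum_pos (fun l _ => mul_pos (hq l) (hm l i)) Finset.univ_nonempty
    rw [hqC'] at h1
    exact pos_of_mul_pos_left h1 (hq i).le
  set φ : (κ → ℝ) → ℂ := fun x => ∑ i, (q i : ℂ) * d i * x i with hφ
  set K : Set (κ → ℝ) := {x | (∀ k i, 0 ≤ (A ^ k *ᵥ fun j => (x j : ℂ)) i) ∧ 1 ≤ ‖φ x‖} with hK
  have hKnn : ∀ x ∈ K, ∀ i, 0 ≤ x i := fun x hx i => by
    have := hx.1 0 i
    simpa using this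
  have hφc : Continuous φ := by fun_prop
  have hcast : Continuous fun x : κ → ℝ => fun j => (x j : ℂ) := by fun_prop
  have hKc : IsClosed K := by
    have h1 : IsClosed (⋂ k, ⋂ i, {x : κ → ℝ | 0 ≤ (A ^ k *ᵥ fun j => (x j : ℂ)) i}) :=
      isClosed_iInter fun k => isClosed_iInter fun i => isClosed_Ici.preimage
        ((continuous_apply i).comp (continuous_const.matrix_mulVec hcast))
    convert h1.inter (isClosed_le (continuous_const (y := (1 : ℝ))) hφc.norm) using 1
    ext x
    simp [hK]
  obtain ⟨x₁, hx₁⟩ : K.Nonempty := by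
    obtain ⟨x, hx, hx0⟩ := hX.spans (fun i => (q i : ℂ) * d i) (by
      intro h
      have := congrFun h i
      simp [(hq i).ne', hd0 i] at this)
    have hxr : ∀ i, (((x i).re : ℝ) : ℂ) = x i := fun i =>
      (Complex.eq_re_of_ofReal_le (r := 0) (by simpa using hX.nonneg x hx i)).symm
    set t : ℝ := ‖∑ i, (q i : ℂ) * d i * x i‖ with ht
    have ht0 : 0 < t := norm_pos_iff.2 hx0
    refine ⟨fun i => t⁻¹ * (x i).re, fun k l => ?_, ?_⟩
    · have : (fun j => ((t⁻¹ * (x j).re : ℝ) : ℂ)) = ((t⁻¹ : ℝ) : ℂ) • x := by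
        ext j
        push_cast
        simp [hxr]
      rw [this, mulVec_smul]
      exact mul_nonneg (by exact_mod_cast (by positivity)) (hX.nonneg _ (hX.pow_mulVec_mem hx k) l)
    · have : φ (fun i => t⁻¹ * (x i).re) = ((t⁻¹ : ℝ) : ℂ) * ∑ i, (q i : ℂ) * d i * x i := by
        simp only [hφ, Finset.mul_sum]
        refine Finset.sum_congr rfl fun l _ => ?_
        push_cast
        rw [hxr]
        ring
      rw [this, norm_mul, ← ht, Complex.norm_real, norm_inv, norm_norm, inv_mul_cancel₀ ht0.ne']
  set g : (κ → ℝ) → ℝ := fun x => ∑ i, q i * x i with hg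
  have hgc : Continuous g := by fun_prop
  have hKb : IsCompact (K ∩ {x | g x ≤ g x₁}) := by
    refine IsCompact.of_isClosed_subset
      (isCompact_univ_pi (s := fun i => Set.Icc 0 (g x₁ / q i)) fun i => isCompact_Icc)
      (hKc.inter (isClosed_le hgc continuous_const)) ?_
    rintro x ⟨hx, hxg⟩ l -
    refine ⟨hKnn x hx l, ?_⟩
    rw [le_div_iff₀ (hq l), mul_comm]
    exact (Finset.single_le_sum (f := fun i => q i * x i)
      (fun i _ => mul_nonneg (hq i).le (hKnn x hx i)) (Finset.mem_univ l)).trans hxg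
  obtain ⟨a, ⟨haK, hag⟩, hamin⟩ := hKb.exists_isMinOn ⟨x₁, hx₁, le_refl (g x₁)⟩ hgc.continuousOn
  have hmin : ∀ x ∈ K, g a ≤ g x := fun x hx => by
    by_cases h : g x ≤ g x₁
    · exact hamin ⟨hx, h⟩
    · exact le_trans hag (not_le.1 h).le
  have ha0 := hKnn a haK
  have hPa : ∀ k i, 0 ≤ (A ^ k *ᵥ (P *ᵥ fun j => (a j : ℂ))) i := fun k i => by
    rw [hP, sum_mulVec, mulVec_sum, Finset.sum_apply]
    refine Finset.sum_nonneg fun s _ => ?_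
    rw [mulVec_mulVec, ← pow_add]
    exact haK.1 _ i
  set b : κ → ℝ := fun i => ((P *ᵥ fun j => (a j : ℂ)) i).re with hb
  have hba : ∀ i, (b i : ℂ) = (P *ᵥ fun j => (a j : ℂ)) i := fun i =>
    (Complex.eq_re_of_ofReal_le (r := 0) (by simpa using hPa 0 i)).symm
  have hbK : (fun i => r⁻¹ * b i) ∈ K := by
    constructor
    · intro k l
      have : (fun j => ((r⁻¹ * b j : ℝ) : ℂ)) = ((r⁻¹ : ℝ) : ℂ) • (P *ᵥ fun j => (a j : ℂ)) := by
        ext j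
        push_cast
        simp [hba]
      rw [this, mulVec_smul]
      exact mul_nonneg (by exact_mod_cast (by positivity)) (hPa k l)
    · have : φ (fun i => r⁻¹ * b i) = φ a := by
        have hr' : (r : ℂ) ≠ 0 := by exact_mod_cast hr0.ne'
        have h1 : ∀ l, (q l : ℂ) * d l * ((r⁻¹ * b l : ℝ) : ℂ)
            = ∑ j, (r : ℂ)⁻¹ * ((q l * C l j : ℝ) : ℂ) * (d j * a j) := fun l => by
          push_cast
          rw [hba, mulVec, dotProduct, Finset.mul_sum, Finset.mul_sum]
          refine Finset.sum_congr rfl fun j _ => ?_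
          rw [hPC]
          have := hd0 l
          field_simp
        simp only [hφ, h1]
        rw [Finset.sum_comm]
        refine Finset.sum_congr rfl fun j _ => ?_
        rw [← Finset.sum_mul, ← Finset.mul_sum, ← Complex.ofReal_sum, hqC']
        push_cast
        field_simp
      rw [Set.mem_ofPred_eq] at haK
      rw [this]
      exact haK.2
  have hle := hmin _ hbK
  have hbre : ∀ l, b l = ∑ j, C l j * a j * (d j / d l).re := fun l => by
    simp only [hb, mulVec, dotProduct, Complex.re_sum]
    refine Finset.sum_congr rfl fun j _ => ?_
    rw [hPC, show (d l)⁻¹ * (C l j : ℂ) * d j * (a j : ℂ)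
      = ((C l j * a j : ℝ) : ℂ) * (d j / d l) by push_cast; ring, Complex.re_ofReal_mul]
  have hre : ∀ l j, (d j / d l).re ≤ 1 := fun l j => by
    refine (Complex.re_le_norm _).trans ?_
    simp [hd]
  have hterm : ∀ l j, 0 ≤ q l * (C l j * a j * (1 - (d j / d l).re)) := fun l j =>
    mul_nonneg (hq l).le (mul_nonneg (mul_nonneg (hm l j).le (ha0 j)) (by linarith [hre l j]))
  have hsum : ∑ l, ∑ j, q l * (C l j * a j * (1 - (d j / d l).re)) ≤ 0 := by
    have h1 : ∑ l, ∑ j, q l * (C l j * a j) = r * g a := by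
      rw [Finset.sum_comm, hg, Finset.mul_sum]
      refine Finset.sum_congr rfl fun j _ => ?_
      rw [← mul_assoc, ← hqC', Finset.sum_mul]
      exact Finset.sum_congr rfl fun l _ => by ring
    have h2 : ∑ l, ∑ j, q l * (C l j * a j * (d j / d l).re) = ∑ l, q l * b l := by
      refine Finset.sum_congr rfl fun l _ => ?_
      rw [hbre, Finset.mul_sum]
    have h3 : g (fun i => r⁻¹ * b i) = r⁻¹ * ∑ l, q l * b l := by
      rw [hg, Finset.mul_sum]
      exact Finset.sum_congr rfl fun l _ => by ring
    rw [h3, inv_mul_eq_div, le_div_iff₀ hr0] at hle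
    have h4 : ∑ l, ∑ j, q l * (C l j * a j * (1 - (d j / d l).re))
        = ∑ l, ∑ j, q l * (C l j * a j) - ∑ l, ∑ j, q l * (C l j * a j * (d j / d l).re) := by
      simp only [← Finset.sum_sub_distrib]
      exact Finset.sum_congr rfl fun l _ => Finset.sum_congr rfl fun j _ => by ring
    rw [h4, h1, h2]
    linarith
  obtain ⟨s, hs⟩ : ∃ s, a s ≠ 0 := by
    by_contra! hcon
    have h1 := haK.2
    simp only [hφ, hcon] at h1
    norm_num at h1
  have hall : ∀ l, d s = d l := fun l => by
    have h1 : ∑ l, ∑ j, q l * (C l j * a j * (1 - (d j / d l).re)) = 0 :=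
      le_antisymm hsum (Finset.sum_nonneg fun l _ => Finset.sum_nonneg fun j _ => hterm l j)
    have h2 := (Finset.sum_eq_zero_iff_of_nonneg
      fun l _ => Finset.sum_nonneg fun j _ => hterm l j).1 h1 l (Finset.mem_univ l)
    have h3 := (Finset.sum_eq_zero_iff_of_nonneg fun j _ => hterm l j).1 h2 s (Finset.mem_univ s)
    have h4 : (d s / d l).re = 1 := by
      have h5 : 1 - (d s / d l).re = 0 := by
        simpa [(hq l).ne', (hm l s).ne', hs] using h3
      linarith
    have hn : ‖d s / d l‖ = 1 := by simp [hd]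
    have h6 : d s / d l = 1 := by
      have hsq : (d s / d l).re * (d s / d l).re + (d s / d l).im * (d s / d l).im = 1 := by
        rw [← Complex.normSq_apply, Complex.normSq_eq_norm_sq, hn]; norm_num
      refine Complex.ext (by simpa using h4) ?_
      have : (d s / d l).im * (d s / d l).im = 0 := by rw [h4] at hsq; linarith
      simpa using this
    exact (div_eq_one_iff_eq (hd0 l)).1 h6
  rw [← hall i, ← hall j]

end Perron
section Blocks

open scoped ComplexOrder

variable {ι κ κ₁ κ₂ : Type*} [Fintype ι] [Fintype κ] [Fintype κ₁] [Fintype κ₂]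

lemma Matrix.NoInvariantSet.exists_pos_eigenvector_complex [DecidableEq κ] [Nonempty κ]
    {A : Matrix κ κ ℂ} (hA : ∀ i j, 0 ≤ A i j) (hAi : A.NoInvariantSet) :
    ∃ r : ℝ, 0 ≤ r ∧ ∃ p : κ → ℝ, (∀ i, 0 < p i) ∧ ∀ i, ∑ j, A i j * p j = r * p i := by
  have hre : ∀ i j, (((A i j).re : ℝ) : ℂ) = A i j := fun i j =>
    (Complex.eq_re_of_ofReal_le (r := 0) (by simpa using hA i j)).symm
  obtain ⟨r, hr, p, hp, h⟩ := Matrix.NoInvariantSet.exists_pos_eigenvector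
    (B := Matrix.of fun i j => (A i j).re) (fun i j => (Complex.nonneg_iff.1 (hA i j)).1) (by
      intro s hs hs'
      obtain ⟨i, hi, j, hj, hij⟩ := hAi s hs hs'
      refine ⟨i, hi, j, hj, fun h0 => hij ?_⟩
      rw [← hre, show (A i j).re = 0 from h0, Complex.ofReal_zero])
  refine ⟨r, hr, p, hp, fun i => ?_⟩
  have := congrArg (fun t : ℝ => (t : ℂ)) (congrFun h i)
  simp only [mulVec, dotProduct, of_apply, Pi.smul_apply, smul_eq_mul] at this
  push_cast at this
  simpa only [hre] using this

lemma IsInvariantNonnegSet.submatrix [DecidableEq ι] [DecidableEq κ] {A : Matrix ι ι ℂ}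
    {X : Set (ι → ℂ)} (hX : IsInvariantNonnegSet A X) {f : κ → ι} (hf : f.Injective)
    (hA : ∀ i, ∀ j ∉ Set.range f, A (f i) j = 0) :
    IsInvariantNonnegSet (A.submatrix f f) ((fun x => x ∘ f) '' X) := by
  refine ⟨?_, fun g hg => ?_, ?_⟩
  · rintro _ ⟨x, hx, rfl⟩ i
    exact hX.nonneg x hx _
  · obtain ⟨x, hx, hx0⟩ := hX.spans (Function.extend f g 0) (by
      intro h
      refine hg (funext fun i => ?_)
      rw [← hf.extend_apply g 0 i, h]
      rfl)
    refine ⟨_, ⟨x, hx, rfl⟩, ?_⟩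
    convert hx0 using 1
    refine Fintype.sum_of_injective f hf _ _ (fun i hi => ?_) (fun i => ?_)
    · rw [Function.extend_apply' _ _ _ (by simpa using hi)]
      simp
    · simp [hf.extend_apply]
  · rintro _ ⟨x, hx, rfl⟩
    refine ⟨_, hX.invariant x hx, ?_⟩
    ext i
    exact (Fintype.sum_of_injective f hf _ _ (fun j hj => by simp [hA i j hj])
      (fun j => by simp)).symm

lemma IsInvariantNonnegSet.exists_pos [DecidableEq ι] {A : Matrix ι ι ℂ} {X : Set (ι → ℂ)}
    (hX : IsInvariantNonnegSet A X) :
    ∃ x : ι → ℂ, (∀ i, 0 < x i) ∧ ∀ k i, 0 ≤ (A ^ k *ᵥ x) i := by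
  have h : ∀ i, ∃ x ∈ X, x i ≠ 0 := fun i => by
    obtain ⟨x, hx, hx0⟩ := hX.spans (Pi.single i 1) (by simp)
    exact ⟨x, hx, by simpa using hx0⟩
  choose x hx hx0 using h
  refine ⟨∑ i, x i, fun i => ?_, fun k i => ?_⟩
  · rw [Finset.sum_apply]
    exact Finset.sum_pos' (fun j _ => hX.nonneg _ (hx j) i)
      ⟨i, Finset.mem_univ i, lt_of_le_of_ne (hX.nonneg _ (hx i) i) (hx0 i).symm⟩
  · rw [mulVec_sum, Finset.sum_apply]
    exact Finset.sum_nonneg fun j _ => hX.nonneg _ (hX.pow_mulVec_mem (hx j) k) i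

lemma false_of_forall_nonneg_of_recurrence {s b : ℕ → ℝ} {l₁ l₂ c : ℝ} (h₁ : 0 ≤ l₁)
    (h₁₂ : l₁ ≤ l₂) (hc : 0 < c) (hs : ∀ k, 0 ≤ s k) (hb : ∀ k, c * l₂ ^ k ≤ b k)
    (hrec : ∀ k, s (k + 1) = l₁ * s k - b k) : False := by
  rcases (h₁.trans h₁₂).eq_or_lt with h | h
  · have hl : l₁ = 0 := le_antisymm (h ▸ h₁₂) h₁
    have h0 := hrec 0
    have h1 := hb 0
    have h2 := hs (0 + 1)
    simp only [pow_zero, hl] at h0 h1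
    linarith
  · have key : ∀ k : ℕ, l₂ * s k ≤ l₂ ^ k * (l₂ * s 0 - k * c) := by
      intro k
      induction k with
      | zero => simp
      | succ k ih =>
        have h3 := mul_le_mul_of_nonneg_right h₁₂ (hs k)
        have h4 : s (k + 1) ≤ l₂ ^ k * (l₂ * s 0 - k * c) - c * l₂ ^ k := by
          linarith [hrec k, hb k]
        calc l₂ * s (k + 1) ≤ l₂ * (l₂ ^ k * (l₂ * s 0 - k * c) - c * l₂ ^ k) := by gcongr
          _ = _ := by push_cast; ring
    obtain ⟨k, hk⟩ := exists_nat_gt (l₂ * s 0 / c)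
    rw [div_lt_iff₀ hc] at hk
    have h5 := key k
    have h6 : 0 ≤ l₂ * s k := mul_nonneg h.le (hs k)
    have h7 : l₂ ^ k * (l₂ * s 0 - k * c) < 0 := mul_neg_of_pos_of_neg (by positivity) (by linarith)
    linarith

variable [DecidableEq κ₁] [DecidableEq κ₂]

lemma Matrix.offDiag_phase_eq_one {A : Matrix (κ₁ ⊕ κ₂) (κ₁ ⊕ κ₂) ℂ}
    (h₂₁ : ∀ i j, A (.inr i) (.inl j) = 0) (h₂₂ : ∀ i j, 0 ≤ A (.inr i) (.inr j))
    {w : ℂ} (hw : ‖w‖ = 1) (hB : ∀ i j, 0 ≤ w * A (.inl i) (.inr j))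
    {i₀ : κ₁} {j₀ : κ₂} (hB₀ : A (.inl i₀) (.inr j₀) ≠ 0)
    {l₁ l₂ : ℝ} (hl₁ : 0 ≤ l₁) (hl : l₁ ≤ l₂)
    {q : κ₁ → ℝ} (hq0 : ∀ i, 0 < q i) (hq : ∀ j, ∑ i, A (.inl i) (.inl j) * q i = l₁ * q j)
    {p : κ₂ → ℝ} (hp0 : ∀ i, 0 < p i) (hp : ∀ i, ∑ j, A (.inr i) (.inr j) * p j = l₂ * p i)
    {x : κ₁ ⊕ κ₂ → ℂ} (hx : ∀ i, 0 < x i) (hAx : ∀ k i, 0 ≤ (A ^ k *ᵥ x) i) : w = 1 := by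
  have hw0 : w ≠ 0 := norm_ne_zero_iff.1 (by simp [hw])
  obtain ⟨c, hc, hcx⟩ : ∃ c : ℝ, 0 < c ∧ ∀ j, ((c * p j : ℝ) : ℂ) ≤ x (.inr j) := by
    have : Nonempty κ₂ := ⟨j₀⟩
    obtain ⟨j, -, hj⟩ := Finset.exists_min_image Finset.univ
      (fun j => (x (.inr j)).re / p j) Finset.univ_nonempty
    refine ⟨_, div_pos (Complex.pos_iff.1 (hx (.inr j))).1 (hp0 j), fun i => ?_⟩
    have := hj i (Finset.mem_univ i)
    rw [le_div_iff₀ (hp0 i)] at this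
    exact Complex.le_def.2 ⟨by simpa using this, by simpa using (Complex.pos_iff.1 (hx (.inr i))).2⟩
  set y : ℕ → κ₁ ⊕ κ₂ → ℂ := fun k => A ^ k *ᵥ x with hy
  have hys : ∀ k, y (k + 1) = A *ᵥ y k := fun k => by
    simp only [hy]
    rw [pow_succ', mulVec_mulVec]
  have hylow : ∀ k j, ((c * l₂ ^ k * p j : ℝ) : ℂ) ≤ y k (.inr j) := by
    intro k
    induction k with
    | zero => intro j; simpa [hy] using hcx j
    | succ k ih =>
      intro i
      rw [hys, mulVec, dotProduct, Fintype.sum_sum_type]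
      simp only [h₂₁, zero_mul, Finset.sum_const_zero, zero_add]
      refine le_trans (le_of_eq ?_) (Finset.sum_le_sum fun j _ =>
        mul_le_mul_of_nonneg_left (ih j) (h₂₂ i j))
      push_cast
      rw [show (c : ℂ) * (l₂ : ℂ) ^ (k + 1) * p i = c * l₂ ^ k * (l₂ * p i) by ring, ← hp,
        Finset.mul_sum]
      exact Finset.sum_congr rfl fun j _ => by ring
  set s : ℕ → ℂ := fun k => ∑ i, (q i : ℂ) * y k (.inl i) with hs
  set b : ℕ → ℂ := fun k => ∑ i, ∑ j, (q i : ℂ) * (w * A (.inl i) (.inr j)) * y k (.inr j) with hb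
  have hs0 : ∀ k, 0 ≤ s k := fun k => Finset.sum_nonneg fun i _ =>
    mul_nonneg (by exact_mod_cast (hq0 i).le) (hAx k _)
  set β : ℂ := ∑ i, ∑ j, (q i : ℂ) * (w * A (.inl i) (.inr j)) * p j with hβ
  have hterm : ∀ i j, 0 ≤ (q i : ℂ) * (w * A (.inl i) (.inr j)) := fun i j =>
    mul_nonneg (by exact_mod_cast (hq0 i).le) (hB i j)
  have hp0' : ∀ j, (0 : ℂ) < p j := fun j => by exact_mod_cast hp0 j
  have hβ0 : 0 < β := by
    refine Finset.sum_pos' (fun i _ => Finset.sum_nonneg fun j _ =>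
      mul_nonneg (hterm i j) (hp0' j).le) ⟨i₀, Finset.mem_univ _, ?_⟩
    refine Finset.sum_pos' (fun j _ => mul_nonneg (hterm i₀ j) (hp0' j).le)
      ⟨j₀, Finset.mem_univ _, ?_⟩
    refine mul_pos (lt_of_le_of_ne (hterm i₀ j₀) (Ne.symm ?_)) (hp0' j₀)
    exact mul_ne_zero (by exact_mod_cast (hq0 i₀).ne') (mul_ne_zero hw0 hB₀)
  have hblow : ∀ k, ((c * l₂ ^ k : ℝ) : ℂ) * β ≤ b k := fun k => by
    simp only [hβ, hb, Finset.mul_sum]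
    refine Finset.sum_le_sum fun i _ => Finset.sum_le_sum fun j _ => ?_
    refine le_trans (le_of_eq ?_) (mul_le_mul_of_nonneg_left (hylow k j) (hterm i j))
    push_cast
    ring
  have hrec : ∀ k, w * (s (k + 1) - l₁ * s k) = b k := by
    intro k
    have h1 : s (k + 1) = l₁ * s k
        + ∑ i, ∑ j, (q i : ℂ) * A (.inl i) (.inr j) * y k (.inr j) := by
      simp only [hs, hys, mulVec, dotProduct, Fintype.sum_sum_type, mul_add, Finset.sum_add_distrib]
      congr 1
      · simp only [Finset.mul_sum]
        rw [Finset.sum_comm]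
        refine Finset.sum_congr rfl fun j _ => ?_
        rw [← mul_assoc, ← hq, Finset.sum_mul]
        exact Finset.sum_congr rfl fun i _ => by ring
      · refine Finset.sum_congr rfl fun i _ => ?_
        rw [Finset.mul_sum]
        exact Finset.sum_congr rfl fun j _ => by ring
    rw [h1, add_sub_cancel_left, hb]
    simp only [Finset.mul_sum]
    exact Finset.sum_congr rfl fun i _ => Finset.sum_congr rfl fun j _ => by ring
  have hreal : ∀ {z : ℂ}, 0 ≤ z → ((z.re : ℝ) : ℂ) = z := fun {z} hz =>
    (Complex.eq_re_of_ofReal_le (r := 0) (by simpa using hz)).symm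
  have hb0 : ∀ k, 0 ≤ b k := fun k => Finset.sum_nonneg fun i _ => Finset.sum_nonneg fun j _ =>
    mul_nonneg (hterm i j) (hAx k _)
  have hrecre : ∀ k, w * (((s (k + 1)).re - l₁ * (s k).re : ℝ) : ℂ) = ((b k).re : ℝ) := fun k => by
    push_cast
    rw [hreal (hs0 _), hreal (hs0 _), hreal (hb0 _)]
    exact hrec k
  have hβre : 0 < β.re := (Complex.pos_iff.1 hβ0).1
  have hblow' : ∀ k, (c * β.re) * l₂ ^ k ≤ (b k).re := fun k => by
    have := (Complex.le_def.1 (hblow k)).1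
    rw [Complex.re_ofReal_mul] at this
    linarith
  have hwim : w.im = 0 := by
    have h0 := hrecre 0
    have h1 := congrArg Complex.im h0
    rw [Complex.im_mul_ofReal, Complex.ofReal_im] at h1
    rcases mul_eq_zero.1 h1 with h2 | h2
    · exact h2
    · rw [h2] at h0
      have h3 := hblow' 0
      have h4 : 0 = (b 0).re := by exact_mod_cast (by simpa using h0 : (0 : ℂ) = ((b 0).re : ℝ))
      have h5 : 0 < c * β.re := by positivity
      simp at h3
      linarith
  have hsq : w.re * w.re = 1 := by
    have : w.re * w.re + w.im * w.im = 1 := by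
      rw [← Complex.normSq_apply, Complex.normSq_eq_norm_sq, hw]; norm_num
    simpa [hwim] using this
  rcases mul_self_eq_one_iff.1 hsq with h1 | h1
  · exact Complex.ext (by simpa using h1) (by simpa using hwim)
  · refine (false_of_forall_nonneg_of_recurrence (s := fun k => (s k).re) (b := fun k => (b k).re)
      hl₁ hl (mul_pos hc hβre) (fun k => (Complex.nonneg_iff.1 (hs0 k)).1) hblow'
      (fun k => ?_)).elim
    have h2 := congrArg Complex.re (hrecre k)
    rw [Complex.re_mul_ofReal, Complex.ofReal_re, h1] at h2
    linarith

lemma Matrix.nonneg_of_blocks {A : Matrix (κ₁ ⊕ κ₂) (κ₁ ⊕ κ₂) ℂ}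
    {X Y : Set (κ₁ ⊕ κ₂ → ℂ)} (hX : IsInvariantNonnegSet A X) (hY : IsInvariantNonnegSet Aᵀ Y)
    (h₂₁ : ∀ i j, A (.inr i) (.inl j) = 0)
    (h₁ : (A.submatrix Sum.inl Sum.inl).NoInvariantSet)
    (h₂ : (A.submatrix Sum.inr Sum.inr).NoInvariantSet) {d : κ₁ ⊕ κ₂ → ℂ} (hd : ∀ i, ‖d i‖ = 1)
    (hdA : ∀ i j, 0 ≤ d i * A i j * (d j)⁻¹) (i j : κ₁ ⊕ κ₂) : 0 ≤ A i j := by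
  have hd0 : ∀ i, d i ≠ 0 := fun i => norm_ne_zero_iff.1 (by simp [hd])
  have hX₂ := hX.submatrix (f := Sum.inr) Sum.inr_injective (by
    rintro i (j | j) hj
    · exact h₂₁ i j
    · simp at hj)
  have hY₁ := hY.submatrix (f := Sum.inl) Sum.inl_injective (by
    rintro i (j | j) hj
    · simp at hj
    · exact h₂₁ j i)
  have hd₂ := hX₂.phase_eq h₂ (d := d ∘ Sum.inr) (fun i => hd _) (fun i j => hdA _ _)
  have hd₁ := hY₁.phase_eq h₁.transpose (d := fun i => (d (.inl i))⁻¹) (fun i => by simp [hd])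
    (fun i j => by
      have := hdA (.inl j) (.inl i)
      simpa [mul_comm, mul_left_comm, mul_assoc] using this)
  have hn₁ : ∀ i j, 0 ≤ A (.inl i) (.inl j) := fun i j => by
    have h := hdA (.inl i) (.inl j)
    rwa [inv_injective (hd₁ i j), mul_comm, ← mul_assoc, inv_mul_cancel₀ (hd0 _), one_mul] at h
  have hn₂ : ∀ i j, 0 ≤ A (.inr i) (.inr j) := fun i j => by
    have h := hdA (.inr i) (.inr j)
    have hij : d (.inr i) = d (.inr j) := hd₂ i j
    rwa [hij, mul_comm, ← mul_assoc, inv_mul_cancel₀ (hd0 _), one_mul] at h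
  suffices hn₁₂ : ∀ i j, 0 ≤ A (.inl i) (.inr j) by
    rcases i with i | i <;> rcases j with j | j
    · exact hn₁ i j
    · exact hn₁₂ i j
    · exact (h₂₁ i j).ge
    · exact hn₂ i j
  by_cases hB : ∀ i j, A (.inl i) (.inr j) = 0
  · exact fun i j => (hB i j).ge
  push Not at hB
  obtain ⟨i₀, j₀, hB₀⟩ := hB
  have : Nonempty κ₁ := ⟨i₀⟩
  have : Nonempty κ₂ := ⟨j₀⟩
  set w := d (.inl i₀) * (d (.inr j₀))⁻¹ with hw
  have hw1 : ‖w‖ = 1 := by simp [hw, hd]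
  have hwA : ∀ i j, 0 ≤ w * A (.inl i) (.inr j) := fun i j => by
    have h := hdA (.inl i) (.inr j)
    have hj : d (.inr j) = d (.inr j₀) := hd₂ j j₀
    rw [inv_injective (hd₁ i i₀), hj] at h
    rwa [hw, mul_right_comm]
  obtain ⟨l₁, hl₁, q, hq0, hq⟩ := h₁.transpose.exists_pos_eigenvector_complex
    (fun i j => hn₁ j i)
  obtain ⟨l₂, hl₂, p, hp0, hp⟩ := h₂.exists_pos_eigenvector_complex (fun i j => hn₂ i j)
  have hw' : w = 1 := by
    rcases le_total l₁ l₂ with hl | hl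
    · obtain ⟨x, hx, hAx⟩ := hX.exists_pos
      exact Matrix.offDiag_phase_eq_one h₂₁ hn₂ hw1 hwA hB₀ hl₁ hl hq0 hq hp0 hp hx hAx
    · have hY' := hY.submatrix (f := Sum.swap (α := κ₂) (β := κ₁))
        Sum.swap_leftInverse.injective (fun i j hj =>
          (hj (Sum.swap_rightInverse.surjective j)).elim)
      obtain ⟨y, hy, hAy⟩ := hY'.exists_pos
      exact Matrix.offDiag_phase_eq_one (κ₁ := κ₂) (κ₂ := κ₁) (fun i j => h₂₁ j i)
        (fun i j => hn₁ j i) hw1 (fun i j => hwA j i) hB₀ hl₂ hl hp0 hp hq0 hq hy hAy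
  intro i j
  simpa [hw'] using hwA i j

lemma Matrix.nonneg_of_rank_le_one [DecidableEq ι] {A : Matrix ι ι ℂ} {X Y : Set (ι → ℂ)}
    (hX : IsInvariantNonnegSet A X) (hY : IsInvariantNonnegSet Aᵀ Y) (hr : A.rank ≤ 1) (i j : ι) :
    0 ≤ A i j := by
  by_cases hA0 : A = 0
  · simp [hA0]
  obtain ⟨⟨f, hfm⟩, hf⟩ := finrank_le_one_iff.1 hr
  have hcol : ∀ j, ∃ c : ℂ, ∀ i, A i j = f i * c := fun j => by
    obtain ⟨c, hc⟩ := hf ⟨A *ᵥ Pi.single j 1, ⟨_, rfl⟩⟩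
    refine ⟨c, fun i => ?_⟩
    have := congrFun (congrArg Subtype.val hc) i
    simp at this
    rw [mul_comm]
    exact this.symm
  choose g hg using hcol
  obtain rfl : A = vecMulVec f g := by
    ext i j
    exact hg j i
  have hf0 : f ≠ 0 := by rintro rfl; simp at hA0
  have hg0 : g ≠ 0 := by rintro rfl; simp at hA0
  obtain ⟨x, hx, hgx⟩ := hX.spans g hg0
  obtain ⟨y, hy, hfy⟩ := hY.spans f hf0
  have hAx : ∀ i, (vecMulVec f g *ᵥ x) i = f i * (g ⬝ᵥ x) := fun i => by
    simp [vecMulVec_mulVec]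
  have hAy : ∀ j, ((vecMulVec f g)ᵀ *ᵥ y) j = g j * (f ⬝ᵥ y) := fun i => by
    simp [transpose_vecMulVec, vecMulVec_mulVec]
  have h1 : 0 ≤ f i * (g ⬝ᵥ x) := hAx i ▸ hX.nonneg _ (hX.invariant x hx) i
  have h2 : 0 ≤ g j * (f ⬝ᵥ y) := hAy j ▸ hY.nonneg _ (hY.invariant y hy) j
  have h3 : 0 < (g ⬝ᵥ x) * (f ⬝ᵥ y) := by
    refine lt_of_le_of_ne ?_ (mul_ne_zero hgx hfy).symm
    rw [mul_comm, dotProduct, Finset.sum_mul]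
    refine Finset.sum_nonneg fun i _ => ?_
    rw [mul_right_comm, ← hAx]
    exact mul_nonneg (hX.nonneg _ (hX.invariant x hx) i) (hY.nonneg y hy i)
  have h4 := mul_nonneg h1 h2
  rw [show f i * (g ⬝ᵥ x) * (g j * (f ⬝ᵥ y)) = f i * g j * ((g ⬝ᵥ x) * (f ⬝ᵥ y)) by ring] at h4
  have h5 := mul_nonneg h4 (inv_nonneg.2 h3.le)
  rwa [mul_assoc, mul_inv_cancel₀ h3.ne', mul_one] at h5

end Blocks
section Assembly

open scoped ComplexOrder

lemma Matrix.noInvariantSet_of_not_decomposable {m : ℕ} {R : Type*} [Zero R]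
    {A : Matrix (Fin m) (Fin m) R} (hA : ¬ Decomposable A) : A.NoInvariantSet := by
  classical
  intro s hs hs'
  by_contra! hcon
  refine hA ?_
  have hcard : Fintype.card {i : Fin m // (i : ℕ) < Fintype.card s} = Fintype.card s := by
    have hle : Fintype.card s ≤ m := by simpa using Fintype.card_subtype_le (· ∈ s)
    rw [Fintype.card_subtype, Fin.card_filter_val_lt, min_eq_right hle]
  let e : {i : Fin m // (i : ℕ) < Fintype.card s} ≃ {i // i ∈ s} := Fintype.equivOfCardEq hcard
  refine ⟨e.extendSubtype, Fintype.card s, Fintype.card_pos_iff.2 hs.to_subtype, ?_,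
    fun i j hi hj => ?_⟩
  · obtain ⟨x, hx⟩ := hs'
    simpa using Fintype.card_subtype_lt (p := (· ∈ s)) (x := x) hx
  · exact hcon _ (e.extendSubtype_not_mem i (not_lt.2 hi)) _ (e.extendSubtype_mem j hj)

lemma Matrix.NoInvariantSet.of_ne_zero {κ R T : Type*} [Zero R] [Zero T] {A : Matrix κ κ R}
    {B : Matrix κ κ T} (hA : A.NoInvariantSet) (hAB : ∀ i j, A i j ≠ 0 → B i j ≠ 0) :
    B.NoInvariantSet := by
  intro s hs hs'
  obtain ⟨i, hi, j, hj, h⟩ := hA s hs hs'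
  exact ⟨i, hi, j, hj, hAB i j h⟩

lemma IsInvariantNonnegSet.reindex {ι κ : Type*} [Fintype ι] [Fintype κ] [DecidableEq ι]
    [DecidableEq κ] {A : Matrix ι ι ℂ} {X : Set (ι → ℂ)} (hX : IsInvariantNonnegSet A X)
    (e : κ ≃ ι) : IsInvariantNonnegSet (A.submatrix e e) ((fun x => x ∘ e) '' X) :=
  hX.submatrix e.injective fun _ j hj => (hj (e.surjective j)).elim

/-- The two consecutive blocks of `Fin n` determined by `k`, followed by a permutation. -/
noncomputable def blockEquiv {n k : ℕ} (hk : k < n) (σ : Equiv.Perm (Fin n)) :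
    Fin k ⊕ Fin (n - k) ≃ Fin n :=
  (finSumFinEquiv.trans (finCongr (Nat.add_sub_cancel' hk.le))).trans σ

lemma Matrix.nonneg_of_same_zeros {n : ℕ} {A B : Matrix (Fin n) (Fin n) ℂ}
    (hdec : 2 ≤ A.rank → ¬ Decomposable A ∨ OneDecomposable A) (hBA : B.rank ≤ A.rank)
    (hAB : ∀ i j, A i j = 0 ↔ B i j = 0) {X Y : Set (Fin n → ℂ)}
    (hX : IsInvariantNonnegSet B X) (hY : IsInvariantNonnegSet Bᵀ Y) {d : Fin n → ℂ}
    (hd : ∀ i, ‖d i‖ = 1) (hdB : ∀ i j, 0 ≤ d i * B i j * (d j)⁻¹) (i j : Fin n) :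
    0 ≤ B i j := by
  rcases Nat.lt_or_ge 1 B.rank with hr | hr
  swap
  · exact Matrix.nonneg_of_rank_le_one hX hY hr i j
  rcases hdec (le_trans hr hBA) with h | ⟨σ, k, -, hk, h₂₁, h₁, h₂⟩
  · have hd0 : d j ≠ 0 := norm_ne_zero_iff.1 (by simp [hd])
    have hB := (Matrix.noInvariantSet_of_not_decomposable h).of_ne_zero
      (B := B) fun i j => mt (hAB i j).2
    have := hdB i j
    rwa [hX.phase_eq hB hd hdB i j, mul_comm, ← mul_assoc, inv_mul_cancel₀ hd0, one_mul] at this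
  · have hinl : ∀ i : Fin k, blockEquiv hk σ (.inl i) = σ (Fin.castLE hk.le i) := fun i => rfl
    have hinr : ∀ i : Fin (n - k), blockEquiv hk σ (.inr i)
        = σ ⟨k + (i : ℕ), by have := i.isLt; omega⟩ := fun i => rfl
    have key := Matrix.nonneg_of_blocks (hX.reindex (blockEquiv hk σ))
      (hY.reindex (blockEquiv hk σ))
      (fun i j => by
        rw [submatrix_apply, hinl, hinr, ← hAB]
        exact h₂₁ _ _ (by simp) (by simp))
      ((Matrix.noInvariantSet_of_not_decomposable h₁).of_ne_zero fun i j => mt (hAB _ _).2)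
      ((Matrix.noInvariantSet_of_not_decomposable h₂).of_ne_zero fun i j => mt (hAB _ _).2)
      (d := d ∘ blockEquiv hk σ) (fun i => hd _) (fun i j => hdB _ _)
    simpa using key ((blockEquiv hk σ).symm i) ((blockEquiv hk σ).symm j)

lemma Matrix.exists_dotProduct_mulVec_ne_zero {n : ℕ} (hn : 2 ≤ n)
    {S : Set (Matrix (Fin n) (Fin n) ℂ)} (hS : ∀ A ∈ S, ∀ B ∈ S, A * B ∈ S)
    (hirr : ∀ p : Submodule ℂ (Fin n → ℂ),
      (∀ A ∈ S, ∀ v ∈ p, A.mulVec v ∈ p) → p = ⊥ ∨ p = ⊤)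
    {w f : Fin n → ℂ} (hw : w ≠ 0) (hf : f ≠ 0) : ∃ A ∈ S, f ⬝ᵥ (A *ᵥ w) ≠ 0 := by
  by_contra! hcon
  have hspan := hirr (Submodule.span ℂ ((fun A => A *ᵥ w) '' S)) (by
    intro A hA v hv
    induction hv using Submodule.span_induction with
    | mem x hx =>
      obtain ⟨B, hB, rfl⟩ := hx
      exact Submodule.subset_span ⟨A * B, hS A hA B hB, (mulVec_mulVec _ _ _).symm⟩
    | zero => simp
    | add x y _ _ hx hy => rw [mulVec_add]; exact add_mem hx hy
    | smul c x _ hx => rw [mulVec_smul]; exact Submodule.smul_mem _ _ hx)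
  rcases hspan with h | h
  · have h0 : ∀ A ∈ S, A *ᵥ w = 0 := fun A hA => by
      have : A *ᵥ w ∈ Submodule.span ℂ ((fun A => A *ᵥ w) '' S) :=
        Submodule.subset_span ⟨A, hA, rfl⟩
      rwa [h, Submodule.mem_bot] at this
    rcases hirr (Submodule.span ℂ {w}) (by
      intro A hA v hv
      obtain ⟨c, rfl⟩ := Submodule.mem_span_singleton.1 hv
      rw [mulVec_smul, h0 A hA, smul_zero]
      exact zero_mem _) with h1 | h1
    · exact hw (by simpa using h1)
    · have h2 := finrank_span_singleton (K := ℂ) hw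
      rw [h1, finrank_top, Module.finrank_fin_fun] at h2
      omega
  · have h1 : ∀ v ∈ Submodule.span ℂ ((fun A => A *ᵥ w) '' S), f ⬝ᵥ v = 0 := by
      intro v hv
      induction hv using Submodule.span_induction with
      | mem x hx =>
        obtain ⟨B, hB, rfl⟩ := hx
        exact hcon B hB
      | zero => simp
      | add x y _ _ hx hy => rw [dotProduct_add, hx, hy, add_zero]
      | smul c x _ hx => rw [dotProduct_smul, hx, smul_zero]
    refine hf (funext fun i => ?_)
    simpa using h1 (Pi.single i 1) (h ▸ Submodule.mem_top)

lemma Matrix.diagonal_conj_apply {n : ℕ} (d : Fin n → ℂ) (A : Matrix (Fin n) (Fin n) ℂ)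
    (i j : Fin n) :
    (diagonal d * A * diagonal (fun i => (d i)⁻¹)) i j = d i * A i j * (d j)⁻¹ := by
  rw [mul_diagonal, diagonal_mul]

lemma DiagSimNonneg.exists_forall_nonneg {n : ℕ} {A : Matrix (Fin n) (Fin n) ℂ}
    (hA : DiagSimNonneg A) :
    ∃ e : Fin n → ℂ, (∀ i, e i ≠ 0) ∧ ∀ i j, 0 ≤ e i * A i j * (e j)⁻¹ := by
  obtain ⟨e, he, h⟩ := hA
  refine ⟨e, he, fun i j => ?_⟩
  have := h i j
  rw [Matrix.diagonal_conj_apply] at this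
  exact Complex.nonneg_iff.2 ⟨this.1, this.2.symm⟩

lemma DiagSimNonneg.diag_nonneg {n : ℕ} {A : Matrix (Fin n) (Fin n) ℂ}
    (hA : DiagSimNonneg A) (i : Fin n) : 0 ≤ A i i := by
  obtain ⟨e, he, h⟩ := hA.exists_forall_nonneg
  have := h i i
  rwa [mul_comm, ← mul_assoc, inv_mul_cancel₀ (he i), one_mul] at this

/-- Normalising the diagonal of a conjugation to modulus one preserves nonnegativity. -/
lemma Matrix.exists_unimodular_conj_nonneg {n : ℕ} {B : Matrix (Fin n) (Fin n) ℂ} {e : Fin n → ℂ}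
    (he : ∀ i, e i ≠ 0) (h : ∀ i j, 0 ≤ e i * B i j * (e j)⁻¹) :
    ∃ d : Fin n → ℂ, (∀ i, ‖d i‖ = 1) ∧ ∀ i j, 0 ≤ d i * B i j * (d j)⁻¹ := by
  have hn : ∀ i, (‖e i‖ : ℂ) ≠ 0 := fun i => by simpa using he i
  refine ⟨fun i => (‖e i‖ : ℂ)⁻¹ * e i, fun i => ?_, fun i j => ?_⟩
  · simp [he i]
  · have h1 : (0 : ℂ) ≤ (‖e i‖⁻¹ * ‖e j‖ : ℝ) := by exact_mod_cast by positivity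
    convert mul_nonneg h1 (h i j) using 1
    push_cast
    have := hn i
    have := hn j
    have := he j
    field_simp

/-- Two spanning families of vectors with nonnegative coordinatewise products become nonnegative
after a diagonal scaling. -/
lemma exists_scaling_nonneg {n : ℕ} {X Y : Set (Fin n → ℂ)}
    (hXs : ∀ f : Fin n → ℂ, f ≠ 0 → ∃ x ∈ X, f ⬝ᵥ x ≠ 0)
    (hYs : ∀ f : Fin n → ℂ, f ≠ 0 → ∃ y ∈ Y, f ⬝ᵥ y ≠ 0)
    (hXY : ∀ x ∈ X, ∀ y ∈ Y, ∀ i, 0 ≤ x i * y i) :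
    ∃ a : Fin n → ℂ, (∀ i, a i ≠ 0) ∧ (∀ x ∈ X, ∀ i, 0 ≤ a i * x i) ∧
      ∀ y ∈ Y, ∀ i, 0 ≤ (a i)⁻¹ * y i := by
  have h : ∀ i, ∃ y ∈ Y, y i ≠ 0 := fun i => by
    obtain ⟨y, hy, hy0⟩ := hYs (Pi.single i 1) (by simp)
    exact ⟨y, hy, by simpa using hy0⟩
  choose y hy hy0 using h
  refine ⟨fun i => y i i, hy0, fun x hx i => by simpa [mul_comm] using hXY x hx _ (hy i) i,
    fun z hz i => ?_⟩
  obtain ⟨x, hx, hx0⟩ := hXs (Pi.single i 1) (by simp)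
  have hx0' : x i ≠ 0 := by simpa using hx0
  have h1 := hXY x hx _ (hy i) i
  have h2 := mul_nonneg (hXY x hx z hz i) (inv_nonneg.2 h1)
  have := hy0 i
  convert h2 using 1
  field_simp

lemma IsInvariantNonnegSet.of_scaling {n : ℕ} {A : Matrix (Fin n) (Fin n) ℂ}
    {X : Set (Fin n → ℂ)} {a : Fin n → ℂ} (ha : ∀ i, a i ≠ 0)
    (hXs : ∀ f : Fin n → ℂ, f ≠ 0 → ∃ x ∈ X, f ⬝ᵥ x ≠ 0) (hX : ∀ x ∈ X, ∀ i, 0 ≤ a i * x i)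
    (hA : ∀ x ∈ X, A *ᵥ x ∈ X) :
    IsInvariantNonnegSet (Matrix.of fun i j => a i * A i j * (a j)⁻¹)
      ((fun x i => a i * x i) '' X) := by
  refine ⟨?_, fun f hf => ?_, ?_⟩
  · rintro _ ⟨x, hx, rfl⟩ i
    exact hX x hx i
  · obtain ⟨x, hx, hx0⟩ := hXs (fun i => f i * a i) (by
      intro h
      refine hf (funext fun i => ?_)
      simpa [ha i] using congrFun h i)
    refine ⟨_, ⟨x, hx, rfl⟩, ?_⟩
    simpa [dotProduct, mul_assoc] using hx0
  · rintro _ ⟨x, hx, rfl⟩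
    refine ⟨_, hA x hx, ?_⟩
    ext i
    simp only [mulVec, dotProduct, of_apply, Finset.mul_sum]
    refine Finset.sum_congr rfl fun j _ => ?_
    have := ha j
    field_simp

lemma exists_diagonal_scaling {n : ℕ} (hn : 2 ≤ n) {S : Set (Matrix (Fin n) (Fin n) ℂ)}
    (hsemi : ∀ A ∈ S, ∀ B ∈ S, A * B ∈ S)
    (hirr : ∀ p : Submodule ℂ (Fin n → ℂ),
      (∀ A ∈ S, ∀ v ∈ p, A.mulVec v ∈ p) → p = ⊥ ∨ p = ⊤)
    (hdiagsim : ∀ A ∈ S, DiagSimNonneg A)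
    (hdec : ∀ A ∈ S, 2 ≤ A.rank → ¬ Decomposable A ∨ OneDecomposable A) :
    ∃ a : Fin n → ℂ, (∀ i, a i ≠ 0) ∧ ∀ A ∈ S, ∀ i j, 0 ≤ a i * A i j * (a j)⁻¹ := by
  have : Nonempty (Fin n) := ⟨⟨0, by omega⟩⟩
  have htrans : ∀ w : Fin n → ℂ, w ≠ 0 → ∀ f : Fin n → ℂ, f ≠ 0 → ∃ A ∈ S, f ⬝ᵥ (A *ᵥ w) ≠ 0 :=
    fun w hw f hf => Matrix.exists_dotProduct_mulVec_ne_zero hn hsemi hirr hw hf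
  have hC := isDiagNonnegCone_closure_span hsemi fun A hA i => (hdiagsim A hA).diag_nonneg i
  have hSC : S ⊆ closure (Submodule.span NNReal S : Set _) :=
    Submodule.subset_span.trans subset_closure
  obtain ⟨u, v, hu, hv, huv⟩ := hC.exists_vecMulVec_mem hSC htrans
  set X : Set (Fin n → ℂ) := (fun A => A *ᵥ u) '' S with hX
  set Y : Set (Fin n → ℂ) := (fun A => v ᵥ* A) '' S with hY
  have hXs : ∀ f : Fin n → ℂ, f ≠ 0 → ∃ x ∈ X, f ⬝ᵥ x ≠ 0 := fun f hf => by
    obtain ⟨A, hA, h⟩ := htrans u hu f hf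
    exact ⟨_, ⟨A, hA, rfl⟩, h⟩
  have hYs : ∀ f : Fin n → ℂ, f ≠ 0 → ∃ y ∈ Y, f ⬝ᵥ y ≠ 0 := fun f hf => by
    obtain ⟨A, hA, h⟩ := htrans f hf v hv
    exact ⟨_, ⟨A, hA, rfl⟩, by rwa [dotProduct_comm, ← dotProduct_mulVec]⟩
  obtain ⟨a, ha, haX, haY⟩ := exists_scaling_nonneg hXs hYs (by
    rintro _ ⟨A, hA, rfl⟩ _ ⟨B, hB, rfl⟩ i
    have := hC.diag _ (hC.mul _ (hC.mul _ (hSC hA) _ huv) _ (hSC hB)) i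
    rwa [mul_vecMulVec, vecMulVec_mul] at this)
  refine ⟨a, ha, fun A hA => ?_⟩
  have hai : ∀ i, (a i)⁻¹ ≠ 0 := fun i => inv_ne_zero (ha i)
  set B : Matrix (Fin n) (Fin n) ℂ := Matrix.of fun i j => a i * A i j * (a j)⁻¹ with hB
  have hBX := IsInvariantNonnegSet.of_scaling (A := A) ha hXs haX (by
    rintro _ ⟨M, hM, rfl⟩
    exact ⟨A * M, hsemi A hA M hM, (mulVec_mulVec _ _ _).symm⟩)
  have hBY := IsInvariantNonnegSet.of_scaling (A := Aᵀ) hai hYs haY (by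
    rintro _ ⟨M, hM, rfl⟩
    exact ⟨M * A, hsemi M hM A hA, by simp [mulVec_transpose]⟩)
  have hBt : (Matrix.of fun i j => (a i)⁻¹ * Aᵀ i j * (a j)⁻¹⁻¹) = Bᵀ := by
    ext i j
    simp only [hB, of_apply, transpose_apply, inv_inv]
    ring
  rw [hBt] at hBY
  have hBA : B = diagonal a * A * diagonal (fun i => (a i)⁻¹) := by
    ext i j
    rw [Matrix.diagonal_conj_apply, hB, of_apply]
  have hrank : B.rank ≤ A.rank := by
    rw [hBA]
    exact (rank_mul_le_left _ _).trans (rank_mul_le_right _ _)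
  obtain ⟨e, he, heA⟩ := (hdiagsim A hA).exists_forall_nonneg
  obtain ⟨d, hd, hdB⟩ := Matrix.exists_unimodular_conj_nonneg (B := B) (e := fun i => e i * (a i)⁻¹)
    (fun i => mul_ne_zero (he i) (hai i)) (fun i j => by
      convert heA i j using 1
      simp only [hB, of_apply]
      have := ha i
      have := ha j
      have := he j
      field_simp)
  exact Matrix.nonneg_of_same_zeros (hdec A hA) hrank
    (fun i j => by simp [ha i, ha j]) hBX hBY hd hdB

end Assembly

/-- **main theorem.** An irreducible semigroup `S ⊆ M_n(ℂ)` in which each member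
is diagonally similar to a nonnegative matrix and every member of rank at least 2 is
indecomposable or 1-decomposable is simultaneously diagonally similar to a semigroup of
nonnegative matrices. -/
theorem stmt_12 {n : ℕ} (hn : 2 ≤ n) (S : Set (Matrix (Fin n) (Fin n) ℂ))
    (hsemi : ∀ A ∈ S, ∀ B ∈ S, A * B ∈ S)
    (hirr : ∀ p : Submodule ℂ (Fin n → ℂ),
      (∀ A ∈ S, ∀ v ∈ p, A.mulVec v ∈ p) → p = ⊥ ∨ p = ⊤)
    (hdiagsim : ∀ A ∈ S, DiagSimNonneg A)
    (hdec : ∀ A ∈ S, 2 ≤ A.rank → ¬ Decomposable A ∨ OneDecomposable A) :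
    ∃ d : Fin n → ℂ, (∀ i, d i ≠ 0) ∧
      ∀ A ∈ S, ∀ i j,
        0 ≤ ((diagonal d * A * diagonal (fun i => (d i)⁻¹)) i j).re ∧
        ((diagonal d * A * diagonal (fun i => (d i)⁻¹)) i j).im = 0 := by
  obtain ⟨a, ha, h⟩ := exists_diagonal_scaling hn hsemi hirr hdiagsim hdec
  refine ⟨a, ha, fun A hA i j => ?_⟩
  rw [Matrix.diagonal_conj_apply]
  have := Complex.nonneg_iff.1 (h A hA i j)
  exact ⟨this.1, this.2.symm⟩
end

section
/- Let S ⊆ M₂(ℂ) be an irreducible multiplicative semigroup such that each member of S is diagonally similar to a matrix with all entries nonnegative real. Then there exists a single invertible diagonal matrix D ∈ M₂(ℂ) such that every matrix in D S D⁻¹ has all entries nonnegative real. -/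
open Matrix

theorem DiagSimNonneg.exists_diag_eq {n : ℕ} {A : Matrix (Fin n) (Fin n) ℂ}
    (h : DiagSimNonneg A) (i : Fin n) : ∃ x : ℝ, 0 ≤ x ∧ A i i = x := by
  obtain ⟨d, hd, h⟩ := h
  obtain ⟨h₁, h₂⟩ := h i i
  have e : (diagonal d * A * diagonal (fun i => (d i)⁻¹)) i i = A i i := by
    rw [mul_diagonal, diagonal_mul]
    field_simp [hd i]
  rw [e] at h₁ h₂
  exact ⟨_, h₁, Complex.ext (by simp) (by simpa using h₂)⟩

theorem DiagSimNonneg.exists_mul_eq {n : ℕ} {A : Matrix (Fin n) (Fin n) ℂ}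
    (h : DiagSimNonneg A) (i j : Fin n) : ∃ x : ℝ, 0 ≤ x ∧ A i j * A j i = x := by
  obtain ⟨d, hd, h⟩ := h
  set M := diagonal d * A * diagonal (fun i => (d i)⁻¹) with hM
  have e : M i j * M j i = A i j * A j i := by
    rw [hM]
    simp only [mul_diagonal, diagonal_mul]
    field_simp [hd i, hd j]
  refine ⟨(M i j).re * (M j i).re, mul_nonneg (h i j).1 (h j i).1, ?_⟩
  rw [← e]
  apply Complex.ext <;> simp [(h i j).2, (h j i).2]

/-- If a closed cone of real matrices is closed under multiplication and its members have
nonnegative diagonal, then a member with positive diagonal can be shifted within the cone by a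
scalar so that its determinant becomes nonpositive. -/
theorem exists_shift_mem_det_nonpos {K : Set (Matrix (Fin 2) (Fin 2) ℝ)} (hK : IsClosed K)
    (hmul : ∀ A ∈ K, ∀ B ∈ K, A * B ∈ K) (hsmul : ∀ c : ℝ, 0 ≤ c → ∀ A ∈ K, c • A ∈ K)
    (hdiag : ∀ A ∈ K, ∀ i, 0 ≤ A i i) {A : Matrix (Fin 2) (Fin 2) ℝ} (hA : A ∈ K)
    (h₁ : 0 < A 1 1) :
    ∃ r : ℝ, A - r • (1 : Matrix (Fin 2) (Fin 2) ℝ) ∈ K ∧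
      (A 0 0 - r) * (A 1 1 - r) ≤ A 0 1 * A 1 0 := by
  set R : Set ℝ := {r | A - r • (1 : Matrix (Fin 2) (Fin 2) ℝ) ∈ K} with hR
  have hcl : IsClosed R := hK.preimage (by fun_prop)
  have hne : R.Nonempty := ⟨0, by simpa [hR] using hA⟩
  have hle : ∀ r ∈ R, r ≤ A 0 0 := fun r hr => by simpa using hdiag _ hr 0
  have hbdd : BddAbove R := ⟨A 0 0, hle⟩
  have hmem := hcl.csSup_mem hne hbdd
  set r := sSup R
  refine ⟨r, hmem, ?_⟩
  have hpos : 0 < A 0 0 + A 1 1 - r := by linarith [hle r hmem]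
  have hdet : A.det / (A 0 0 + A 1 1 - r) ∈ R := by
    have := hsmul _ (inv_nonneg.2 hpos.le) _ (hmul _ hA _ hmem)
    change A - _ • (1 : Matrix (Fin 2) (Fin 2) ℝ) ∈ K
    convert this using 1
    ext i j
    fin_cases i <;> fin_cases j <;>
      simp [det_fin_two, mul_apply, Fin.sum_univ_two] <;> field_simp <;> ring
  have := le_csSup hbdd hdet
  rw [div_le_iff₀ hpos, det_fin_two] at this
  change _ ≤ r * _ at this
  linarith

theorem offdiag_eq_of_mul_neg {a b c d a' b' c' d' : ℝ} (ha : 0 ≤ a) (hd : 0 ≤ d)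
    (ha' : 0 ≤ a') (hd' : 0 ≤ d') (hdet : a * d ≤ b * c) (hdet' : a' * d' ≤ b' * c')
    (h₁ : 0 ≤ a * a' + b * c') (h₂ : 0 ≤ c * b' + d * d') (h₃ : 0 ≤ a' * a + b' * c)
    (h₄ : 0 ≤ c' * b + d' * d) (hneg : b * c' < 0) :
    b * c' = b' * c ∧ a * b' + b * d' = 0 ∧ a' * b + b' * d = 0 ∧ c * a' + d * c' = 0 ∧
      c' * a + d' * c = 0 := by
  have had : 0 ≤ a * d := mul_nonneg ha hd
  have had' : 0 ≤ a' * d' := mul_nonneg ha' hd'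
  have hprod : (a * a') * (d * d') ≤ (b * c') * (b' * c) := by
    have := mul_le_mul hdet hdet' had' (had.trans hdet)
    linarith
  have haa : 0 < a * a' := by linarith
  have hdd : 0 < d * d' := by linarith
  have hq : b' * c < 0 := by nlinarith [mul_pos haa hdd]
  have hp2 : (b * c') * (b * c') ≤ (a * a') * (d * d') := by nlinarith
  have hq2 : (b' * c) * (b' * c) ≤ (a * a') * (d * d') := by nlinarith
  have e : b * c' = b' * c := by nlinarith
  have e₁ : a * a' = -(b * c') := by nlinarith
  have e₂ : d * d' = -(b * c') := by nlinarith
  have ha0 : a ≠ 0 := left_ne_zero_of_mul haa.ne'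
  have ha'0 : a' ≠ 0 := right_ne_zero_of_mul haa.ne'
  have hd0 : d ≠ 0 := left_ne_zero_of_mul hdd.ne'
  have hd'0 : d' ≠ 0 := right_ne_zero_of_mul hdd.ne'
  have hdetpos : 0 < a' * d' := had'.lt_of_ne' (mul_ne_zero ha'0 hd'0)
  have hdetpos' : 0 < a * d := had.lt_of_ne' (mul_ne_zero ha0 hd0)
  have hp : (a * d) * (a' * d') = (b * c) * (b' * c') := by
    linear_combination (d * d') * e₁ - (b * c') * e₂ + (b * c') * e
  have e₃ : a * d = b * c := by nlinarith
  have e₄ : a' * d' = b' * c' := by nlinarith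
  refine ⟨e, ?_, ?_, ?_, ?_⟩
  · exact (mul_eq_zero.1 (by linear_combination b' * e₁ + b * e₄ :
      a' * (a * b' + b * d') = 0)).resolve_left ha'0
  · exact (mul_eq_zero.1 (by linear_combination b * e₁ + b' * e₃ - b * e :
      a * (a' * b + b' * d) = 0)).resolve_left ha0
  · exact (mul_eq_zero.1 (by linear_combination c * e₁ + c' * e₃ :
      a * (c * a' + d * c') = 0)).resolve_left ha0
  · exact (mul_eq_zero.1 (by linear_combination c' * e₁ + c * e₄ - c' * e :
      a' * (c' * a + d' * c) = 0)).resolve_left ha'0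

theorem commute_of_closed_cone {K : Set (Matrix (Fin 2) (Fin 2) ℝ)} (hK : IsClosed K)
    (hmul : ∀ A ∈ K, ∀ B ∈ K, A * B ∈ K) (hsmul : ∀ c : ℝ, 0 ≤ c → ∀ A ∈ K, c • A ∈ K)
    (hdiag : ∀ A ∈ K, ∀ i, 0 ≤ A i i) {A B : Matrix (Fin 2) (Fin 2) ℝ} (hA : A ∈ K)
    (hB : B ∈ K) (hneg : A 0 1 * B 1 0 < 0) : Commute A B := by
  have hBA := hdiag _ (hmul _ hB _ hA) 1
  simp only [mul_apply, Fin.sum_univ_two] at hBA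
  have hd : 0 < B 1 1 * A 1 1 := by linarith
  have hA₁ : 0 < A 1 1 := (hdiag A hA 1).lt_of_ne' (right_ne_zero_of_mul hd.ne')
  have hB₁ : 0 < B 1 1 := (hdiag B hB 1).lt_of_ne' (left_ne_zero_of_mul hd.ne')
  obtain ⟨r, hr, hrdet⟩ := exists_shift_mem_det_nonpos hK hmul hsmul hdiag hA hA₁
  obtain ⟨s, hs, hsdet⟩ := exists_shift_mem_det_nonpos hK hmul hsmul hdiag hB hB₁
  have h₁ := hdiag _ hr 0
  have h₂ := hdiag _ hr 1
  have h₃ := hdiag _ hs 0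
  have h₄ := hdiag _ hs 1
  have h₅ := hdiag _ (hmul _ hr _ hs) 0
  have h₆ := hdiag _ (hmul _ hr _ hs) 1
  have h₇ := hdiag _ (hmul _ hs _ hr) 0
  have h₈ := hdiag _ (hmul _ hs _ hr) 1
  suffices h : A 0 1 * B 1 0 = B 0 1 * A 1 0 ∧
      (A 0 0 - r) * B 0 1 + A 0 1 * (B 1 1 - s) = 0 ∧
      (B 0 0 - s) * A 0 1 + B 0 1 * (A 1 1 - r) = 0 ∧
      A 1 0 * (B 0 0 - s) + (A 1 1 - r) * B 1 0 = 0 ∧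
      B 1 0 * (A 0 0 - r) + (B 1 1 - s) * A 1 0 = 0 by
    obtain ⟨e₁, e₂, e₃, e₄, e₅⟩ := h
    ext i j
    fin_cases i <;> fin_cases j <;> simp [mul_apply, Fin.sum_univ_two] <;> linarith
  simp [mul_apply, Fin.sum_univ_two] at h₁ h₂ h₃ h₄ h₅ h₆ h₇ h₈
  exact offdiag_eq_of_mul_neg (sub_nonneg.2 h₁) (sub_nonneg.2 h₂) (sub_nonneg.2 h₃)
    (sub_nonneg.2 h₄) hrdet hsdet h₅ h₆ h₇ h₈ hneg

theorem commute_fin_two_iff {R : Type*} [CommRing R] {A B : Matrix (Fin 2) (Fin 2) R} :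
    Commute A B ↔ A 0 1 * B 1 0 = B 0 1 * A 1 0 ∧
      A 0 0 * B 0 1 + A 0 1 * B 1 1 = B 0 0 * A 0 1 + B 0 1 * A 1 1 ∧
      A 1 0 * B 0 0 + A 1 1 * B 1 0 = B 1 0 * A 0 0 + B 1 1 * A 1 0 := by
  rw [commute_iff_eq, ← Matrix.ext_iff]
  simp only [Fin.forall_fin_two, mul_apply, Fin.sum_univ_two]
  constructor
  · rintro ⟨⟨h₀₀, h₀₁⟩, h₁₀, -⟩
    exact ⟨by linear_combination h₀₀, h₀₁, h₁₀⟩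
  · rintro ⟨h, h₀₁, h₁₀⟩
    exact ⟨⟨by linear_combination h, h₀₁⟩, h₁₀, by linear_combination -h⟩

theorem commute_trans_of_ne {R : Type*} [CommRing R] [IsDomain R]
    {A B C : Matrix (Fin 2) (Fin 2) R} (hB : B 0 1 ≠ 0) (hAB : Commute A B)
    (hBC : Commute B C) : Commute A C := by
  rw [commute_fin_two_iff] at *
  obtain ⟨h₁, h₂, h₃⟩ := hAB
  obtain ⟨k₁, k₂, k₃⟩ := hBC
  refine ⟨mul_left_cancel₀ hB ?_, mul_left_cancel₀ hB ?_, mul_left_cancel₀ hB ?_⟩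
  · linear_combination A 0 1 * k₁ + C 0 1 * h₁
  · linear_combination A 0 1 * k₂ + C 0 1 * h₂
  · linear_combination -A 1 0 * k₂ - (A 0 0 - A 1 1) * k₁ + C 0 1 * h₃

/-- If two members of a semigroup of real matrices with nonnegative diagonals and nonnegative
products of opposite off-diagonal entries have off-diagonal entries of opposite signs, then the
first one is central. -/
theorem commute_of_mul_neg {S : Set (Matrix (Fin 2) (Fin 2) ℝ)}
    (hmul : ∀ A ∈ S, ∀ B ∈ S, A * B ∈ S) (hdiag : ∀ A ∈ S, ∀ i, 0 ≤ A i i)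
    (hoff : ∀ A ∈ S, 0 ≤ A 0 1 * A 1 0) {A B : Matrix (Fin 2) (Fin 2) ℝ} (hA : A ∈ S)
    (hB : B ∈ S) (hneg : A 0 1 * B 1 0 < 0) {C : Matrix (Fin 2) (Fin 2) ℝ} (hC : C ∈ S) :
    Commute A C := by
  have key : ∀ X ∈ S, ∀ Y ∈ S, X 0 1 * Y 1 0 < 0 → Commute X Y := by
    intro X hX Y hY
    set T : Set (Matrix (Fin 2) (Fin 2) ℝ) := {M | ∃ c : ℝ, 0 ≤ c ∧ ∃ Z ∈ S, c • Z = M}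
    have hST : S ⊆ closure T :=
      fun Z hZ => subset_closure ⟨1, zero_le_one, Z, hZ, one_smul ℝ Z⟩
    refine commute_of_closed_cone (K := closure T) isClosed_closure ?_ ?_ ?_ (hST hX) (hST hY)
    · intro M hM N hN
      refine map_mem_closure₂ continuous_mul hM hN ?_
      rintro _ ⟨c, hc, Z, hZ, rfl⟩ _ ⟨c', hc', Z', hZ', rfl⟩
      exact ⟨c * c', mul_nonneg hc hc', _, hmul _ hZ _ hZ', (smul_mul_smul_comm c Z c' Z').symm⟩
    · intro c hc M hM
      refine map_mem_closure (continuous_const_smul c) hM ?_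
      rintro _ ⟨c', hc', Z, hZ, rfl⟩
      exact ⟨c * c', mul_nonneg hc hc', Z, hZ, mul_smul c c' Z⟩
    · intro M hM i
      have hcl : IsClosed {M : Matrix (Fin 2) (Fin 2) ℝ | 0 ≤ M i i} :=
        isClosed_le continuous_const (continuous_id.matrix_elem i i)
      refine closure_minimal ?_ hcl hM
      rintro _ ⟨c, hc, Z, hZ, rfl⟩
      exact mul_nonneg hc (hdiag Z hZ i)
  have hAB := key A hA B hB hneg
  have e₀ : A 0 1 * B 1 0 = B 0 1 * A 1 0 := (commute_fin_two_iff.1 hAB).1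
  have hneg' : B 0 1 * A 1 0 < 0 := e₀ ▸ hneg
  have hA₀ : A 0 1 ≠ 0 := left_ne_zero_of_mul hneg.ne
  have hA₁ : A 1 0 ≠ 0 := right_ne_zero_of_mul hneg'.ne
  have hB₀ : B 0 1 ≠ 0 := left_ne_zero_of_mul hneg'.ne
  have hB₁ : B 1 0 ≠ 0 := right_ne_zero_of_mul hneg.ne
  have hA₂ : 0 < A 0 1 * A 1 0 := (hoff A hA).lt_of_ne' (mul_ne_zero hA₀ hA₁)
  have hB₂ : 0 < B 0 1 * B 1 0 := (hoff B hB).lt_of_ne' (mul_ne_zero hB₀ hB₁)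
  by_cases h₀ : C 0 1 = 0
  · by_cases h₁ : C 1 0 = 0
    · suffices h : C 0 0 = C 1 1 by
        rw [commute_fin_two_iff, h₀, h₁, h]
        refine ⟨?_, ?_, ?_⟩ <;> ring
      have c₀ : (C * A) 0 1 = C 0 0 * A 0 1 := by simp [mul_apply, Fin.sum_univ_two, h₀]
      have c₁ : (C * A) 1 0 = C 1 1 * A 1 0 := by simp [mul_apply, Fin.sum_univ_two, h₁]
      have of_commute (h : Commute (C * A) B) : C 0 0 = C 1 1 := by
        have h := (commute_fin_two_iff.1 h).1
        rw [c₀, c₁] at h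
        refine mul_right_cancel₀ hneg.ne ?_
        linear_combination h - C 1 1 * e₀
      have hCA := hmul C hC A hA
      by_cases p : C 0 0 = 0
      · by_cases q : C 1 1 = 0
        · rw [p, q]
        · refine of_commute (key B hB _ hCA ?_).symm
          rw [c₁, mul_left_comm]
          exact mul_neg_of_pos_of_neg ((hdiag C hC 1).lt_of_ne' q) hneg'
      · refine of_commute (key _ hCA B hB ?_)
        rw [c₀, mul_assoc]
        exact mul_neg_of_pos_of_neg ((hdiag C hC 0).lt_of_ne' p) hneg
    · rcases lt_or_ge (A 0 1 * C 1 0) 0 with h | h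
      · exact key A hA C hC h
      · refine commute_trans_of_ne hB₀ hAB (key B hB C hC ?_)
        by_contra! h'
        have : 0 < (A 0 1 * C 1 0) * (B 0 1 * C 1 0) :=
          (mul_nonneg h h').lt_of_ne' (by simp [hA₀, hB₀, h₁])
        nlinarith [mul_pos this hB₂, mul_nonneg (sq_nonneg (B 0 1)) (sq_nonneg (C 1 0))]
  · rcases lt_or_ge (C 0 1 * A 1 0) 0 with h | h
    · exact (key C hC A hA h).symm
    · refine commute_trans_of_ne hB₀ hAB (key C hC B hB ?_).symm
      by_contra! h'
      have : 0 < (C 0 1 * A 1 0) * (C 0 1 * B 1 0) :=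
        (mul_nonneg h h').lt_of_ne' (by simp [hA₁, hB₁, h₀])
      nlinarith [mul_pos this hA₂, mul_nonneg (sq_nonneg (A 1 0)) (sq_nonneg (C 0 1))]

/-- A matrix commuting with every member of an irreducible collection is diagonal. -/
theorem apply_eq_zero_of_forall_commute {n : ℕ} {S : Set (Matrix (Fin n) (Fin n) ℂ)}
    (hirr : ∀ p : Submodule ℂ (Fin n → ℂ),
      (∀ A ∈ S, ∀ v ∈ p, A.mulVec v ∈ p) → p = ⊥ ∨ p = ⊤)
    {A : Matrix (Fin n) (Fin n) ℂ} (hA : ∀ B ∈ S, Commute A B) {i j : Fin n} (hij : i ≠ j) :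
    A i j = 0 := by
  have : Nonempty (Fin n) := ⟨i⟩
  obtain ⟨μ, hμ⟩ := Module.End.exists_eigenvalue A.mulVecLin
  have htop := (hirr (Module.End.eigenspace A.mulVecLin μ) fun B hB v hv => by
    rw [Module.End.mem_eigenspace_iff, mulVecLin_apply] at hv ⊢
    rw [mulVec_mulVec, (hA B hB).eq, ← mulVec_mulVec, hv, mulVec_smul]).resolve_left hμ
  have hmem : Pi.single j 1 ∈ Module.End.eigenspace A.mulVecLin μ := htop ▸ Submodule.mem_top
  rw [Module.End.mem_eigenspace_iff] at hmem
  simpa [hij] using congr_fun hmem i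

/-- A rescaling of the coordinates making all members of `S` real transfers
`commute_of_mul_neg` to complex matrices. -/
theorem commute_of_rescaled_mul_neg {S : Set (Matrix (Fin 2) (Fin 2) ℂ)}
    (hmul : ∀ A ∈ S, ∀ B ∈ S, A * B ∈ S) (hdiagsim : ∀ A ∈ S, DiagSimNonneg A) {c : ℂ}
    (hc : c ≠ 0) (h₀₁ : ∀ A ∈ S, ∃ x : ℝ, A 0 1 * c = x) (h₁₀ : ∀ A ∈ S, ∃ x : ℝ, A 1 0 = x * c)
    {A B : Matrix (Fin 2) (Fin 2) ℂ} (hA : A ∈ S) (hB : B ∈ S) {x : ℝ} (hx : x < 0)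
    (hAB : A 0 1 * B 1 0 = x) {C : Matrix (Fin 2) (Fin 2) ℂ} (hC : C ∈ S) : Commute A C := by
  set T : Set (Matrix (Fin 2) (Fin 2) ℝ) := {M | ∃ X ∈ S,
    X 0 0 = M 0 0 ∧ X 0 1 * c = M 0 1 ∧ X 1 0 = M 1 0 * c ∧ X 1 1 = M 1 1}
  have hex : ∀ X ∈ S, ∃ M ∈ T,
      X 0 0 = M 0 0 ∧ X 0 1 * c = M 0 1 ∧ X 1 0 = M 1 0 * c ∧ X 1 1 = M 1 1 := by
    intro X hX
    obtain ⟨p, -, hp⟩ := (hdiagsim X hX).exists_diag_eq 0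
    obtain ⟨q, hq⟩ := h₀₁ X hX
    obtain ⟨r, hr⟩ := h₁₀ X hX
    obtain ⟨s, -, hs⟩ := (hdiagsim X hX).exists_diag_eq 1
    exact ⟨!![p, q; r, s], ⟨X, hX, hp, hq, hr, hs⟩, hp, hq, hr, hs⟩
  obtain ⟨M, hM, a₁, a₂, a₃, a₄⟩ := hex A hA
  obtain ⟨N, hN, b₁, b₂, b₃, b₄⟩ := hex B hB
  obtain ⟨P, hP, c₁, c₂, c₃, c₄⟩ := hex C hC
  have hneg : M 0 1 * N 1 0 = x := by
    have : ((M 0 1 * N 1 0 : ℝ) : ℂ) = x := by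
      push_cast
      rw [← hAB, ← a₂, b₃]
      ring
    exact_mod_cast this
  have hMP : Commute M P := by
    refine commute_of_mul_neg (S := T) ?_ ?_ ?_ hM hN (hneg ▸ hx) hP
    · rintro M ⟨X, hX, x₁, x₂, x₃, x₄⟩ N ⟨Y, hY, y₁, y₂, y₃, y₄⟩
      refine ⟨X * Y, hmul X hX Y hY, ?_, ?_, ?_, ?_⟩ <;>
        simp only [mul_apply, Fin.sum_univ_two] <;> push_cast
      · rw [x₁, y₁, ← x₂, y₃]; ring
      · rw [← x₂, ← y₂, x₁, y₄]; ring
      · rw [x₃, x₄, y₁, y₃]; ring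
      · rw [x₄, y₄, ← y₂, x₃]; ring
    · rintro M ⟨X, hX, x₁, x₂, x₃, x₄⟩
      obtain ⟨p, hp, hp'⟩ := (hdiagsim X hX).exists_diag_eq 0
      obtain ⟨q, hq, hq'⟩ := (hdiagsim X hX).exists_diag_eq 1
      rw [x₁] at hp'
      rw [x₄] at hq'
      rw [Fin.forall_fin_two]
      exact ⟨hp.trans_eq (by exact_mod_cast hp'.symm), hq.trans_eq (by exact_mod_cast hq'.symm)⟩
    · rintro M ⟨X, hX, x₁, x₂, x₃, x₄⟩
      obtain ⟨p, hp, hp'⟩ := (hdiagsim X hX).exists_mul_eq 0 1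
      have : ((M 0 1 * M 1 0 : ℝ) : ℂ) = p := by
        push_cast
        rw [← hp', ← x₂, x₃]
        ring
      exact hp.trans_eq (by exact_mod_cast this.symm)
  rw [commute_fin_two_iff] at hMP ⊢
  obtain ⟨h₁, h₂, h₃⟩ := hMP
  have h₁' := congr_arg (fun t : ℝ => (t : ℂ)) h₁
  have h₂' := congr_arg (fun t : ℝ => (t : ℂ)) h₂
  have h₃' := congr_arg (fun t : ℝ => (t : ℂ)) h₃
  push_cast at h₁' h₂' h₃'
  rw [← a₂, ← c₂] at h₁'
  rw [← a₁, ← a₂, ← a₄, ← c₁, ← c₂, ← c₄] at h₂'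
  rw [← a₁, ← a₄, ← c₁, ← c₄] at h₃'
  refine ⟨?_, mul_right_cancel₀ hc ?_, ?_⟩
  · rw [a₃, c₃]
    linear_combination h₁'
  · linear_combination h₂'
  · rw [a₃, c₃]
    linear_combination c * h₃'

/-- An irreducible semigroup `S ⊆ M₂(ℂ)` in which each member is diagonally
similar to a nonnegative matrix is simultaneously diagonally similar to a semigroup of
nonnegative matrices. -/
theorem stmt_13 (S : Set (Matrix (Fin 2) (Fin 2) ℂ))
    (hsemi : ∀ A ∈ S, ∀ B ∈ S, A * B ∈ S)
    (hirr : ∀ p : Submodule ℂ (Fin 2 → ℂ),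
      (∀ A ∈ S, ∀ v ∈ p, A.mulVec v ∈ p) → p = ⊥ ∨ p = ⊤)
    (hdiagsim : ∀ A ∈ S, DiagSimNonneg A) :
    ∃ d : Fin 2 → ℂ, (∀ i, d i ≠ 0) ∧
      ∀ A ∈ S, ∀ i j,
        0 ≤ ((diagonal d * A * diagonal (fun i => (d i)⁻¹)) i j).re ∧
        ((diagonal d * A * diagonal (fun i => (d i)⁻¹)) i j).im = 0 := by
  obtain ⟨B, hB, hB₀⟩ : ∃ B ∈ S, B 1 0 ≠ 0 := by
    by_contra! h
    rcases hirr (LinearMap.ker (LinearMap.proj 1)) fun A hA v hv => by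
      simp_all with h' | h'
    · have : ![1, 0] ∈ (⊥ : Submodule ℂ (Fin 2 → ℂ)) := h' ▸ by simp
      simp at this
    · have : ![0, 1] ∈ LinearMap.ker (LinearMap.proj (R := ℂ) (φ := fun _ : Fin 2 => ℂ) 1) :=
        h' ▸ Submodule.mem_top
      simp at this
  obtain ⟨A, hA, hA₀⟩ : ∃ A ∈ S, A 0 1 ≠ 0 := by
    by_contra! h
    rcases hirr (LinearMap.ker (LinearMap.proj 0)) fun A hA v hv => by
      simp_all with h' | h'
    · have : ![0, 1] ∈ (⊥ : Submodule ℂ (Fin 2 → ℂ)) := h' ▸ by simp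
      simp at this
    · have : ![1, 0] ∈ LinearMap.ker (LinearMap.proj (R := ℂ) (φ := fun _ : Fin 2 => ℂ) 0) :=
        h' ▸ Submodule.mem_top
      simp at this
  have hreal : ∀ X ∈ S, ∀ Y ∈ S, ∃ x : ℝ, X 0 1 * Y 1 0 = x := by
    intro X hX Y hY
    obtain ⟨x, -, hx⟩ := (hdiagsim _ (hsemi X hX Y hY)).exists_diag_eq 0
    obtain ⟨y, -, hy⟩ := (hdiagsim X hX).exists_diag_eq 0
    obtain ⟨z, -, hz⟩ := (hdiagsim Y hY).exists_diag_eq 0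
    rw [mul_apply, Fin.sum_univ_two, hy, hz] at hx
    exact ⟨x - y * z, by push_cast; linear_combination hx⟩
  have hnonneg : ∀ X ∈ S, ∀ Y ∈ S, ∃ x : ℝ, 0 ≤ x ∧ X 0 1 * Y 1 0 = x := by
    intro X hX Y hY
    obtain ⟨x, hx⟩ := hreal X hX Y hY
    refine ⟨x, ?_, hx⟩
    by_contra! hneg
    have h₁₀ : ∀ Z ∈ S, ∃ z : ℝ, Z 1 0 = z * B 1 0 := by
      intro Z hZ
      obtain ⟨w, hw⟩ := hreal A hA Z hZ
      obtain ⟨t, ht⟩ := hreal A hA B hB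
      refine ⟨w / t, ?_⟩
      push_cast
      rw [← hw, ← ht]
      field_simp
    have hcomm : ∀ Z ∈ S, Commute X Z := fun Z hZ =>
      commute_of_rescaled_mul_neg hsemi hdiagsim hB₀ (fun Z hZ => hreal Z hZ B hB) h₁₀ hX hY
        hneg hx hZ
    have hX₀ : X 0 1 = 0 := apply_eq_zero_of_forall_commute hirr hcomm zero_ne_one
    rw [hX₀, zero_mul] at hx
    exact hneg.ne (by exact_mod_cast hx.symm)
  refine ⟨![B 1 0, 1], by simp [Fin.forall_fin_two, hB₀], fun X hX => ?_⟩
  obtain ⟨x, hx, hx'⟩ := (hdiagsim X hX).exists_diag_eq 0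
  obtain ⟨y, hy, hy'⟩ := (hdiagsim X hX).exists_diag_eq 1
  obtain ⟨z, hz, hz'⟩ := hnonneg X hX B hB
  obtain ⟨w, hw, hw'⟩ := hnonneg A hA X hX
  obtain ⟨t, ht, ht'⟩ := hnonneg A hA B hB
  have e : X 1 0 * (B 1 0)⁻¹ = ((w / t : ℝ) : ℂ) := by
    push_cast
    rw [← hw', ← ht']
    field_simp
  have e₀ : B 1 0 * (x : ℂ) * (B 1 0)⁻¹ = x := by field_simp
  have e' : B 1 0 * X 0 1 = z := by rw [mul_comm, hz']
  simp only [Fin.forall_fin_two, mul_diagonal, diagonal_mul]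
  simp [hx', hy', e, e', e₀, hx, hy, hz, div_nonneg hw ht]
end

section
/- Let A₃ = [[1,0,1],[0,1,−1],[0,0,0]] ∈ M₃(ℝ), K₃ = {(x,y,z) ∈ ℝ³ : x ≥ 0, y ≥ z ≥ 0} and L₃ = {(x,y,z) ∈ ℝ³ : x ≥ y ≥ 0, z ≥ 0}. Then K₃ and L₃ are proper cones contained in ℝ₊³, A₃(K₃) ⊆ K₃, A₃ᵀ(L₃) ⊆ L₃, A₃² = A₃, and A₃ is diagonally similar to a matrix with all entries nonnegative, yet A₃ has a strictly negative entry. -/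
open Matrix

theorem isProperCone_setOf_nonneg_and_le :
    IsProperCone {v : Fin 3 → ℝ | 0 ≤ v 0 ∧ v 2 ≤ v 1 ∧ 0 ≤ v 2} := by
  refine ⟨by simp, ?_, ?_, ?_, ?_, ?_⟩
  · rintro x ⟨hx0, hx1, hx2⟩ y ⟨hy0, hy1, hy2⟩
    exact ⟨add_nonneg hx0 hy0, add_le_add hx1 hy1, add_nonneg hx2 hy2⟩
  · rintro r hr x ⟨hx0, hx1, hx2⟩
    exact ⟨mul_nonneg hr hx0, mul_le_mul_of_nonneg_left hx1 hr, mul_nonneg hr hx2⟩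
  · refine .and ?_ (.and ?_ ?_) <;> exact isClosed_le (by fun_prop) (by fun_prop)
  · rintro x ⟨hx0, hx1, hx2⟩ ⟨hy0, hy1, hy2⟩
    simp only [Pi.neg_apply] at hy0 hy1 hy2
    ext i
    fin_cases i <;> simp <;> linarith
  · have hopen : IsOpen {v : Fin 3 → ℝ | 0 < v 0 ∧ v 2 < v 1 ∧ 0 < v 2} := by
      refine .and ?_ (.and ?_ ?_) <;> exact isOpen_lt (by fun_prop) (by fun_prop)
    refine ⟨![1, 2, 1], interior_maximal ?_ hopen ?_⟩
    · rintro v ⟨h0, h1, h2⟩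
      exact ⟨h0.le, h1.le, h2.le⟩
    · simp

theorem isProperCone_setOf_le_and_nonneg :
    IsProperCone {v : Fin 3 → ℝ | v 1 ≤ v 0 ∧ 0 ≤ v 1 ∧ 0 ≤ v 2} := by
  refine ⟨by simp, ?_, ?_, ?_, ?_, ?_⟩
  · rintro x ⟨hx0, hx1, hx2⟩ y ⟨hy0, hy1, hy2⟩
    exact ⟨add_le_add hx0 hy0, add_nonneg hx1 hy1, add_nonneg hx2 hy2⟩
  · rintro r hr x ⟨hx0, hx1, hx2⟩
    exact ⟨mul_le_mul_of_nonneg_left hx0 hr, mul_nonneg hr hx1, mul_nonneg hr hx2⟩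
  · refine .and ?_ (.and ?_ ?_) <;> exact isClosed_le (by fun_prop) (by fun_prop)
  · rintro x ⟨hx0, hx1, hx2⟩ ⟨hy0, hy1, hy2⟩
    simp only [Pi.neg_apply] at hy0 hy1 hy2
    ext i
    fin_cases i <;> simp <;> linarith
  · have hopen : IsOpen {v : Fin 3 → ℝ | v 1 < v 0 ∧ 0 < v 1 ∧ 0 < v 2} := by
      refine .and ?_ (.and ?_ ?_) <;> exact isOpen_lt (by fun_prop) (by fun_prop)
    refine ⟨![2, 1, 1], interior_maximal ?_ hopen ?_⟩
    · rintro v ⟨h0, h1, h2⟩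
      exact ⟨h0.le, h1.le, h2.le⟩
    · simp

/-- For `A₃ = [[1,0,1],[0,1,−1],[0,0,0]]`,
`K₃ = {(x,y,z) : x ≥ 0, y ≥ z ≥ 0}` and `L₃ = {(x,y,z) : x ≥ y ≥ 0, z ≥ 0}`: `K₃` and `L₃` are
proper cones in `ℝ₊³`, `A₃(K₃) ⊆ K₃`, `A₃ᵀ(L₃) ⊆ L₃`, `A₃² = A₃`, `A₃` is diagonally similar to
a nonnegative matrix, yet `A₃` has a strictly negative entry. -/
theorem stmt_14 (A : Matrix (Fin 3) (Fin 3) ℝ) (hA : A = !![1, 0, 1; 0, 1, -1; 0, 0, 0])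
    (K L : Set (Fin 3 → ℝ))
    (hK : K = {v | 0 ≤ v 0 ∧ v 2 ≤ v 1 ∧ 0 ≤ v 2})
    (hL : L = {v | v 1 ≤ v 0 ∧ 0 ≤ v 1 ∧ 0 ≤ v 2}) :
    IsProperCone K ∧ IsProperCone L ∧
    (∀ v ∈ K, ∀ i, 0 ≤ v i) ∧ (∀ v ∈ L, ∀ i, 0 ≤ v i) ∧
    (∀ v ∈ K, A.mulVec v ∈ K) ∧ (∀ v ∈ L, Aᵀ.mulVec v ∈ L) ∧
    A * A = A ∧
    (∃ d : Fin 3 → ℝ, (∀ i, d i ≠ 0) ∧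
      ∀ i j, 0 ≤ (diagonal d * A * diagonal (fun i => (d i)⁻¹)) i j) ∧
    (∃ i j, A i j < 0) := by
  subst hA hK hL
  refine ⟨isProperCone_setOf_nonneg_and_le, isProperCone_setOf_le_and_nonneg,
    ?_, ?_, ?_, ?_, ?_, ⟨![1, -1, 1], ?_, ?_⟩, ⟨1, 2, by simp⟩⟩
  · rintro v ⟨h0, h1, h2⟩ i
    fin_cases i <;> simp <;> linarith
  · rintro v ⟨h0, h1, h2⟩ i
    fin_cases i <;> simp <;> linarith
  · rintro v ⟨h0, h1, h2⟩
    simp only [Set.mem_ofPred_eq, mulVec, dotProduct, Fin.sum_univ_three]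
    refine ⟨?_, ?_, ?_⟩ <;> simp <;> linarith
  · rintro v ⟨h0, h1, h2⟩
    simp only [Set.mem_ofPred_eq, mulVec, dotProduct, Fin.sum_univ_three, transpose_apply]
    refine ⟨?_, ?_, ?_⟩ <;> simp <;> linarith
  · ext i j
    fin_cases i <;> fin_cases j <;> simp [mul_apply, Fin.sum_univ_three]
  · intro i
    fin_cases i <;> simp
  · intro i j
    rw [mul_diagonal, diagonal_mul]
    fin_cases i <;> fin_cases j <;> simp
end

section
/- Let n ≥ 3. Let A₃ = [[1,0,1],[0,1,−1],[0,0,0]], K₃ = {(x,y,z) ∈ ℝ³ : x ≥ 0, y ≥ z ≥ 0}, L₃ = {(x,y,z) ∈ ℝ³ : x ≥ y ≥ 0, z ≥ 0}, and set K_n = K₃ ⊕ ℝ₊^{n−3}, L_n = L₃ ⊕ ℝ₊^{n−3}, and A_n = A₃ ⊕ 0 ∈ M_n(ℝ) (A₃ extended by a zero block). Define S₁ = { x yᵀ : x ∈ K_n, y ∈ L_n } and S = S₁ ∪ {A_n}. Then S is an irreducible multiplicative semigroup in M_n(ℝ) in which every member is diagonally similar to a matrix with all entries nonnegative, but there is no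 single invertible diagonal matrix D such that every matrix in D S D⁻¹ has all entries nonnegative. -/
open Matrix

/-- A complex subspace that is invariant under every dyad `x yᵀ` with `x ∈ K`, `y ∈ L` is trivial
as soon as no nonzero vector is orthogonal to `L` and every subspace containing `K` is everything. -/
theorem eq_bot_or_eq_top_of_vecMulVec_invariant {n : ℕ} {K L : Set (Fin n → ℝ)}
    (hK : ∀ p : Submodule ℂ (Fin n → ℂ), (∀ x ∈ K, (fun i => (x i : ℂ)) ∈ p) → p = ⊤)
    (hL : ∀ v : Fin n → ℂ, (∀ y ∈ L, (fun i => (y i : ℂ)) ⬝ᵥ v = 0) → v = 0)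
    (p : Submodule ℂ (Fin n → ℂ))
    (hp : ∀ x ∈ K, ∀ y ∈ L, ∀ v ∈ p,
      ((vecMulVec x y).map (fun t : ℝ => (t : ℂ))).mulVec v ∈ p) : p = ⊥ ∨ p = ⊤ := by
  by_cases h : ∀ v ∈ p, ∀ y ∈ L, (fun i => (y i : ℂ)) ⬝ᵥ v = 0
  · exact Or.inl ((Submodule.eq_bot_iff p).2 fun v hv => hL v (h v hv))
  · right
    push Not at h
    obtain ⟨v, hv, y, hy, hne⟩ := h
    refine hK p fun x hx => ?_
    have hmem := hp x hx y hy v hv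
    have hdyad : ((vecMulVec x y).map (fun t : ℝ => (t : ℂ))).mulVec v =
        ((fun i => (y i : ℂ)) ⬝ᵥ v) • fun i => (x i : ℂ) := by
      ext i
      simp [mulVec, dotProduct, vecMulVec_apply, mul_comm, mul_left_comm,
        Finset.mul_sum]
    rw [hdyad] at hmem
    exact (p.smul_mem_iff hne).1 hmem

/-- If `K` contains `1 + e_a` and all `1 + e_a + e_j`, then `K` spans. -/
theorem Submodule.eq_top_of_one_add_single_mem {n : ℕ} {K : Set (Fin n → ℝ)} (a : Fin n)
    (h₀ : 1 + Pi.single a 1 ∈ K) (h₁ : ∀ j, 1 + Pi.single a 1 + Pi.single j 1 ∈ K)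
    (p : Submodule ℂ (Fin n → ℂ)) (hp : ∀ x ∈ K, (fun i => (x i : ℂ)) ∈ p) : p = ⊤ := by
  have hsingle (j : Fin n) : (Pi.single j 1 : Fin n → ℂ) ∈ p := by
    convert p.sub_mem (hp _ (h₁ j)) (hp _ h₀) using 1
    ext i
    by_cases hij : i = j <;> simp [Pi.single_apply, hij]
  refine (Submodule.eq_top_iff').2 fun v => ?_
  rw [pi_eq_sum_univ' v]
  refine p.sum_mem fun j _ => p.smul_mem _ ?_
  convert hsingle j using 1

/-- If `L` contains `1 + e_a` and all `1 + e_a + e_j`, then only `0` is orthogonal to `L`. -/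
theorem eq_zero_of_one_add_single_mem {n : ℕ} {L : Set (Fin n → ℝ)} (a : Fin n)
    (h₀ : 1 + Pi.single a 1 ∈ L) (h₁ : ∀ j, 1 + Pi.single a 1 + Pi.single j 1 ∈ L)
    (v : Fin n → ℂ) (hv : ∀ y ∈ L, (fun i => (y i : ℂ)) ⬝ᵥ v = 0) : v = 0 := by
  ext j
  have hdiff : (fun i => ((1 + Pi.single a 1 + Pi.single j 1 : Fin n → ℝ) i : ℂ)) =
      (fun i => ((1 + Pi.single a 1 : Fin n → ℝ) i : ℂ)) + Pi.single j 1 := by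
    ext i
    by_cases hij : i = j <;> simp [Pi.single_apply, hij]
  have h := hv _ (h₁ j)
  rw [hdiff, add_dotProduct, hv _ h₀] at h
  simpa using h

/-- With `Kₙ = K₃ ⊕ ℝ₊^{n−3}`, `Lₙ = L₃ ⊕ ℝ₊^{n−3}` and `Aₙ = A₃ ⊕ 0`
(where `A₃ = [[1,0,1],[0,1,−1],[0,0,0]]`, `K₃ = {(x,y,z) : x ≥ 0, y ≥ z ≥ 0}`,
`L₃ = {(x,y,z) : x ≥ y ≥ 0, z ≥ 0}`), the set `S = Kₙ Lₙᵀ ∪ {Aₙ}` is an irreducible semigroup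
in `M_n(ℝ)` whose members are each diagonally similar to a nonnegative matrix, while `S` is not
simultaneously diagonally similar to a set of nonnegative matrices. -/
theorem stmt_15 {n : ℕ} (hn : 3 ≤ n)
    (Kn Ln : Set (Fin n → ℝ))
    (hKn : Kn = {v | 0 ≤ v ⟨0, by omega⟩ ∧ v ⟨2, by omega⟩ ≤ v ⟨1, by omega⟩ ∧
      0 ≤ v ⟨2, by omega⟩ ∧ ∀ i : Fin n, 3 ≤ (i : ℕ) → 0 ≤ v i})
    (hLn : Ln = {v | v ⟨1, by omega⟩ ≤ v ⟨0, by omega⟩ ∧ 0 ≤ v ⟨1, by omega⟩ ∧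
      0 ≤ v ⟨2, by omega⟩ ∧ ∀ i : Fin n, 3 ≤ (i : ℕ) → 0 ≤ v i})
    (An : Matrix (Fin n) (Fin n) ℝ)
    (hAn : An = Matrix.of fun i j : Fin n =>
      if (i : ℕ) = 0 ∧ (j : ℕ) = 0 then 1
      else if (i : ℕ) = 1 ∧ (j : ℕ) = 1 then 1
      else if (i : ℕ) = 0 ∧ (j : ℕ) = 2 then 1
      else if (i : ℕ) = 1 ∧ (j : ℕ) = 2 then -1
      else 0)
    (S : Set (Matrix (Fin n) (Fin n) ℝ))
    (hS : S = {M | ∃ x ∈ Kn, ∃ y ∈ Ln, M = vecMulVec x y} ∪ {An}) :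
    (∀ A ∈ S, ∀ B ∈ S, A * B ∈ S) ∧
    (∀ p : Submodule ℂ (Fin n → ℂ),
      (∀ A ∈ S, ∀ v ∈ p, (A.map (fun x : ℝ => (x : ℂ))).mulVec v ∈ p) → p = ⊥ ∨ p = ⊤) ∧
    (∀ M ∈ S, ∃ d : Fin n → ℝ, (∀ i, d i ≠ 0) ∧
      ∀ i j, 0 ≤ (diagonal d * M * diagonal (fun i => (d i)⁻¹)) i j) ∧
    ¬ ∃ d : Fin n → ℝ, (∀ i, d i ≠ 0) ∧
        ∀ M ∈ S, ∀ i j, 0 ≤ (diagonal d * M * diagonal (fun i => (d i)⁻¹)) i j := by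
  set a : Fin n := ⟨0, by omega⟩ with ha
  set b : Fin n := ⟨1, by omega⟩ with hb
  set c : Fin n := ⟨2, by omega⟩ with hc
  have hab : a ≠ b := by simp [ha, hb]
  have hac : a ≠ c := by simp [ha, hc]
  have hbc : b ≠ c := by simp [hb, hc]
  have hrest : ∀ i : Fin n, 3 ≤ (i : ℕ) → i ≠ a ∧ i ≠ b ∧ i ≠ c := by
    intro i hi
    simp only [ha, hb, hc, ne_eq, Fin.ext_iff]
    omega
  have hcases : ∀ i : Fin n, i = a ∨ i = b ∨ i = c ∨ 3 ≤ (i : ℕ) := by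
    intro i
    simp only [ha, hb, hc, Fin.ext_iff]
    omega
  have hAn' : An = vecMulVec (Pi.single a 1) (Pi.single a 1 + Pi.single c 1) +
      vecMulVec (Pi.single b 1) (Pi.single b 1 - Pi.single c 1) := by
    have h0 : ∀ i : Fin n, (i : ℕ) = 0 ↔ i = a := fun i => by simp [ha, Fin.ext_iff]
    have h1 : ∀ i : Fin n, (i : ℕ) = 1 ↔ i = b := fun i => by simp [hb, Fin.ext_iff]
    have h2 : ∀ i : Fin n, (i : ℕ) = 2 ↔ i = c := fun i => by simp [hc, Fin.ext_iff]
    ext i j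
    simp only [hAn, of_apply, h0, h1, h2, Matrix.add_apply, vecMulVec_apply, Pi.add_apply,
      Pi.sub_apply, Pi.single_apply]
    by_cases hia : i = a
    · by_cases hja : j = a
      · simp [hia, hja, hab, hac]
      · by_cases hjc : j = c <;> simp [hia, hja, hjc, hab, hac.symm]
    · by_cases hib : i = b
      · by_cases hjb : j = b
        · simp [hib, hjb, hab.symm, hbc]
        · by_cases hjc : j = c <;> simp [hib, hjb, hjc, hab.symm, hbc.symm]
      · simp [hia, hib]
  have hAsq : An * An = An := by
    rw [hAn']
    simp [mul_add, add_mul, vecMulVec_mul_vecMulVec, hab, hab.symm, hac, hbc]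
  have hAmem : An ∈ S := by rw [hS]; exact Or.inr rfl
  have hdyad : ∀ x ∈ Kn, ∀ y ∈ Ln, vecMulVec x y ∈ S := by
    intro x hx y hy
    rw [hS]
    exact Or.inl ⟨x, hx, y, hy, rfl⟩
  have hKnonneg : ∀ x ∈ Kn, ∀ i, 0 ≤ x i := by
    rw [hKn]
    rintro x ⟨h0, h1, h2, h3⟩ i
    rcases hcases i with rfl | rfl | rfl | hi
    exacts [h0, h2.trans h1, h2, h3 i hi]
  have hLnonneg : ∀ y ∈ Ln, ∀ i, 0 ≤ y i := by
    rw [hLn]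
    rintro y ⟨h0, h1, h2, h3⟩ i
    rcases hcases i with rfl | rfl | rfl | hi
    exacts [h1.trans h0, h1, h2, h3 i hi]
  have hAK : ∀ x ∈ Kn, An *ᵥ x ∈ Kn := by
    intro x hx
    have hAx : An *ᵥ x = (x a + x c) • Pi.single a 1 + (x b - x c) • Pi.single b 1 := by
      rw [hAn', add_mulVec, vecMulVec_mulVec, vecMulVec_mulVec]
      simp [add_dotProduct, sub_dotProduct, - MulOpposite.op_add, - MulOpposite.op_sub]
    rw [hKn] at hx
    obtain ⟨h0, h1, h2, -⟩ := hx
    rw [hAx, hKn]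
    refine ⟨?_, ?_, ?_, fun i hi => ?_⟩
    · simpa [hab] using add_nonneg h0 h2
    · simpa [hab, hac, hbc, hab.symm, hac.symm, hbc.symm] using h1
    · simp [hac.symm, hbc.symm]
    · obtain ⟨hia, hib, -⟩ := hrest i hi
      simp [hia, hib]
  have hLA : ∀ y ∈ Ln, y ᵥ* An ∈ Ln := by
    intro y hy
    have hyA : y ᵥ* An = y a • (Pi.single a 1 + Pi.single c 1) +
        y b • (Pi.single b 1 - Pi.single c 1) := by
      rw [hAn', vecMul_add, vecMul_vecMulVec, vecMul_vecMulVec]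
      simp
    rw [hLn] at hy
    obtain ⟨h0, h1, h2, -⟩ := hy
    rw [hyA, hLn]
    refine ⟨?_, ?_, ?_, fun i hi => ?_⟩
    · simpa [hab, hac, hbc, hab.symm, hac.symm, hbc.symm] using h0
    · simpa [hab.symm, hbc] using h1
    · simpa [hac.symm, hbc.symm] using h0
    · obtain ⟨hia, hib, hic⟩ := hrest i hi
      simp [hia, hib, hic]
  have hKsmul : ∀ t : ℝ, 0 ≤ t → ∀ x ∈ Kn, t • x ∈ Kn := by
    rw [hKn]
    rintro t ht x ⟨h0, h1, h2, h3⟩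
    exact ⟨mul_nonneg ht h0, mul_le_mul_of_nonneg_left h1 ht, mul_nonneg ht h2,
      fun i hi => mul_nonneg ht (h3 i hi)⟩
  have hsingle : ∀ i j : Fin n, (0 : ℝ) ≤ (Pi.single i 1 : Fin n → ℝ) j ∧
      (Pi.single i 1 : Fin n → ℝ) j ≤ 1 := by
    intro i j
    by_cases hij : j = i <;> simp [hij]
  refine ⟨?_, ?_, ?_, ?_⟩
  · intro A hA B hB
    rw [hS] at hA hB
    rcases hA with ⟨x, hx, y, hy, rfl⟩ | rfl <;> rcases hB with ⟨u, hu, v, hv, rfl⟩ | rfl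
    · rw [vecMulVec_mul_vecMulVec, vecMulVec_smul, ← smul_vecMulVec]
      exact hdyad _ (hKsmul _ (Finset.sum_nonneg fun i _ =>
        mul_nonneg (hLnonneg y hy i) (hKnonneg u hu i)) x hx) v hv
    · rw [vecMulVec_mul]
      exact hdyad x hx _ (hLA y hy)
    · rw [mul_vecMulVec]
      exact hdyad _ (hAK u hu) v hv
    · rwa [hAsq]
  · intro p hp
    refine eq_bot_or_eq_top_of_vecMulVec_invariant
      (Submodule.eq_top_of_one_add_single_mem b ?_ fun j => ?_)
      (eq_zero_of_one_add_single_mem a ?_ fun j => ?_) p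
      fun x hx y hy => hp _ (hdyad x hx y hy)
    · rw [hKn]
      refine ⟨?_, ?_, ?_, fun i _ => ?_⟩ <;> simp only [Pi.add_apply, Pi.one_apply]
      · linarith [hsingle b a]
      · simp [hbc.symm]
      · linarith [hsingle b c]
      · linarith [hsingle b i]
    · rw [hKn]
      refine ⟨?_, ?_, ?_, fun i _ => ?_⟩ <;> simp only [Pi.add_apply, Pi.one_apply]
      · linarith [hsingle b a, hsingle j a]
      · have := hsingle j c
        have := hsingle j b
        simp only [Pi.single_eq_same, Pi.single_eq_of_ne hbc.symm]
        linarith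
      · linarith [hsingle b c, hsingle j c]
      · linarith [hsingle b i, hsingle j i]
    · rw [hLn]
      refine ⟨?_, ?_, ?_, fun i _ => ?_⟩ <;> simp only [Pi.add_apply, Pi.one_apply]
      · simp [hab.symm]
      · linarith [hsingle a b]
      · linarith [hsingle a c]
      · linarith [hsingle a i]
    · rw [hLn]
      refine ⟨?_, ?_, ?_, fun i _ => ?_⟩ <;> simp only [Pi.add_apply, Pi.one_apply]
      · have := hsingle j a
        have := hsingle j b
        simp only [Pi.single_eq_same, Pi.single_eq_of_ne hab.symm]
        linarith
      · linarith [hsingle a b, hsingle j b]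
      · linarith [hsingle a c, hsingle j c]
      · linarith [hsingle a i, hsingle j i]
  · intro M hM
    rw [hS] at hM
    rcases hM with ⟨x, hx, y, hy, rfl⟩ | rfl
    · refine ⟨1, fun i => one_ne_zero, fun i j => ?_⟩
      simpa [mul_diagonal, diagonal_mul, vecMulVec_apply] using
        mul_nonneg (hKnonneg x hx i) (hLnonneg y hy j)
    · refine ⟨fun i => if i = b then -1 else 1, fun i => by dsimp only; split_ifs <;> norm_num,
        fun i j => ?_⟩
      rw [hAn']
      simp only [mul_diagonal, diagonal_mul, Matrix.add_apply, vecMulVec_apply, Pi.add_apply,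
        Pi.sub_apply, Pi.single_apply]
      by_cases hib : i = b
      · by_cases hjb : j = b
        · simp [hib, hjb, hab.symm, hbc]
        · by_cases hjc : j = c <;> simp [hib, hjb, hjc, hab.symm, hbc.symm]
      · by_cases hjb : j = b
        · simp [hib, hjb, hab.symm, hbc]
        · by_cases hia : i = a <;> by_cases hja : j = a <;> by_cases hjc : j = c <;>
            simp [hib, hjb, hia, hja, hjc, hab, hac, hac.symm, hbc.symm]
  · rintro ⟨d, hd, h⟩
    have hones : vecMulVec (1 : Fin n → ℝ) 1 ∈ S :=
      hdyad _ (by rw [hKn]; simp) _ (by rw [hLn]; simp)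
    have h₁ := h _ hones b c
    have h₂ := h _ hAmem b c
    have hne : d b * (d c)⁻¹ ≠ 0 := mul_ne_zero (hd b) (inv_ne_zero (hd c))
    simp only [mul_diagonal, diagonal_mul, vecMulVec_apply, Pi.one_apply, mul_one] at h₁
    simp [hAn', mul_diagonal, diagonal_mul, vecMulVec_apply, hab.symm, hbc.symm] at h₂
    exact hne (le_antisymm h₂ h₁)
end

section
/- Let n ≥ 2 and let S ⊆ M_n(ℂ) be an irreducible multiplicative semigroup with closure of ℝ₊S equal to S, in which every member has nonnegative real diagonal entries. Then the set S₁ of members of S of rank at most one is nonzero, i.e., S contains a matrix of rank exactly one. -/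
open Matrix

namespace Matrix

variable {ι : Type*} [Fintype ι]

/-- A compact convex set of matrices stable under left multiplication by a compact semigroup of
invertible matrices contains a common fixed point. -/
theorem exists_fixed_of_isCompact_of_convex [DecidableEq ι] {G K : Set (Matrix ι ι ℂ)}
    (hG : IsCompact G) (hG0 : G.Nonempty) (hmul : ∀ g ∈ G, ∀ h ∈ G, g * h ∈ G)
    (hdet : ∀ g ∈ G, g.det ≠ 0) (hK : IsCompact K) (hK0 : K.Nonempty) (hconv : Convex ℝ K)
    (hinv : ∀ g ∈ G, ∀ z ∈ K, g * z ∈ K) : ∃ z ∈ K, ∀ g ∈ G, g * z = z := by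
  let N : Matrix ι ι ℂ → ℝ := fun z => ∑ i, ∑ j, ‖z i j‖ ^ 2
  have hN : Continuous N := by fun_prop
  have hpar (a b : Matrix ι ι ℂ) :
      N ((1 / 2 : ℝ) • a + (1 / 2 : ℝ) • b) = N a / 2 + N b / 2 - N (a - b) / 4 := by
    have key (x y : ℂ) : ‖(1 / 2 : ℝ) • x + (1 / 2 : ℝ) • y‖ ^ 2 =
        ‖x‖ ^ 2 / 2 + ‖y‖ ^ 2 / 2 - ‖x - y‖ ^ 2 / 4 := by
      have h := parallelogram_law_with_norm ℝ x y
      rw [← smul_add, norm_smul, mul_pow]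
      norm_num
      linarith
    simp only [N, add_apply, smul_apply, sub_apply, key, Finset.sum_add_distrib,
      Finset.sum_sub_distrib, Finset.sum_div]
  have hN0 {z : Matrix ι ι ℂ} (hz : N z ≤ 0) : z = 0 := by
    ext i j
    have h1 : ‖z i j‖ ^ 2 ≤ N z :=
      (Finset.single_le_sum (f := fun j => ‖z i j‖ ^ 2) (fun _ _ => by positivity)
        (Finset.mem_univ j)).trans
        (Finset.single_le_sum (f := fun i => ∑ j, ‖z i j‖ ^ 2) (fun _ _ => by positivity)
        (Finset.mem_univ i))
    have h2 : ‖z i j‖ ^ 2 = 0 := le_antisymm (h1.trans hz) (by positivity)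
    simpa using h2
  let F : Matrix ι ι ℂ → ℝ := fun z => sSup ((fun g => N (g * z)) '' G)
  have hF : Continuous F := by
    refine hG.continuous_sSup (f := fun z g => N (g * z)) ?_
    exact hN.comp (continuous_snd.mul continuous_fst)
  have hgz (z : Matrix ι ι ℂ) : Continuous fun g : Matrix ι ι ℂ => N (g * z) :=
    hN.comp (continuous_id.mul continuous_const)
  have hle (z : Matrix ι ι ℂ) {g} (hg : g ∈ G) : N (g * z) ≤ F z :=
    le_csSup (hG.image (hgz z)).bddAbove ⟨g, hg, rfl⟩
  obtain ⟨z, hz, hmin⟩ := hK.exists_isMinOn hK0 hF.continuousOn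
  refine ⟨z, hz, fun g hg => ?_⟩
  have hw : (1 / 2 : ℝ) • z + (1 / 2 : ℝ) • (g * z) ∈ K :=
    hconv hz (hinv g hg z hz) (by norm_num) (by norm_num) (by norm_num)
  obtain ⟨h, hh, hmax⟩ := (hG.image (hgz _)).sSup_mem (hG0.image _)
  have h1 := hmin hw
  have h2 := hle z hh
  have h3 := hle z (hmul h hh g hg)
  have h4 : F z ≤ N (h * ((1 / 2 : ℝ) • z + (1 / 2 : ℝ) • (g * z))) := h1.trans hmax.ge
  rw [mul_add, mul_smul_comm, mul_smul_comm, hpar, ← mul_assoc] at h4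
  have h5 : h * z - h * g * z = 0 := hN0 (by linarith)
  rw [mul_assoc, ← mul_sub] at h5
  have h6 : z - g * z = 0 := by
    have := (isUnit_iff_isUnit_det h).2 (hdet h hh).isUnit
    exact (this.mul_right_eq_zero).1 h5
  exact (sub_eq_zero.1 h6).symm

/-- A compact semigroup of invertible matrices is a group. -/
theorem exists_mul_eq_one_of_isCompact [DecidableEq ι] {G : Set (Matrix ι ι ℂ)}
    (hG : IsCompact G) (hmul : ∀ g ∈ G, ∀ h ∈ G, g * h ∈ G)
    (hdet : ∀ g ∈ G, g.det ≠ 0) {g : Matrix ι ι ℂ} (hg : g ∈ G) : ∃ h ∈ G, g * h = 1 := by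
  obtain ⟨e, ⟨h, hh, rfl⟩, he⟩ := exists_idempotent_in_compact_subsemigroup
    (M := Matrix ι ι ℂ) (fun r => continuous_id.mul continuous_const) ((g * ·) '' G)
    ⟨_, g, hg, rfl⟩ (hG.image (continuous_const.mul continuous_id)) (by
      rintro _ ⟨a, ha, rfl⟩ _ ⟨b, hb, rfl⟩
      exact ⟨a * (g * b), hmul a ha _ (hmul g hg b hb), by simp only [mul_assoc]⟩)
  refine ⟨h, hh, ?_⟩
  have hu : IsUnit (g * h) :=
    (isUnit_iff_isUnit_det _).2 (hdet _ (hmul g hg h hh)).isUnit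
  exact hu.mul_left_cancel (by simpa using he)

/-- A compact semigroup of invertible matrices whose traces have nonnegative real part has a
nonzero common fixed vector. -/
theorem exists_fixed_vector_of_isCompact_of_trace_nonneg [DecidableEq ι] [Nonempty ι]
    {G : Set (Matrix ι ι ℂ)}
    (hG : IsCompact G) (hG0 : G.Nonempty) (hmul : ∀ g ∈ G, ∀ h ∈ G, g * h ∈ G)
    (hdet : ∀ g ∈ G, g.det ≠ 0) (htr : ∀ g ∈ G, 0 ≤ g.trace.re) :
    ∃ v : ι → ℂ, v ≠ 0 ∧ ∀ g ∈ G, g *ᵥ v = v := by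
  let _ : NormedAddCommGroup (Matrix ι ι ℂ) := Matrix.normedAddCommGroup
  let _ : NormedSpace ℝ (Matrix ι ι ℂ) := Matrix.normedSpace
  choose! inv hinvG hinv using fun g (hg : g ∈ G) => exists_mul_eq_one_of_isCompact hG hmul hdet hg
  have hcont (h : Matrix ι ι ℂ) : Continuous fun z : Matrix ι ι ℂ => (h * z).trace.re := by
    fun_prop
  have hlin (h : Matrix ι ι ℂ) : IsLinearMap ℝ fun z : Matrix ι ι ℂ => (h * z).trace.re :=
    ⟨fun x y => by simp [mul_add], fun c x => by simp⟩
  obtain ⟨t, htG, ht⟩ := hG.elim_nhds_subcover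
    (fun g => {z | 1 / 2 < (inv g * z).trace.re}) fun g hg => by
      refine (isOpen_lt continuous_const (hcont _)).mem_nhds ?_
      have h1 : (1 : ℝ) ≤ Fintype.card ι := by exact_mod_cast Fintype.card_pos
      simp only [Set.mem_ofPred_eq, mul_eq_one_comm.1 (hinv g hg), trace_one, Complex.natCast_re]
      linarith
  have hhalf : ∀ g ∈ G, 1 / 2 ≤ ((∑ h ∈ t, inv h) * g).trace.re := by
    intro g hg
    obtain ⟨h, hht, hh⟩ := Set.mem_iUnion₂.1 (ht hg)
    rw [Finset.sum_mul, trace_sum, Complex.re_sum]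
    exact (le_of_lt hh).trans (Finset.single_le_sum (f := fun h => (inv h * g).trace.re)
      (fun k hk => htr _ (hmul _ (hinvG k (htG k hk)) g hg)) hht)
  have hKhalf : closedConvexHull ℝ G ⊆ {z | 1 / 2 ≤ ((∑ h ∈ t, inv h) * z).trace.re} :=
    closedConvexHull_min hhalf (convex_halfSpace_ge (hlin _) _)
      (isClosed_le continuous_const (hcont _))
  have hK : IsCompact (closedConvexHull ℝ G) := by
    rw [closedConvexHull_eq_closure_convexHull]
    exact (isBounded_convexHull.2 hG.isBounded).isCompact_closure
  have hinvK : ∀ g ∈ G, ∀ z ∈ closedConvexHull ℝ G, g * z ∈ closedConvexHull ℝ G := by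
    intro g hg
    refine closedConvexHull_min (t := (g * ·) ⁻¹' closedConvexHull ℝ G)
      (fun h hh => subset_closedConvexHull (hmul g hg h hh)) ?_ ?_
    · exact convex_closedConvexHull.is_linear_preimage
        ⟨fun x y => mul_add g x y, fun c x => mul_smul_comm c g x⟩
    · exact isClosed_closedConvexHull.preimage (continuous_const.mul continuous_id)
  obtain ⟨z, hz, hfix⟩ := exists_fixed_of_isCompact_of_convex hG hG0 hmul hdet hK
    (hG0.mono subset_closedConvexHull) convex_closedConvexHull hinvK
  have hz0 : z ≠ 0 := by
    rintro rfl
    have := hKhalf hz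
    norm_num at this
  obtain ⟨j, hj⟩ : ∃ j, z.col j ≠ 0 := by
    by_contra! h
    exact hz0 (Matrix.ext fun i j => congrFun (h j) i)
  refine ⟨z.col j, hj, fun g hg => ?_⟩
  ext i
  exact congrFun (congrFun (hfix g hg) i) j

/-- In a closed homogeneous semigroup of matrices with nonnegative traces all of whose nonzero
members are invertible, the identity occurs and all members have a common eigenvector. -/
theorem one_mem_and_exists_common_eigenvector [DecidableEq ι] [Nonempty ι]
    {R : Set (Matrix ι ι ℂ)} (hclosed : IsClosed R)
    (hsmul : ∀ c : ℝ, 0 ≤ c → ∀ A ∈ R, c • A ∈ R) (hmul : ∀ A ∈ R, ∀ B ∈ R, A * B ∈ R)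
    (hdet : ∀ A ∈ R, A ≠ 0 → A.det ≠ 0) (htr : ∀ A ∈ R, 0 ≤ A.trace.re)
    (hne : ∃ A ∈ R, A ≠ 0) :
    1 ∈ R ∧ ∃ v : ι → ℂ, v ≠ 0 ∧ ∀ A ∈ R, ∃ c : ℂ, A *ᵥ v = c • v := by
  let _ : NormedAddCommGroup (Matrix ι ι ℂ) := Matrix.normedAddCommGroup
  let _ : NormedSpace ℝ (Matrix ι ι ℂ) := Matrix.normedSpace
  have hcard : Fintype.card ι ≠ 0 := Fintype.card_ne_zero
  have hdetsmul (c : ℝ) (hc : 0 ≤ c) (A : Matrix ι ι ℂ) :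
      ‖(c • A).det‖ = c ^ Fintype.card ι * ‖A.det‖ := by
    rw [← Complex.coe_smul, det_smul, norm_mul, norm_pow, Complex.norm_of_nonneg hc]
  have hdetc : Continuous fun A : Matrix ι ι ℂ => ‖A.det‖ := by fun_prop
  let G : Set (Matrix ι ι ℂ) := {A | A ∈ R ∧ ‖A.det‖ = 1}
  have hGclosed : IsClosed G := hclosed.inter (isClosed_eq hdetc continuous_const)
  have hGdet : ∀ g ∈ G, g.det ≠ 0 := fun g hg h => by simpa [h] using hg.2
  have hG : IsCompact G := by
    refine Metric.isCompact_of_isClosed_isBounded hGclosed ?_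
    have hU : IsCompact (R ∩ Metric.sphere 0 1) := (isCompact_sphere _ _).inter_left hclosed
    have hscale {A : Matrix ι ι ℂ} (hA : A ∈ G) : A ≠ 0 ∧ ‖A‖⁻¹ • A ∈ R ∩ Metric.sphere 0 1 := by
      have hA0 : A ≠ 0 := by
        rintro rfl
        exact hGdet _ hA det_zero
      refine ⟨hA0, hsmul _ (by positivity) A hA.1, ?_⟩
      rw [mem_sphere_zero_iff_norm, norm_smul, norm_inv, norm_norm,
        inv_mul_cancel₀ (norm_ne_zero_iff.2 hA0)]
    rcases (R ∩ Metric.sphere (0 : Matrix ι ι ℂ) 1).eq_empty_or_nonempty with h0 | h0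
    · have : G = ∅ := Set.eq_empty_of_forall_notMem fun A hA => by
        simpa [h0] using (hscale hA).2
      simp [this]
    · obtain ⟨B, hB, hmin⟩ := hU.exists_isMinOn h0 hdetc.continuousOn
      have hB0 : 0 < ‖B.det‖ := norm_pos_iff.2 (hdet B hB.1 (by
        rintro rfl
        simpa using hB.2))
      refine isBounded_iff_forall_norm_le.2 ⟨max 1 ‖B.det‖⁻¹, fun A hA => ?_⟩
      rcases le_total ‖A‖ 1 with h1 | h1
      · exact h1.trans (le_max_left _ _)
      · refine le_trans ?_ (le_max_right _ _)
        have h2 : ‖B.det‖ ≤ ‖(‖A‖⁻¹ • A).det‖ := hmin (hscale hA).2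
        rw [hdetsmul _ (by positivity), hA.2, mul_one, inv_pow] at h2
        have h3 := le_inv_of_le_inv₀ hB0 h2
        exact (le_self_pow₀ h1 hcard).trans h3
  have hGmul : ∀ g ∈ G, ∀ h ∈ G, g * h ∈ G := fun g hg h hh =>
    ⟨hmul g hg.1 h hh.1, by rw [det_mul, norm_mul, hg.2, hh.2, mul_one]⟩
  have hnormalize : ∀ A ∈ R, A ≠ 0 → ∃ c : ℝ, c ≠ 0 ∧ c • A ∈ G := by
    intro A hA hA0
    have hd : 0 < ‖A.det‖ := norm_pos_iff.2 (hdet A hA hA0)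
    have hc : 0 < (‖A.det‖⁻¹ ^ (Fintype.card ι : ℝ)⁻¹ : ℝ) := by positivity
    refine ⟨_, hc.ne', hsmul _ hc.le A hA, ?_⟩
    rw [hdetsmul _ hc.le, Real.rpow_inv_natCast_pow (by positivity) hcard,
      inv_mul_cancel₀ hd.ne']
  have hG0 : G.Nonempty := by
    obtain ⟨A, hA, hA0⟩ := hne
    obtain ⟨c, -, hc⟩ := hnormalize A hA hA0
    exact ⟨_, hc⟩
  constructor
  · obtain ⟨g, hg⟩ := hG0
    obtain ⟨h, hh, hgh⟩ := exists_mul_eq_one_of_isCompact hG hGmul hGdet hg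
    exact hgh ▸ hmul g hg.1 h hh.1
  · obtain ⟨v, hv, hfix⟩ := exists_fixed_vector_of_isCompact_of_trace_nonneg hG hG0 hGmul hGdet
      fun g hg => htr g hg.1
    refine ⟨v, hv, fun A hA => ?_⟩
    by_cases hA0 : A = 0
    · exact ⟨0, by simp [hA0]⟩
    · obtain ⟨c, hc, hcA⟩ := hnormalize A hA hA0
      refine ⟨((c⁻¹ : ℝ) : ℂ), ?_⟩
      have h := hfix _ hcA
      rw [smul_mulVec] at h
      rw [Complex.coe_smul]
      nth_rewrite 2 [← h]
      rw [smul_smul, inv_mul_cancel₀ hc, one_smul]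

theorem det_ne_zero_of_card_le_rank {K : Type*} [Field K] [DecidableEq ι] {A : Matrix ι ι K}
    (h : Fintype.card ι ≤ A.rank) : A.det ≠ 0 := by
  have htop : LinearMap.range A.mulVecLin = ⊤ := by
    apply Submodule.eq_top_of_finrank_eq
    rw [Module.finrank_fintype_fun_eq_card]
    exact le_antisymm A.rank_le_card_width h
  exact ((isUnit_iff_isUnit_det A).1
    (mulVec_surjective_iff_isUnit.1 (LinearMap.range_eq_top.1 htop))).ne_zero

theorem exists_mul_eq_of_rank_eq {K : Type*} [Field K] [DecidableEq ι] (A : Matrix ι ι K)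
    {r : ℕ} (h : A.rank = r) :
    ∃ (P : Matrix ι (Fin r) K) (Q : Matrix (Fin r) ι K), P * Q = A := by
  let e : LinearMap.range A.mulVecLin ≃ₗ[K] (Fin r → K) :=
    LinearEquiv.ofFinrankEq _ _ (by rw [Module.finrank_fin_fun]; exact h)
  refine ⟨LinearMap.toMatrix' ((LinearMap.range A.mulVecLin).subtype ∘ₗ e.symm.toLinearMap),
    LinearMap.toMatrix' (e.toLinearMap ∘ₗ A.mulVecLin.rangeRestrict), ?_⟩
  rw [← LinearMap.toMatrix'_comp]
  conv_rhs => rw [← LinearMap.toMatrix'_toLin' A, toLin'_apply']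
  congr 1
  ext v
  simp

/-- The orbit of a nonzero vector under an irreducible semigroup of matrices spans the space. -/
theorem span_orbit_eq_top_of_irreducible {S : Set (Matrix ι ι ℂ)}
    (hι : 2 ≤ Fintype.card ι) (hmul : ∀ A ∈ S, ∀ B ∈ S, A * B ∈ S)
    (hirr : ∀ p : Submodule ℂ (ι → ℂ), (∀ A ∈ S, ∀ v ∈ p, A *ᵥ v ∈ p) → p = ⊥ ∨ p = ⊤)
    {v : ι → ℂ} (hv : v ≠ 0) : Submodule.span ℂ {w | ∃ A ∈ S, A *ᵥ v = w} = ⊤ := by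
  refine (hirr _ fun A hA w hw => ?_).resolve_left fun hbot => ?_
  · refine Submodule.span_induction (p := fun w _ => A *ᵥ w ∈ Submodule.span ℂ _)
      ?_ ?_ ?_ ?_ hw
    · rintro _ ⟨B, hB, rfl⟩
      exact Submodule.subset_span ⟨A * B, hmul A hA B hB, (mulVec_mulVec _ _ _).symm⟩
    · simp
    · intro x y _ _ hx hy
      rw [mulVec_add]
      exact add_mem hx hy
    · intro c x _ hx
      rw [mulVec_smul]
      exact Submodule.smul_mem _ c hx
  · have hzero : ∀ A ∈ S, A *ᵥ v = 0 := fun A hA =>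
      Submodule.span_eq_bot.1 hbot _ ⟨A, hA, rfl⟩
    rcases hirr (Submodule.span ℂ {v}) fun A hA w hw => by
      obtain ⟨c, rfl⟩ := Submodule.mem_span_singleton.1 hw
      simp [mulVec_smul, hzero A hA] with h | h
    · exact hv (Submodule.span_singleton_eq_bot.1 h)
    · have := finrank_span_singleton (K := ℂ) hv
      rw [h, finrank_top, Module.finrank_fintype_fun_eq_card] at this
      omega

end Matrix

/-- An irreducible, homogenization-closed and topologically closed semigroup
of complex matrices with nonnegative diagonals contains a matrix of rank exactly one. -/
theorem stmt_16 {n : ℕ} (hn : 2 ≤ n) (S : Set (Matrix (Fin n) (Fin n) ℂ))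
    (hsemi : ∀ A ∈ S, ∀ B ∈ S, A * B ∈ S)
    (hirr : ∀ p : Submodule ℂ (Fin n → ℂ),
      (∀ A ∈ S, ∀ v ∈ p, A.mulVec v ∈ p) → p = ⊥ ∨ p = ⊤)
    (hclos : closure {M | ∃ r : ℝ, 0 ≤ r ∧ ∃ A ∈ S, M = (r : ℂ) • A} = S)
    (hdiag : ∀ A ∈ S, ∀ i, 0 ≤ (A i i).re ∧ (A i i).im = 0) :
    ∃ A ∈ S, A.rank = 1 := by
  have hclosed : IsClosed S := hclos ▸ isClosed_closure
  have hsmul : ∀ c : ℝ, 0 ≤ c → ∀ A ∈ S, c • A ∈ S := fun c hc A hA =>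
    hclos ▸ subset_closure ⟨c, hc, A, hA, (Complex.coe_smul c A).symm⟩
  have htr : ∀ A ∈ S, 0 ≤ A.trace.re := fun A hA => by
    rw [trace, Complex.re_sum]
    exact Finset.sum_nonneg fun i _ => (hdiag A hA i).1
  have horbit {v : Fin n → ℂ} (hv : v ≠ 0) :
      Submodule.span ℂ {w | ∃ A ∈ S, A *ᵥ v = w} = ⊤ :=
    span_orbit_eq_top_of_irreducible (by simpa using hn) hsemi hirr hv
  have hsingle (i : Fin n) : (Pi.single i 1 : Fin n → ℂ) ≠ 0 := by simp
  have hne : {A | A ∈ S ∧ A ≠ 0}.Nonempty := by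
    by_contra! h
    have h0 : ∀ A ∈ S, A = 0 := fun A hA => by
      by_contra hA0
      exact Set.eq_empty_iff_forall_notMem.1 h A ⟨hA, hA0⟩
    have hbot := horbit (hsingle ⟨0, by omega⟩)
    rw [Submodule.span_eq_bot.2 (by rintro _ ⟨A, hA, rfl⟩; rw [h0 A hA, zero_mulVec])] at hbot
    exact hsingle ⟨0, by omega⟩ ((Submodule.mem_bot ℂ).1 (hbot ▸ Submodule.mem_top))
  obtain ⟨A, ⟨hA, hA0⟩, hmin⟩ := (measure Matrix.rank).wf.has_min _ hne
  replace hmin : ∀ B ∈ S, B ≠ 0 → A.rank ≤ B.rank := fun B hB hB0 => not_lt.1 (hmin B ⟨hB, hB0⟩)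
  obtain ⟨B, hB, hAB⟩ : ∃ B ∈ S, (A * B).trace ≠ 0 := by
    by_contra! h
    refine hA0 (Matrix.ext fun i => congrFun ?_)
    have hrow : ∀ B ∈ S, A i ⬝ᵥ (B *ᵥ Pi.single i 1) = 0 := fun B hB => by
      have h1 := congrArg Complex.re (h B hB)
      rw [trace, Complex.re_sum, Complex.zero_re, Finset.sum_eq_zero_iff_of_nonneg
        (f := fun j => ((A * B).diag j).re) fun j _ => (hdiag _ (hsemi A hA B hB) j).1] at h1
      rw [mulVec_single_one]
      exact Complex.ext (h1 i (Finset.mem_univ i)) (hdiag _ (hsemi A hA B hB) i).2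
    have hall : ∀ w, A i ⬝ᵥ w = 0 := fun w => by
      refine Submodule.span_induction (p := fun w _ => A i ⬝ᵥ w = 0) ?_ ?_ ?_ ?_
        (horbit (hsingle i) ▸ Submodule.mem_top : w ∈ Submodule.span ℂ _)
      · rintro _ ⟨B, hB, rfl⟩
        exact hrow B hB
      · simp
      · intro x y _ _ hx hy
        simp [dotProduct_add, hx, hy]
      · intro c x _ hx
        simp [dotProduct_smul, hx]
    exact dotProduct_eq_zero (A i) hall
  have hT := hsemi A hA B hB
  set T := A * B
  have hT0 : T ≠ 0 := by
    intro h
    simp [h] at hAB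
  have hTrank : T.rank = A.rank := le_antisymm (rank_mul_le_left A B) (hmin T hT hT0)
  have hTT0 : T * T ≠ 0 := fun h => hAB <|
    (isNilpotent_trace_of_isNilpotent ⟨2, by rw [pow_two, h]⟩).eq_zero
  generalize A.rank = r at hmin hTrank
  obtain ⟨P, Q, hPQ⟩ := exists_mul_eq_of_rank_eq T hTrank
  have hr0 : 0 < r := by
    by_contra! h
    obtain rfl : r = 0 := by omega
    exact hT0 (by rw [← hPQ, Subsingleton.elim P 0, Matrix.zero_mul])
  have hQP : (Q * P).det ≠ 0 := by
    refine det_ne_zero_of_card_le_rank ?_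
    rw [Fintype.card_fin]
    refine (hmin _ (hsemi T hT T hT) hTT0).trans ?_
    rw [← hPQ, show P * Q * (P * Q) = P * (Q * P) * Q by simp only [Matrix.mul_assoc]]
    exact (rank_mul_le_left _ _).trans (rank_mul_le_right _ _)
  obtain ⟨L, hLP, hPL⟩ : ∃ L : Matrix (Fin r) (Fin n) ℂ, L * P = 1 ∧ P * (Q * P) * L = T :=
    ⟨(Q * P)⁻¹ * Q, by rw [Matrix.mul_assoc, nonsing_inv_mul _ hQP.isUnit], by
      rw [← Matrix.mul_assoc, Matrix.mul_assoc P, mul_nonsing_inv _ hQP.isUnit, Matrix.mul_one,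
        hPQ]⟩
  have : Nonempty (Fin r) := ⟨⟨0, hr0⟩⟩
  have hcompress (Y : Matrix (Fin r) (Fin r) ℂ) : L * (P * Y * L) * P = Y := by
    rw [show L * (P * Y * L) * P = (L * P) * Y * (L * P) by simp only [Matrix.mul_assoc], hLP,
      Matrix.one_mul, Matrix.mul_one]
  obtain ⟨hone, v, hv, heig⟩ := one_mem_and_exists_common_eigenvector
    (R := {Y : Matrix (Fin r) (Fin r) ℂ | P * Y * L ∈ S})
    (hclosed.preimage (by fun_prop))
    (fun c hc Y hY => by
      have h := hsmul c hc _ hY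
      rwa [← Matrix.smul_mul, ← Matrix.mul_smul] at h)
    (fun Y hY Z hZ => by
      have h := hsemi _ hY _ hZ
      rwa [show P * Y * L * (P * Z * L) = P * Y * (L * P) * Z * L by simp only [Matrix.mul_assoc],
        hLP, Matrix.mul_one, Matrix.mul_assoc P] at h)
    (fun Y hY hY0 => by
      refine det_ne_zero_of_card_le_rank ?_
      rw [Fintype.card_fin]
      refine (hmin _ hY fun h => hY0 ?_).trans
        ((rank_mul_le_left _ _).trans (rank_mul_le_right _ _))
      rw [← hcompress Y, h, Matrix.mul_zero, Matrix.zero_mul])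
    (fun Y hY => by
      have h := htr _ hY
      rwa [trace_mul_cycle, hLP, Matrix.one_mul] at h)
    ⟨Q * P, by
      change P * (Q * P) * L ∈ S
      rwa [hPL], by
      intro h
      rw [h] at hPL
      exact hT0 (by rw [← hPL, Matrix.mul_zero, Matrix.zero_mul])⟩
  replace hone : P * L ∈ S := by
    change P * 1 * L ∈ S at hone
    rwa [Matrix.mul_one] at hone
  have hPv : P *ᵥ v ≠ 0 := fun h => hv <| by
    rw [← one_mulVec v, ← hLP, ← mulVec_mulVec, h, mulVec_zero]
  have hle : ⊤ ≤ (Submodule.span ℂ {v}).comap L.mulVecLin := by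
    rw [← horbit hPv, Submodule.span_le]
    rintro _ ⟨X, hX, rfl⟩
    obtain ⟨c, hc⟩ := heig (L * X * P) (by
      change P * (L * X * P) * L ∈ S
      have h := hsemi _ (hsemi _ hone X hX) _ hone
      simpa only [Matrix.mul_assoc] using h)
    refine Submodule.mem_span_singleton.2 ⟨c, ?_⟩
    rw [← hc, mulVecLin_apply, mulVec_mulVec, mulVec_mulVec]
  have htop : Submodule.span ℂ {v} = ⊤ := eq_top_iff.2 fun u _ => by
    have h : L *ᵥ (P *ᵥ u) ∈ Submodule.span ℂ {v} := hle (Submodule.mem_top (x := P *ᵥ u))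
    rwa [mulVec_mulVec, hLP, one_mulVec] at h
  have hr := finrank_span_singleton (K := ℂ) hv
  rw [htop, finrank_top, Module.finrank_fin_fun] at hr
  exact ⟨T, hT, hTrank.trans hr⟩
end
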